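/- arXiv:1107.4906 — 2 statements merged into one kernel-verified Lean document; each statement's English description precedes it below -/
import Mathlib

section
/- Let s ≥ 9. For s general points of P^1 x P^1 with ideal I, one has sqrt(s) - 1 < γ(I) ≤ sqrt(2s); that is, there is a nonempty Zariski-open subset U of (P^1 x P^1)^s such that for every s-tuple of pairwise distinct points lying in U, with I the ideal of these points, the limit γ(I) of α(I^(m))/m satisfies sqrt(s) - 1 < γ(I) ≤ sqrt(2s). -/
open MvPolynomial

noncomputable section

/-- The weights giving the bigrading on `k[x0,x1,y0,y1]` with
`deg x0 = deg x1 = (1,0)` and `deg y0 = deg y1 = (0,1)`. -/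
def w4 : Fin 4 → ℕ × ℕ := ![(1,0), (1,0), (0,1), (0,1)]

variable (k : Type*) [Field k]

/-- `p = ((a0,a1),(b0,b1))` represents a point `[a0:a1] × [b0:b1]` of `P^1 × P^1`
if neither pair of coordinates is identically zero. -/
def IsPtRep (p : (k × k) × (k × k)) : Prop := p.1 ≠ 0 ∧ p.2 ≠ 0

/-- Two (nonzero) vectors of `k²` define the same point of `P^1`. -/
def ProjEq (u v : k × k) : Prop := u.1 * v.2 = u.2 * v.1

/-- Two representatives define the same point of `P^1 × P^1`. -/
def PtEq (p q : (k × k) × (k × k)) : Prop := ProjEq k p.1 q.1 ∧ ProjEq k p.2 q.2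

/-- The bihomogeneous ideal of the point `[a0:a1] × [b0:b1]`, namely
`(a1*x0 - a0*x1, b1*y0 - b0*y1)`. -/
def pointIdeal (p : (k × k) × (k × k)) : Ideal (MvPolynomial (Fin 4) k) :=
  Ideal.span {C p.1.2 * X 0 - C p.1.1 * X 1, C p.2.2 * X 2 - C p.2.1 * X 3}

/-- The ideal `I(Z) = ∩ I(P_i)` of a finite tuple of points. -/
def idealOfPoints {s : ℕ} (Z : Fin s → (k × k) × (k × k)) :
    Ideal (MvPolynomial (Fin 4) k) :=
  ⨅ i, pointIdeal k (Z i)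

/-- The `m`-th symbolic power `I(Z)^(m) = ∩ I(P_i)^m`. -/
def symbolicPower {s : ℕ} (Z : Fin s → (k × k) × (k × k)) (m : ℕ) :
    Ideal (MvPolynomial (Fin 4) k) :=
  ⨅ i, (pointIdeal k (Z i)) ^ m

/-- The bigraded piece `J_(i,j)` of a bihomogeneous ideal, as a `k`-subspace. -/
def bipiece (J : Ideal (MvPolynomial (Fin 4) k)) (d : ℕ × ℕ) :
    Submodule k (MvPolynomial (Fin 4) k) :=
  (Submodule.restrictScalars k J) ⊓ (weightedHomogeneousSubmodule k w4 d)

/-- `α(J)`: the least total degree `t = i + j` in which `J` has a nonzero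
bihomogeneous element of bidegree `(i,j)`. -/
def alpha (J : Ideal (MvPolynomial (Fin 4) k)) : ℕ :=
  sInf {t | ∃ F ∈ J, F ≠ 0 ∧ ∃ d : ℕ × ℕ, d.1 + d.2 = t ∧ F.IsWeightedHomogeneous w4 d}

/-- The coordinates of a tuple of points of `P^1 × P^1`, as a point of affine `4s`-space. -/
def coordsOf {s : ℕ} (Z : Fin s → (k × k) × (k × k)) : Fin s × Fin 4 → k :=
  fun p => ![(Z p.1).1.1, (Z p.1).1.2, (Z p.1).2.1, (Z p.1).2.2] p.2

/-- The weights making `k[(P^1 × P^1)^s]` multigraded. -/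
def wProd (s : ℕ) : Fin s × Fin 4 → (Fin s → ℕ × ℕ) := fun p => Pi.single p.1 (w4 p.2)

/-- `GeneralPosition k s P` says that property `P` holds for `s` general points of
`P^1 × P^1`: there is a nonempty Zariski-open subset `U` of `(P^1 × P^1)^s` (the
complement of the zero locus of a multihomogeneous form `G` not vanishing identically)
such that `P` holds for every tuple of pairwise distinct points lying in `U`. -/
def GeneralPosition (s : ℕ) (P : (Fin s → (k × k) × (k × k)) → Prop) : Prop :=
  ∃ (G : MvPolynomial (Fin s × Fin 4) k) (d : Fin s → ℕ × ℕ),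
    G.IsWeightedHomogeneous (wProd s) d ∧
    (∃ Z : Fin s → (k × k) × (k × k), (∀ i, IsPtRep k (Z i)) ∧ eval (coordsOf k Z) G ≠ 0) ∧
    ∀ Z : Fin s → (k × k) × (k × k), (∀ i, IsPtRep k (Z i)) →
      (∀ i j, i ≠ j → ¬ PtEq k (Z i) (Z j)) →
      eval (coordsOf k Z) G ≠ 0 → P Z

/-- Distinct points in multiplicity 1 generic position: every subset `S` imposes
independent conditions in every bidegree, i.e.
`dim_k I(S)_(i,j) = max {0, (i+1)(j+1) - |S|}`. -/
def Mult1Generic {s : ℕ} (Z : Fin s → (k × k) × (k × k)) : Prop :=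
  (∀ i, IsPtRep k (Z i)) ∧ (∀ i j, i ≠ j → ¬ PtEq k (Z i) (Z j)) ∧
  ∀ (S : Finset (Fin s)) (i j : ℕ),
    Module.finrank k ↥(bipiece k (⨅ a ∈ S, pointIdeal k (Z a)) (i, j))
      = (i + 1) * (j + 1) - S.card


/-! ### Part 1: a Bezout type inequality by counting dimensions -/

/-- Polynomials whose exponents are `< U` and `< V`. -/
def WW (K : Type*) [Field K] (U V : ℕ) : Submodule K (MvPolynomial (Fin 2) K) :=
  restrictSupport K {e | e 0 < U ∧ e 1 < V}

theorem mem_WW {K : Type*} [Field K] {U V : ℕ} {f : MvPolynomial (Fin 2) K} (hf : f ≠ 0) :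
    f ∈ WW K U V ↔ degreeOf 0 f < U ∧ degreeOf 1 f < V := by
  have hne : f.support.Nonempty := by
    rwa [Finset.nonempty_iff_ne_empty, Ne, MvPolynomial.support_eq_empty]
  rw [WW, mem_restrictSupport_iff]
  obtain ⟨e0, he0⟩ := hne
  constructor
  · intro h
    have h0 := h he0
    simp only [Set.mem_ofPred_eq] at h0
    rw [degreeOf_lt_iff (by omega), degreeOf_lt_iff (by omega)]
    exact ⟨fun m hm => (h hm).1, fun m hm => (h hm).2⟩
  · rintro ⟨h0, h1⟩ m hm
    rw [degreeOf_lt_iff (by omega)] at h0 h1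
    exact ⟨h0 m hm, h1 m hm⟩

theorem exists_WW {K : Type*} [Field K] (f : MvPolynomial (Fin 2) K) :
    ∃ B, ∀ U V, B ≤ U → B ≤ V → f ∈ WW K U V := by
  by_cases hf : f = 0
  · exact ⟨0, fun U V _ _ => by rw [hf]; exact zero_mem _⟩
  · refine ⟨degreeOf 0 f + degreeOf 1 f + 1, fun U V hU hV => ?_⟩
    rw [mem_WW hf]; omega

theorem WW_mul {K : Type*} [Field K] {U V a b U' V' : ℕ} {F f : MvPolynomial (Fin 2) K}
    (ha : degreeOf 0 F = a) (hb : degreeOf 1 F = b) (hF : F ≠ 0)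
    (hU : U' = U + a) (hV : V' = V + b) :
    F * f ∈ WW K U' V' ↔ f ∈ WW K U V := by
  by_cases hf : f = 0
  · simp [hf]
  · rw [mem_WW hf, mem_WW (mul_ne_zero hF hf), degreeOf_mul_eq hF hf, degreeOf_mul_eq hF hf]
    omega

/-- exponents `< U`, `< V` correspond to pairs. -/
def WWequiv (U V : ℕ) : {e : Fin 2 →₀ ℕ | e 0 < U ∧ e 1 < V} ≃ Fin U × Fin V where
  toFun e := (⟨e.1 0, e.2.1⟩, ⟨e.1 1, e.2.2⟩)
  invFun p := ⟨Finsupp.equivFunOnFinite.symm ![p.1.1, p.2.1], by simp⟩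
  left_inv e := by
    apply Subtype.ext
    ext i
    fin_cases i <;> simp
  right_inv p := by simp

instance WW_fin {K : Type*} [Field K] (U V : ℕ) : FiniteDimensional K (WW K U V) := by
  have : Finite {e : Fin 2 →₀ ℕ | e 0 < U ∧ e 1 < V} := Finite.of_equiv _ (WWequiv U V).symm
  exact Module.Finite.of_basis (basisRestrictSupport K {e : Fin 2 →₀ ℕ | e 0 < U ∧ e 1 < V})

theorem finrank_WW {K : Type*} [Field K] (U V : ℕ) : Module.finrank K (WW K U V) = U * V := by
  rw [WW, Module.finrank_eq_nat_card_basis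
    (basisRestrictSupport K {e : Fin 2 →₀ ℕ | e 0 < U ∧ e 1 < V}),
    Nat.card_congr (WWequiv U V)]
  simp

/-- Index set of monomials in two variables of degree `< m`. -/
abbrev TT (m : ℕ) : Type := (d : Fin m) × Fin (d.1 + 1)

theorem card_TT_succ (m : ℕ) : Fintype.card (TT (m + 1)) = Fintype.card (TT m) + (m + 1) := by
  simp [TT, Fin.sum_univ_castSucc]

theorem two_card_TT (m : ℕ) : 2 * Fintype.card (TT m) = m * (m + 1) := by
  induction m with
  | zero => simp
  | succ m ih => rw [card_TT_succ, mul_add, ih]; ring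

/-- the exponent of an index -/
def TTexp {m : ℕ} (t : TT m) : Fin 2 →₀ ℕ :=
  Finsupp.equivFunOnFinite.symm ![t.2.1, t.1.1 - t.2.1]

theorem TTexp_surj {m : ℕ} (e : Fin 2 →₀ ℕ) (he : e.degree < m) : ∃ t : TT m, TTexp t = e := by
  have h : e.degree = e 0 + e 1 := by
    rw [Finsupp.degree_eq_sum]; simp
  refine ⟨⟨⟨e 0 + e 1, by omega⟩, ⟨e 0, by simp⟩⟩, ?_⟩
  ext i
  fin_cases i <;> simp [TTexp]

theorem TTexp_inj {m : ℕ} : Function.Injective (TTexp (m := m)) := by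
  rintro ⟨⟨d, hd⟩, ⟨i, hi⟩⟩ ⟨⟨d', hd'⟩, ⟨i', hi'⟩⟩ h
  have h0 : i = i' := by simpa [TTexp] using DFunLike.congr_fun h 0
  have h1 : d - i = d' - i' := by simpa [TTexp] using DFunLike.congr_fun h 1
  simp only at hi hi'
  have : d = d' := by omega
  subst this h0
  rfl

theorem TTexp_degree {m : ℕ} (t : TT m) : (TTexp t).degree < m := by
  rw [Finsupp.degree_eq_sum]
  obtain ⟨⟨d, hd⟩, ⟨i, hi⟩⟩ := t
  simp [TTexp]
  simp at hi
  omega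

/-- translation to a point -/
def tau {K : Type*} [Field K] (P : K × K) : MvPolynomial (Fin 2) K →ₐ[K] MvPolynomial (Fin 2) K :=
  aeval ![X 0 + C P.1, X 1 + C P.2]

theorem tau_surj {K : Type*} [Field K] (P : K × K) : Function.Surjective (tau P) := by
  intro f
  refine ⟨tau (-P) f, ?_⟩
  have : (tau P).comp (tau (-P)) = AlgHom.id K _ := by
    apply MvPolynomial.algHom_ext
    intro i
    fin_cases i <;> simp [tau]
  exact DFunLike.congr_fun this f

/-- polynomials vanishing to order `m` at `P` -/
def Vp {K : Type*} [Field K] (P : K × K) (m : ℕ) : Ideal (MvPolynomial (Fin 2) K) :=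
  Ideal.comap (tau P) (idealOfVars (Fin 2) K ^ m)

/-- affine ideal of a point -/
def ptI {K : Type*} [Field K] (P : K × K) : Ideal (MvPolynomial (Fin 2) K) :=
  Ideal.span {X 0 - C P.1, X 1 - C P.2}

theorem ptI_pow_le {K : Type*} [Field K] (P : K × K) (m : ℕ) : ptI P ^ m ≤ Vp P m := by
  rw [Vp, ← Ideal.map_le_iff_le_comap, Ideal.map_pow]
  apply Ideal.pow_right_mono
  rw [Ideal.map_le_iff_le_comap, ptI, Ideal.span_le]
  rintro f (rfl | rfl)
  · simp [tau]
    exact Ideal.subset_span ⟨0, rfl⟩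
  · simp [tau]
    exact Ideal.subset_span ⟨1, rfl⟩

theorem Vp_coprime {K : Type*} [Field K] {P Q : K × K} (h : P ≠ Q) (m : ℕ) :
    IsCoprime (Vp P m) (Vp Q m) := by
  have h1 : IsCoprime (ptI P) (ptI Q) := by
    rw [Ideal.isCoprime_iff_exists]
    have : P.1 ≠ Q.1 ∨ P.2 ≠ Q.2 := by
      by_contra hc
      push Not at hc
      exact h (Prod.ext hc.1 hc.2)
    rcases this with h' | h'
    · refine ⟨C (Q.1 - P.1)⁻¹ * (X 0 - C P.1), Ideal.mul_mem_left _ _ (Ideal.subset_span (by simp)),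
        - C (Q.1 - P.1)⁻¹ * (X 0 - C Q.1), Ideal.mul_mem_left _ _ (Ideal.subset_span (by simp)), ?_⟩
      have : (C (Q.1 - P.1)⁻¹ * (C Q.1 - C P.1) : MvPolynomial (Fin 2) K) = 1 := by
        rw [← C_sub, ← C_mul, inv_mul_cancel₀ (sub_ne_zero.2 h'.symm), C_1]
      linear_combination this
    · refine ⟨C (Q.2 - P.2)⁻¹ * (X 1 - C P.2), Ideal.mul_mem_left _ _ (Ideal.subset_span (by simp)),
        - C (Q.2 - P.2)⁻¹ * (X 1 - C Q.2), Ideal.mul_mem_left _ _ (Ideal.subset_span (by simp)), ?_⟩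
      have : (C (Q.2 - P.2)⁻¹ * (C Q.2 - C P.2) : MvPolynomial (Fin 2) K) = 1 := by
        rw [← C_sub, ← C_mul, inv_mul_cancel₀ (sub_ne_zero.2 h'.symm), C_1]
      linear_combination this
  have h2 : IsCoprime (ptI P ^ m) (ptI Q ^ m) := h1.pow
  rw [Ideal.isCoprime_iff_exists] at h2 ⊢
  obtain ⟨a, ha, b, hb, hab⟩ := h2
  exact ⟨a, ptI_pow_le _ _ ha, b, ptI_pow_le _ _ hb, hab⟩

theorem mul_mem_Vp {K : Type*} [Field K] {P : K × K} {m : ℕ} {H f : MvPolynomial (Fin 2) K}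
    (hH : eval ![P.1, P.2] H = 0) (hf : f ∈ Vp P m) : H * f ∈ Vp P (m + 1) := by
  simp only [Vp, Ideal.mem_comap, map_mul] at hf ⊢
  rw [pow_succ', ]
  refine Ideal.mul_mem_mul ?_ hf
  rw [← pow_one (idealOfVars (Fin 2) K), mem_pow_idealOfVars_iff']
  intro e he
  have : e = 0 := by rwa [Nat.lt_one_iff, Finsupp.degree_eq_zero_iff] at he
  subst this
  rw [← hH, ← MvPolynomial.constantCoeff_eq]
  have : (constantCoeff (R := K)).comp (tau P).toRingHom
      = eval ![P.1, P.2] := by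
    apply MvPolynomial.ringHom_ext
    · intro r; simp
    · intro i; fin_cases i <;> simp [tau]
  exact DFunLike.congr_fun this H

/-- Taylor coefficients of order `< m` at several points. -/
def LL {K : Type*} [Field K] {ι : Type*} (p : ι → K × K) (m : ℕ) :
    MvPolynomial (Fin 2) K →ₗ[K] (ι × TT m → K) :=
  LinearMap.pi fun x => (lcoeff K (TTexp x.2)).comp (tau (p x.1)).toLinearMap

theorem LL_apply {K : Type*} [Field K] {ι : Type*} (p : ι → K × K) (m : ℕ)
    (f : MvPolynomial (Fin 2) K) (x : ι × TT m) :
    LL p m f x = coeff (TTexp x.2) (tau (p x.1) f) := rfl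

theorem LL_ker {K : Type*} [Field K] {ι : Type*} (p : ι → K × K) (m : ℕ)
    (f : MvPolynomial (Fin 2) K) : LL p m f = 0 ↔ ∀ i, f ∈ Vp (p i) m := by
  simp only [Vp, Ideal.mem_comap, mem_pow_idealOfVars_iff', funext_iff, LL_apply, Pi.zero_apply]
  constructor
  · intro h i e he
    obtain ⟨t, rfl⟩ := TTexp_surj e he
    exact h (i, t)
  · intro h x
    exact h x.1 _ (TTexp_degree _)

theorem LL_surj {K : Type*} [Field K] {ι : Type*} [Finite ι] (p : ι → K × K)
    (hp : Function.Injective p) (m : ℕ) : Function.Surjective (LL p m) := by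
  intro c
  have h1 : ∀ i, ∃ f, ∀ t, coeff (TTexp t) (tau (p i) f) = c (i, t) := by
    intro i
    obtain ⟨f, hf⟩ := tau_surj (p i) (∑ t : TT m, monomial (TTexp t) (c (i, t)))
    refine ⟨f, fun t => ?_⟩
    rw [hf, coeff_sum, Finset.sum_eq_single t]
    · simp
    · intro b _ hb
      rw [coeff_monomial, if_neg]
      exact fun h => hb (TTexp_inj h)
    · simp
  choose g hg using h1
  obtain ⟨r, hr⟩ := Ideal.exists_forall_sub_mem_ideal
    (I := fun i => Vp (p i) m) (fun i j hij => Vp_coprime (fun h => hij (hp h)) m) g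
  refine ⟨r, funext fun x => ?_⟩
  rw [LL_apply, ← hg]
  have := hr x.1
  simp only [Vp, Ideal.mem_comap, mem_pow_idealOfVars_iff', map_sub, coeff_sub] at this
  exact sub_eq_zero.1 (this _ (TTexp_degree x.2))

theorem finrank_inf_ker {K M N : Type*} [Field K] [AddCommGroup M] [Module K M]
    [AddCommGroup N] [Module K N] (L : M →ₗ[K] N) (W : Submodule K M) [FiniteDimensional K W] :
    Module.finrank K (W.map L) + Module.finrank K (W ⊓ LinearMap.ker L : Submodule K M)
      = Module.finrank K W := by
  have h := LinearMap.finrank_range_add_finrank_ker (L.domRestrict W)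
  rw [LinearMap.range_domRestrict, LinearMap.ker_domRestrict] at h
  rw [← h]
  congr 1
  have e := Submodule.equivMapOfInjective W.subtype W.subtype_injective
    ((LinearMap.ker L).comap W.subtype)
  rw [e.finrank_eq, Submodule.map_comap_subtype]

theorem finrank_map_inj {K M N : Type*} [Field K] [AddCommGroup M] [Module K M]
    [AddCommGroup N] [Module K N] (L : M →ₗ[K] N) (hL : Function.Injective L)
    (W : Submodule K M) : Module.finrank K (W.map L) = Module.finrank K W :=
  (Submodule.equivMapOfInjective L hL W).finrank_eq.symm

theorem exists_WW_map {K : Type*} [Field K] {N : Type*} [AddCommGroup N] [Module K N]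
    [FiniteDimensional K N] (L : MvPolynomial (Fin 2) K →ₗ[K] N) (hL : Function.Surjective L) :
    ∃ B, ∀ U V, B ≤ U → B ≤ V → (WW K U V).map L = ⊤ := by
  obtain ⟨n, b, hb⟩ := Module.Finite.exists_fin (R := K) (M := N)
  choose g hg using fun i => hL (b i)
  choose B hB using fun i => exists_WW (g i)
  refine ⟨∑ i, B i, fun U V hU hV => ?_⟩
  rw [eq_top_iff, ← hb, Submodule.span_le]
  rintro _ ⟨i, rfl⟩
  have := Finset.single_le_sum (f := B) (fun _ _ => Nat.zero_le _) (Finset.mem_univ i)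
  exact ⟨g i, hB i U V (by omega) (by omega), hg i⟩

theorem mulLeft_inj {K : Type*} [Field K] {F : MvPolynomial (Fin 2) K} (hF : F ≠ 0) :
    Function.Injective (LinearMap.mulLeft K F) := fun _ _ h => mul_left_cancel₀ hF h

theorem bezout {K : Type*} [Field K] {ι : Type*} [Fintype ι] (p : ι → K × K)
    (hp : Function.Injective p) (m : ℕ) (F H : MvPolynomial (Fin 2) K) (hF : F ≠ 0) (hH : H ≠ 0)
    (hFH : IsRelPrime F H) (hFv : ∀ i, F ∈ Vp (p i) (m + 1))
    (hHv : ∀ i, eval ![(p i).1, (p i).2] H = 0) :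
    Fintype.card ι * (m + 1) ≤ degreeOf 0 F * degreeOf 1 H + degreeOf 1 F * degreeOf 0 H := by
  obtain ⟨B, hB⟩ := exists_WW_map (LL p (m + 1)) (LL_surj p hp (m + 1))
  obtain ⟨a, ha⟩ : ∃ a, degreeOf 0 F = a := ⟨_, rfl⟩
  obtain ⟨b, hb⟩ : ∃ a, degreeOf 1 F = a := ⟨_, rfl⟩
  obtain ⟨c, hc⟩ : ∃ a, degreeOf 0 H = a := ⟨_, rfl⟩
  obtain ⟨d, hd⟩ : ∃ a, degreeOf 1 H = a := ⟨_, rfl⟩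
  rw [ha, hb, hc, hd]
  set W := WW K (B + a + c) (B + b + d)
  set S1 := (WW K (B + c) (B + d)).map (LinearMap.mulLeft K F)
  set S2 := (WW K (B + a) (B + b) ⊓ LinearMap.ker (LL p m)).map (LinearMap.mulLeft K H)
  set S3 := (WW K B B).map (LinearMap.mulLeft K (F * H))
  set T := W ⊓ LinearMap.ker (LL p (m + 1))
  have hT := finrank_inf_ker (LL p (m + 1)) W
  rw [hB _ _ (by omega) (by omega), finrank_top, finrank_WW] at hT
  have h2 := finrank_inf_ker (LL p m) (WW K (B + a) (B + b))
  rw [finrank_WW] at h2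
  have h2' := Submodule.finrank_le ((WW K (B + a) (B + b)).map (LL p m))
  rw [Module.finrank_fintype_fun_eq_card, Fintype.card_prod] at hT h2'
  have e1 : Module.finrank K S1 = (B + c) * (B + d) := by
    rw [finrank_map_inj _ (mulLeft_inj hF), finrank_WW]
  have e2 := finrank_map_inj _ (mulLeft_inj hH) (WW K (B + a) (B + b) ⊓ LinearMap.ker (LL p m))
  have e3 : Module.finrank K S3 = B * B := by
    rw [finrank_map_inj _ (mulLeft_inj (mul_ne_zero hF hH)), finrank_WW]
  have hle : S1 ⊔ S2 ≤ T := by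
    refine sup_le ?_ ?_
    · rintro _ ⟨f, hf, rfl⟩
      refine ⟨(WW_mul ha hb hF (by omega) (by omega)).2 hf, ?_⟩
      rw [SetLike.mem_coe, LinearMap.mem_ker, LL_ker]
      exact fun i => Ideal.mul_mem_right _ _ (hFv i)
    · rintro _ ⟨f, ⟨hf, hf'⟩, rfl⟩
      refine ⟨(WW_mul hc hd hH (by omega) (by omega)).2 hf, ?_⟩
      rw [SetLike.mem_coe, LinearMap.mem_ker, LL_ker] at hf' ⊢
      exact fun i => mul_mem_Vp (hHv i) (hf' i)
  have hinf : S1 ⊓ S2 ≤ S3 := by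
    rintro x ⟨⟨f, hf, rfl⟩, ⟨g, ⟨hg, -⟩, hfg⟩⟩
    simp only [LinearMap.mulLeft_apply] at hfg
    have h1 : H ∣ F * f := ⟨g, hfg.symm⟩
    obtain ⟨f', rfl⟩ := (hFH.symm.dvd_of_dvd_mul_left h1)
    refine ⟨f', (WW_mul hc hd hH rfl rfl).1 hf, ?_⟩
    simp
  have hs := Submodule.finrank_sup_add_finrank_inf_eq S1 S2
  have i1 := Submodule.finrank_mono hle
  have i2 := Submodule.finrank_mono hinf
  rw [e1, e2] at hs
  rw [e3] at i2
  rw [card_TT_succ] at hT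
  change _ + Module.finrank K T = _ at hT
  nlinarith

theorem exists_relPrime {K : Type*} [Field K] [Infinite K] (F A B : MvPolynomial (Fin 2) K)
    (hF : F ≠ 0) (hAB : IsRelPrime A B) : ∃ t : K, IsRelPrime F (A + C t * B) := by
  classical
  by_contra hcon
  push Not at hcon
  have h1 : ∀ t : K, ∃ f ∈ UniqueFactorizationMonoid.factors F, f ∣ A + C t * B := by
    intro t
    have := hcon t
    by_contra h2
    push Not at h2
    apply this
    apply WfDvdMonoid.isRelPrime_of_no_irreducible_factors (fun h => hF h.1)
    intro d hp hd1 hd2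
    obtain ⟨q, hq, hqd⟩ :=
      UniqueFactorizationMonoid.exists_mem_factors_of_dvd hF hp hd1
    exact h2 q hq (hqd.symm.dvd.trans hd2)
  choose f hf hdvd using h1
  obtain ⟨t, t', htt, hff⟩ := Finite.exists_ne_map_eq_of_infinite
    (fun t => (⟨f t, by simpa using hf t⟩ :
      {x // x ∈ (UniqueFactorizationMonoid.factors F).toFinset}))
  simp only [Subtype.mk.injEq] at hff
  have hd1 := hdvd t
  have hd2 := hdvd t'
  rw [← hff] at hd2
  have hirr := UniqueFactorizationMonoid.irreducible_of_factor _ (hf t)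
  have hB : f t ∣ B := by
    have := dvd_sub hd1 hd2
    have e : A + C t * B - (A + C t' * B) = C (t - t') * B := by rw [C_sub]; ring
    rw [e] at this
    have hu : IsUnit (C (t - t') : MvPolynomial (Fin 2) K) :=
      (IsUnit.mk0 _ (sub_ne_zero.2 htt)).map C
    exact (hu.dvd_mul_left).1 this
  have hA : f t ∣ A := (dvd_add_left (hB.mul_left _)).1 hd1
  exact hirr.not_isUnit (hAB hA hB)

/-- The main lower bound. -/
theorem affine_lower {K : Type*} [Field K] [Infinite K] {ι : Type*} [Fintype ι] (p : ι → K × K)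
    (hp : Function.Injective p) (m q a b : ℕ) (F A B : MvPolynomial (Fin 2) K) (hF : F ≠ 0)
    (hFa : degreeOf 0 F ≤ a) (hFb : degreeOf 1 F ≤ b)
    (hAB : IsRelPrime A B) (hA : ∀ i, degreeOf i A ≤ q) (hB : ∀ i, degreeOf i B ≤ q)
    (hq : Fintype.card ι = q ^ 2) (hq0 : 0 < q)
    (hFv : ∀ i, F ∈ ptI (p i) ^ m)
    (hAv : ∀ i, eval ![(p i).1, (p i).2] A = 0) (hBv : ∀ i, eval ![(p i).1, (p i).2] B = 0) :
    q * m ≤ a + b := by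
  rcases m with _ | m
  · simp
  obtain ⟨t, ht⟩ := exists_relPrime F A B hF hAB
  have hv : ∀ i, eval ![(p i).1, (p i).2] (A + C t * B) = 0 := by
    intro i; simp [hAv, hBv]
  have hFv' : ∀ i, F ∈ Vp (p i) (m + 1) := fun i => ptI_pow_le _ _ (hFv i)
  have hdeg : ∀ i, degreeOf i (A + C t * B) ≤ q := by
    intro i
    refine (degreeOf_add_le _ _ _).trans (max_le (hA i) ?_)
    exact (degreeOf_C_mul_le _ _ _).trans (hB i)
  by_cases h0 : A + C t * B = 0
  · exfalso
    rw [h0] at ht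
    have hu : IsUnit F := ht dvd_rfl (dvd_zero F)
    have : Nonempty ι := by
      rw [← Fintype.card_pos_iff, hq]; positivity
    obtain ⟨i⟩ := this
    have h1 := Ideal.eq_top_of_isUnit_mem _ (hFv' i) hu
    have h2 : (1 : MvPolynomial (Fin 2) K) ∈ Vp (p i) (m + 1) := by rw [h1]; trivial
    simp only [Vp, Ideal.mem_comap, map_one, mem_pow_idealOfVars_iff'] at h2
    have := h2 0 (by simp)
    simp at this
  · have := bezout p hp m F _ hF h0 ht hFv' hv
    rw [hq] at this
    have h1 : degreeOf 0 F * degreeOf 1 (A + C t * B) ≤ a * q := Nat.mul_le_mul hFa (hdeg 1)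
    have h2 : degreeOf 1 F * degreeOf 0 (A + C t * B) ≤ b * q := Nat.mul_le_mul hFb (hdeg 0)
    have h3 : q * (q * (m + 1)) ≤ q * (a + b) := by nlinarith
    exact Nat.le_of_mul_le_mul_left h3 hq0

/-! ### Part 3: curves through general points -/

/-- evaluation matrix -/
def MM {S : Type*} [CommRing S] {q : ℕ} (x y : Fin q × Fin q → S) :
    Matrix (Fin q × Fin q) (Fin q × Fin q) S :=
  Matrix.of fun e f => x e ^ f.1.1 * y e ^ f.2.1

/-- values of the pure power -/
def vv {S : Type*} [CommRing S] {q : ℕ} (x y : Fin q × Fin q → S) (i : Fin 2) :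
    Fin q × Fin q → S := fun e => (![x e, y e] i) ^ q

/-- coefficients -/
def cc {S : Type*} [CommRing S] {q : ℕ} (x y : Fin q × Fin q → S) (i : Fin 2) :
    Fin q × Fin q → S := Matrix.mulVec (MM x y).adjugate (vv x y i)

/-- the curve -/
def cur {S : Type*} [CommRing S] {q : ℕ} (x y : Fin q × Fin q → S) (i : Fin 2) :
    MvPolynomial (Fin 2) S :=
  C (MM x y).det * X i ^ q - ∑ f, C (cc x y i f) * (X 0 ^ f.1.1 * X 1 ^ f.2.1)

/-- specialization `X 1 = ξ` -/
def spec {S : Type*} [CommRing S] (ξ : S) : MvPolynomial (Fin 2) S →+* Polynomial S :=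
  eval₂Hom Polynomial.C ![Polynomial.X, Polynomial.C ξ]

/-- the certificate -/
def cert {S : Type*} [CommRing S] {q : ℕ} (x y : Fin q × Fin q → S) (ξ : S) : S :=
  (MM x y).det * Polynomial.resultant (spec ξ (cur x y 0)) (spec ξ (cur x y 1)) q q

theorem MM_map {S S' : Type*} [CommRing S] [CommRing S'] {q : ℕ} (x y : Fin q × Fin q → S)
    (ψ : S →+* S') : MM (fun e => ψ (x e)) (fun e => ψ (y e)) = (MM x y).map ψ := by
  ext e f
  simp [MM]

theorem cc_map {S S' : Type*} [CommRing S] [CommRing S'] {q : ℕ} (x y : Fin q × Fin q → S)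
    (ψ : S →+* S') (i : Fin 2) (f) :
    cc (fun e => ψ (x e)) (fun e => ψ (y e)) i f = ψ (cc x y i f) := by
  have h : vv (fun e => ψ (x e)) (fun e => ψ (y e)) i = ψ ∘ vv x y i := by
    ext e
    fin_cases i <;> simp [vv]
  rw [cc, cc, MM_map, h, RingHom.map_mulVec]
  congr 2
  exact (RingHom.map_adjugate ψ (MM x y)).symm

theorem cur_map {S S' : Type*} [CommRing S] [CommRing S'] {q : ℕ} (x y : Fin q × Fin q → S)
    (ψ : S →+* S') (i : Fin 2) :
    cur (fun e => ψ (x e)) (fun e => ψ (y e)) i = MvPolynomial.map ψ (cur x y i) := by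
  have hd : (MM (fun e => ψ (x e)) (fun e => ψ (y e))).det = ψ (MM x y).det := by
    rw [MM_map, RingHom.map_det]; rfl
  rw [cur, cur, hd]
  simp [cc_map]

theorem spec_map {S S' : Type*} [CommRing S] [CommRing S'] (ξ : S)
    (ψ : S →+* S') (F : MvPolynomial (Fin 2) S) :
    spec (ψ ξ) (MvPolynomial.map ψ F) = (spec ξ F).map ψ := by
  have : (spec (ψ ξ)).comp (MvPolynomial.map ψ) = (Polynomial.mapRingHom ψ).comp (spec ξ) := by
    apply MvPolynomial.ringHom_ext
    · intro r; simp [spec]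
    · intro i; fin_cases i <;> simp [spec]
  exact DFunLike.congr_fun this F

theorem cert_map {S S' : Type*} [CommRing S] [CommRing S'] {q : ℕ} (x y : Fin q × Fin q → S)
    (ξ : S) (ψ : S →+* S') :
    cert (fun e => ψ (x e)) (fun e => ψ (y e)) (ψ ξ) = ψ (cert x y ξ) := by
  have hd : (MM (fun e => ψ (x e)) (fun e => ψ (y e))).det = ψ (MM x y).det := by
    rw [MM_map, RingHom.map_det]; rfl
  rw [cert, cert, hd, cur_map, cur_map, spec_map, spec_map, Polynomial.resultant_map_map, map_mul]

theorem cur_eval {S : Type*} [CommRing S] {q : ℕ} (x y : Fin q × Fin q → S) (i : Fin 2)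
    (e : Fin q × Fin q) : eval ![x e, y e] (cur x y i) = 0 := by
  have h : Matrix.mulVec (MM x y) (cc x y i) = (MM x y).det • vv x y i := by
    rw [cc, Matrix.mulVec_mulVec, Matrix.mul_adjugate, Matrix.smul_mulVec, Matrix.one_mulVec]
  have h' := congrFun h e
  simp only [Matrix.mulVec, dotProduct, MM, Matrix.of_apply, Pi.smul_apply, smul_eq_mul, vv] at h'
  simp only [cur, map_sub, map_mul, eval_C, map_pow, eval_X, map_sum, MM]
  rw [← h', sub_eq_zero]
  refine Finset.sum_congr rfl fun f _ => ?_
  simp [mul_comm]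

theorem cur_degreeOf {S : Type*} [CommRing S] [Nontrivial S] {q : ℕ} (x y : Fin q × Fin q → S)
    (i j : Fin 2) : degreeOf j (cur x y i) ≤ q := by
  have hX : ∀ (n : ℕ) (a : Fin 2), degreeOf j ((X a : MvPolynomial (Fin 2) S) ^ n) ≤
      if j = a then n else 0 := by
    intro n a
    refine (degreeOf_pow_le _ _ _).trans ?_
    rw [degreeOf_X]
    split_ifs <;> simp
  refine (degreeOf_sub_le _ _ _).trans (max_le ?_ ?_)
  · refine (degreeOf_C_mul_le _ _ _).trans ((hX _ _).trans ?_)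
    split_ifs <;> simp
  · refine (degreeOf_sum_le _ _ _).trans (Finset.sup_le fun f _ => ?_)
    refine (degreeOf_C_mul_le _ _ _).trans ((degreeOf_mul_le _ _ _).trans ?_)
    have h0 := hX f.1.1 0
    have h1 := hX f.2.1 1
    have := f.1.2
    have := f.2.2
    fin_cases j <;> simp at h0 h1 ⊢ <;> omega

theorem spec_cur {S : Type*} [CommRing S] {q : ℕ} (x y : Fin q × Fin q → S) (ξ : S) (i : Fin 2) :
    spec ξ (cur x y i) = Polynomial.C (MM x y).det * ![Polynomial.X, Polynomial.C ξ] i ^ q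
      - ∑ f : Fin q × Fin q, Polynomial.C (cc x y i f * ξ ^ f.2.1) * Polynomial.X ^ f.1.1 := by
  simp only [cur, spec, map_sub, map_mul, map_sum, map_pow, coe_eval₂Hom, eval₂_C, eval₂_X]
  congr 1
  refine Finset.sum_congr rfl fun f _ => ?_
  simp
  ring

theorem low_deg {S : Type*} [CommRing S] {q : ℕ} (c : Fin q × Fin q → S) :
    (∑ f : Fin q × Fin q, Polynomial.C (c f) * Polynomial.X ^ f.1.1 : Polynomial S).degree
      < (q : WithBot ℕ) := by
  rw [← Polynomial.mem_degreeLT]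
  refine Submodule.sum_mem _ fun f _ => ?_
  rw [Polynomial.mem_degreeLT]
  exact lt_of_le_of_lt (Polynomial.degree_C_mul_X_pow_le _ _) (by exact_mod_cast f.1.2)

theorem spec_cur_natDegree {S : Type*} [CommRing S] {q : ℕ} (x y : Fin q × Fin q → S) (ξ : S)
    (i : Fin 2) : (spec ξ (cur x y i)).natDegree ≤ q := by
  rw [spec_cur, Polynomial.natDegree_le_iff_degree_le]
  refine (Polynomial.degree_sub_le _ _).trans (max_le ?_ (low_deg _).le)
  fin_cases i
  · exact Polynomial.degree_C_mul_X_pow_le _ _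
  · simp only [Fin.mk_one, Matrix.cons_val_one, Matrix.cons_val_fin_one, ← Polynomial.C_pow,
      ← Polynomial.C_mul]
    exact Polynomial.degree_C_le.trans (by exact_mod_cast Nat.zero_le q)

theorem spec_eq {K : Type*} [Field K] (ξ : K) (F : MvPolynomial (Fin 2) K) :
    spec ξ F = (finSuccEquiv K 1 F).map (eval fun _ => ξ) := by
  have : (spec ξ) = (Polynomial.mapRingHom (eval fun _ => ξ)).comp
      (finSuccEquiv K 1).toRingEquiv.toRingHom := by
    apply MvPolynomial.ringHom_ext
    · intro r; simp [spec, finSuccEquiv_apply]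
    · have h1 : finSuccEquiv K 1 (X 1) = Polynomial.C (X 0) := finSuccEquiv_X_succ (j := 0)
      intro i; fin_cases i
      · simp [spec, finSuccEquiv_apply]
      · simp [spec, h1]
  exact DFunLike.congr_fun this F

theorem fse_cur {K : Type*} [Field K] {q : ℕ} (x y : Fin q × Fin q → K) :
    finSuccEquiv K 1 (cur x y 0) = Polynomial.C (C (MM x y).det) * Polynomial.X ^ q -
      ∑ f : Fin q × Fin q, Polynomial.C (C (cc x y 0 f) * X 0 ^ f.2.1) * Polynomial.X ^ f.1.1 := by
  have h1 : finSuccEquiv K 1 (X 1) = Polynomial.C (X 0) := finSuccEquiv_X_succ (j := 0)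
  have hC : ∀ r : K, finSuccEquiv K 1 (C r) = Polynomial.C (C r) := fun r => by
    simp [finSuccEquiv_apply]
  simp only [cur, map_sub, map_mul, map_sum, map_pow, finSuccEquiv_X_zero, h1, hC]
  congr 1
  refine Finset.sum_congr rfl fun f _ => ?_
  ring

theorem cur_relPrime {K : Type*} [Field K] {q : ℕ} (hq : q ≠ 0) (x y : Fin q × Fin q → K) (ξ : K)
    (h : cert x y ξ ≠ 0) : IsRelPrime (cur x y 0) (cur x y 1) := by
  obtain ⟨hδ, hr⟩ := mul_ne_zero_iff.1 h
  intro d hdA hdB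
  obtain ⟨u, v, -, -, huv⟩ := Polynomial.exists_mul_add_mul_eq_C_resultant _ _
    (spec_cur_natDegree x y ξ 0) (spec_cur_natDegree x y ξ 1) (Or.inl hq)
  have hdvd : spec ξ d ∣ Polynomial.C (Polynomial.resultant (spec ξ (cur x y 0))
      (spec ξ (cur x y 1)) q q) := by
    rw [← huv]
    exact dvd_add ((map_dvd (spec ξ) hdA).mul_right _) ((map_dvd (spec ξ) hdB).mul_right _)
  have hsu : IsUnit (spec ξ d) :=
    isUnit_of_dvd_unit hdvd ((IsUnit.mk0 _ hr).map Polynomial.C)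
  have hlc : (finSuccEquiv K 1 (cur x y 0)).leadingCoeff = C (MM x y).det := by
    have hne : (C (MM x y).det : MvPolynomial (Fin 1) K) ≠ 0 := by simpa using hδ
    rw [fse_cur, Polynomial.leadingCoeff_sub_of_degree_lt, Polynomial.leadingCoeff_C_mul_X_pow]
    rw [Polynomial.degree_C_mul_X_pow _ hne]
    exact low_deg _
  have hdl : IsUnit (finSuccEquiv K 1 d).leadingCoeff := by
    obtain ⟨w, hw⟩ := hdA
    rw [hw, map_mul, Polynomial.leadingCoeff_mul] at hlc
    exact isUnit_of_dvd_unit ⟨_, hlc.symm⟩ ((IsUnit.mk0 _ hδ).map C)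
  rw [spec_eq] at hsu
  have hnd := Polynomial.natDegree_eq_zero_of_isUnit hsu
  rw [Polynomial.natDegree_map_of_leadingCoeff_ne_zero _ (hdl.map _).ne_zero] at hnd
  have hu : IsUnit (finSuccEquiv K 1 d) := by
    rw [Polynomial.leadingCoeff, hnd] at hdl
    rw [Polynomial.eq_C_of_natDegree_eq_zero hnd]
    exact hdl.map Polynomial.C
  exact (MulEquiv.isUnit_map (finSuccEquiv K 1)).1 hu

theorem cert_grid {K : Type*} [Field K] {q : ℕ} [NeZero q] (u : Fin q → K)
    (hu : Function.Injective u) (ξ : K) (hξ : ∀ i, ξ ≠ u i) :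
    cert (fun e => u e.1) (fun e => u e.2) ξ ≠ 0 := by
  set x : Fin q × Fin q → K := fun e => u e.1
  set y : Fin q × Fin q → K := fun e => u e.2
  have hM : MM x y = Matrix.kroneckerMap (· * ·) (Matrix.vandermonde u) (Matrix.vandermonde u) := by
    ext e f
    simp [MM, Matrix.vandermonde, x, y]
  have hδ : (MM x y).det ≠ 0 := by
    rw [hM, Matrix.det_kronecker]
    have := Matrix.det_vandermonde_ne_zero_iff.2 hu
    exact mul_ne_zero (pow_ne_zero _ this) (pow_ne_zero _ this)
  refine mul_ne_zero hδ ?_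
  set r : Polynomial K := ∏ j, (Polynomial.X - Polynomial.C (u j)) with hrdef
  have hrm : r.Monic := Polynomial.monic_prod_of_monic _ _ fun j _ => Polynomial.monic_X_sub_C _
  have hrd : r.natDegree = q := by
    rw [hrdef, Polynomial.natDegree_prod_of_monic _ _ fun j _ => Polynomial.monic_X_sub_C _]
    simp
  have hre : ∀ t, r.eval t = t ^ q + ∑ l : Fin q, r.coeff l * t ^ l.1 := by
    intro t
    rw [Polynomial.eval_eq_sum_range, hrd, Finset.sum_range_succ, add_comm, Finset.sum_range]
    congr 1
    have : r.coeff q = 1 := by rw [← hrd]; exact hrm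
    rw [this, one_mul]
  let ee : Fin q × Fin q → K := fun f => if f.1 = 0 then - r.coeff f.2 else 0
  have hee : Matrix.mulVec (MM x y) ee = vv x y 1 := by
    ext e
    have h0 : r.eval (u e.2) = 0 := by
      rw [hrdef, Polynomial.eval_prod]
      exact Finset.prod_eq_zero (Finset.mem_univ e.2) (by simp)
    rw [hre] at h0
    simp only [Matrix.mulVec, dotProduct, MM, Matrix.of_apply, vv, ee, Fintype.sum_prod_type]
    rw [Finset.sum_eq_single 0]
    · simp [x, y]
      rw [eq_neg_of_add_eq_zero_left h0]
      congr 1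
      exact Finset.sum_congr rfl fun _ _ => mul_comm _ _
    · intro b _ hb
      simp [hb]
    · simp
  have hcc : cc x y 1 = (MM x y).det • ee := by
    rw [cc, ← hee, Matrix.mulVec_mulVec, Matrix.adjugate_mul, Matrix.smul_mulVec,
      Matrix.one_mulVec]
  have hB : spec ξ (cur x y 1) = Polynomial.C ((MM x y).det * r.eval ξ) := by
    rw [spec_cur, hcc, Fintype.sum_prod_type, Finset.sum_eq_single 0]
    · simp [ee, hre, Finset.mul_sum, mul_add]
      exact Finset.sum_congr rfl fun _ _ => mul_assoc _ _ _
    · intro b _ hb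
      simp [ee, hb]
    · simp
  have hA : (spec ξ (cur x y 0)).coeff q = (MM x y).det := by
    rw [spec_cur, Polynomial.coeff_sub, Polynomial.coeff_eq_zero_of_degree_lt (low_deg _)]
    simp
  have hrx : r.eval ξ ≠ 0 := by
    rw [hrdef, Polynomial.eval_prod]
    exact Finset.prod_ne_zero_iff.2 fun j _ => by simpa [sub_eq_zero] using hξ j
  rw [hB, Polynomial.resultant_C_right, hA]
  exact mul_ne_zero (pow_ne_zero _ hδ) (pow_ne_zero _ (mul_ne_zero hδ hrx))

/-! ### Part 4: existence of forms with prescribed multiplicities -/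

/-- coordinate change moving a point to `[0:1] × [0:1]` -/
def sig {K : Type*} [Field K] (u v : K) : MvPolynomial (Fin 4) K →ₐ[K] MvPolynomial (Fin 4) K :=
  aeval ![X 0 + C u * X 1, X 1, X 2 + C v * X 3, X 3]

theorem sig_sig {K : Type*} [Field K] (u v : K) (F : MvPolynomial (Fin 4) K) :
    sig (-u) (-v) (sig u v F) = F := by
  have : (sig (-u) (-v)).comp (sig u v) = AlgHom.id K _ := by
    apply MvPolynomial.algHom_ext
    intro i
    fin_cases i <;> simp [sig]
  exact DFunLike.congr_fun this F

theorem sig_monomial {K : Type*} [Field K] (u v : K) (e : Fin 4 →₀ ℕ) (c : K) :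
    sig u v (monomial e c) = C c * ((X 0 + C u * X 1) ^ e 0 * X 1 ^ e 1 *
      (X 2 + C v * X 3) ^ e 2 * X 3 ^ e 3) := by
  rw [sig, aeval_monomial, Finsupp.prod_fintype _ _ (fun _ => pow_zero _), Fin.prod_univ_four]
  simp [algebraMap_eq]

/-- exponents of bidegree `(t,t)` -/
def ex4 (t i j : ℕ) : Fin 4 →₀ ℕ := Finsupp.equivFunOnFinite.symm ![i, t - i, j, t - j]

theorem weight_four (e : Fin 4 →₀ ℕ) :
    Finsupp.weight w4 e = (e 0 + e 1, e 2 + e 3) := by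
  rw [Finsupp.weight_apply, Finsupp.sum_fintype e (fun i c => c • w4 i) (fun i => zero_smul ℕ (w4 i)), Fin.sum_univ_four]
  simp [w4]

theorem eq_ex4 {t : ℕ} (e : Fin 4 →₀ ℕ) (h : Finsupp.weight w4 e = (t, t)) :
    e = ex4 t (e 0) (e 2) := by
  rw [weight_four, Prod.mk.injEq] at h
  ext i
  fin_cases i <;> simp [ex4] <;> omega

theorem ex4_weight {t i j : ℕ} (hi : i ≤ t) (hj : j ≤ t) :
    Finsupp.weight w4 (ex4 t i j) = (t, t) := by
  rw [weight_four]
  simp [ex4]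
  omega

theorem sig_homog {K : Type*} [Field K] (u v : K) (e : Fin 4 →₀ ℕ) (c : K) :
    (sig u v (monomial e c)).IsWeightedHomogeneous w4 (Finsupp.weight w4 e) := by
  have hX : ∀ i : Fin 4, (X i : MvPolynomial (Fin 4) K).IsWeightedHomogeneous w4 (w4 i) :=
    fun i => isWeightedHomogeneous_X K w4 i
  have h0 : (X 0 + C u * X 1 : MvPolynomial (Fin 4) K).IsWeightedHomogeneous w4 (1, 0) := by
    refine (hX 0).add ?_
    have := (isWeightedHomogeneous_C w4 u).mul (hX 1)
    rw [zero_add] at this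
    exact this
  have h2 : (X 2 + C v * X 3 : MvPolynomial (Fin 4) K).IsWeightedHomogeneous w4 (0, 1) := by
    refine (hX 2).add ?_
    have := (isWeightedHomogeneous_C w4 v).mul (hX 3)
    rw [zero_add] at this
    exact this
  rw [sig_monomial]
  have := (isWeightedHomogeneous_C w4 c).mul
    ((((h0.pow (e 0)).mul ((hX 1).pow (e 1))).mul (h2.pow (e 2))).mul ((hX 3).pow (e 3)))
  convert this using 1
  rw [weight_four]
  simp [w4]

theorem sig_mem {K : Type*} [Field K] (p : (K × K) × (K × K)) (h1 : p.1.2 ≠ 0) (h2 : p.2.2 ≠ 0)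
    (m t : ℕ) (G : MvPolynomial (Fin 4) K) (hG : G.IsWeightedHomogeneous w4 (t, t))
    (hc : ∀ i j, i + j < m → coeff (ex4 t i j) G = 0) :
    sig (-(p.1.1 / p.1.2)) (-(p.2.1 / p.2.2)) G ∈ pointIdeal K p ^ m := by
  rw [G.as_sum, map_sum]
  refine Ideal.sum_mem _ fun e he => ?_
  rw [mem_support_iff] at he
  have hee := eq_ex4 e (hG he)
  have hm : m ≤ e 0 + e 2 := by
    by_contra hlt
    exact he (by rw [hee]; exact hc _ _ (by omega))
  rw [sig_monomial]
  refine Ideal.mul_mem_left _ _ (Ideal.mul_mem_right _ _ ?_)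
  have ha : (X 0 + C (-(p.1.1 / p.1.2)) * X 1 : MvPolynomial (Fin 4) K) ∈ pointIdeal K p := by
    have : (X 0 + C (-(p.1.1 / p.1.2)) * X 1 : MvPolynomial (Fin 4) K) =
        C (p.1.2)⁻¹ * (C p.1.2 * X 0 - C p.1.1 * X 1) := by
      rw [mul_sub, ← mul_assoc, ← mul_assoc, ← C_mul, ← C_mul, inv_mul_cancel₀ h1, div_eq_inv_mul,
        C_1, C_neg]
      ring
    rw [this]
    exact Ideal.mul_mem_left _ _ (Ideal.subset_span (by simp))
  have hb : (X 2 + C (-(p.2.1 / p.2.2)) * X 3 : MvPolynomial (Fin 4) K) ∈ pointIdeal K p := by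
    have : (X 2 + C (-(p.2.1 / p.2.2)) * X 3 : MvPolynomial (Fin 4) K) =
        C (p.2.2)⁻¹ * (C p.2.2 * X 2 - C p.2.1 * X 3) := by
      rw [mul_sub, ← mul_assoc, ← mul_assoc, ← C_mul, ← C_mul, inv_mul_cancel₀ h2, div_eq_inv_mul,
        C_1, C_neg]
      ring
    rw [this]
    exact Ideal.mul_mem_left _ _ (Ideal.subset_span (by simp))
  have := Ideal.mul_mem_mul (Ideal.pow_mem_pow ha (e 0)) (Ideal.pow_mem_pow hb (e 2))
  rw [← pow_add] at this
  have h3 := Ideal.mul_mem_right (X 1 ^ e 1) _ (Ideal.pow_le_pow_right hm this)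
  convert h3 using 1
  ring

theorem exists_form {K : Type*} [Field K] {s : ℕ} (Z : Fin s → (K × K) × (K × K))
    (h1 : ∀ i, (Z i).1.2 ≠ 0) (h2 : ∀ i, (Z i).2.2 ≠ 0) (m t : ℕ)
    (hst : s * Fintype.card (TT m) < (t + 1) ^ 2) :
    ∃ F ∈ symbolicPower K Z m, F ≠ 0 ∧ F.IsWeightedHomogeneous w4 (t, t) := by
  classical
  let mk : (Fin (t + 1) × Fin (t + 1) → K) →ₗ[K] MvPolynomial (Fin 4) K :=
    ∑ f : Fin (t + 1) × Fin (t + 1), (monomial (ex4 t f.1.1 f.2.1)).comp (LinearMap.proj f)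
  have hmk : ∀ c, mk c = ∑ f : Fin (t + 1) × Fin (t + 1), monomial (ex4 t f.1.1 f.2.1) (c f) := by
    intro c; simp [mk]
  let Φ : (Fin (t + 1) × Fin (t + 1) → K) →ₗ[K] (Fin s × TT m → K) :=
    LinearMap.pi fun a => (lcoeff K (ex4 t a.2.2.1 (a.2.1.1 - a.2.2.1))).comp
      ((sig ((Z a.1).1.1 / (Z a.1).1.2) ((Z a.1).2.1 / (Z a.1).2.2)).toLinearMap.comp mk)
  have hker : LinearMap.ker Φ ≠ ⊥ := by
    apply LinearMap.ker_ne_bot_of_finrank_lt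
    simp only [Module.finrank_fintype_fun_eq_card, Fintype.card_prod, Fintype.card_fin]
    rw [← pow_two]; exact hst
  obtain ⟨c, hc, hc0⟩ := (Submodule.ne_bot_iff _).1 hker
  have hΦ : ∀ a, Φ c a = 0 := fun a => by rw [LinearMap.mem_ker.1 hc]; rfl
  have hwt : ∀ f : Fin (t + 1) × Fin (t + 1), Finsupp.weight w4 (ex4 t f.1.1 f.2.1) = (t, t) :=
    fun f => ex4_weight (by omega) (by omega)
  refine ⟨mk c, ?_, ?_, ?_⟩
  · rw [symbolicPower, Submodule.mem_iInf]
    intro i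
    rw [← sig_sig ((Z i).1.1 / (Z i).1.2) ((Z i).2.1 / (Z i).2.2) (mk c)]
    refine sig_mem (Z i) (h1 i) (h2 i) m t _ ?_ ?_
    · rw [hmk, map_sum]
      refine IsWeightedHomogeneous.sum _ _ _ fun f _ => ?_
      rw [← hwt f]
      exact sig_homog _ _ _ _
    · intro a b hab
      have := hΦ (i, ⟨⟨a + b, hab⟩, ⟨a, by simp⟩⟩)
      simpa [Φ] using this
  · obtain ⟨g, hg⟩ := Function.ne_iff.1 hc0
    intro h0
    apply hg
    have : coeff (ex4 t g.1.1 g.2.1) (mk c) = c g := by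
      rw [hmk, coeff_sum, Finset.sum_eq_single g]
      · simp
      · intro f _ hfg
        rw [coeff_monomial, if_neg]
        intro h
        apply hfg
        have e0 := DFunLike.congr_fun h 0
        have e2 := DFunLike.congr_fun h 2
        simp [ex4] at e0 e2
        exact Prod.ext (Fin.ext e0) (Fin.ext e2)
      · simp
    rw [← this, h0]; simp
  · rw [hmk]
    refine IsWeightedHomogeneous.sum _ _ _ fun f _ => ?_
    exact isWeightedHomogeneous_monomial _ _ _ (hwt f)

theorem alpha_le {K : Type*} [Field K] {s : ℕ} (Z : Fin s → (K × K) × (K × K))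
    (h1 : ∀ i, (Z i).1.2 ≠ 0) (h2 : ∀ i, (Z i).2.2 ≠ 0) (m t : ℕ)
    (hst : s * Fintype.card (TT m) < (t + 1) ^ 2) : alpha K (symbolicPower K Z m) ≤ t + t := by
  obtain ⟨F, hF, hF0, hFh⟩ := exists_form Z h1 h2 m t hst
  exact Nat.sInf_le ⟨F, hF, hF0, (t, t), rfl, hFh⟩

theorem alpha_spec {K : Type*} [Field K] {s : ℕ} (Z : Fin s → (K × K) × (K × K))
    (h1 : ∀ i, (Z i).1.2 ≠ 0) (h2 : ∀ i, (Z i).2.2 ≠ 0) (m : ℕ) :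
    ∃ F ∈ symbolicPower K Z m, F ≠ 0 ∧ ∃ d : ℕ × ℕ,
      d.1 + d.2 = alpha K (symbolicPower K Z m) ∧ F.IsWeightedHomogeneous w4 d := by
  refine Nat.sInf_mem (s := {t | ∃ F ∈ symbolicPower K Z m, F ≠ 0 ∧ ∃ d : ℕ × ℕ, d.1 + d.2 = t ∧
    F.IsWeightedHomogeneous w4 d}) ?_
  obtain ⟨F, hF, hF0, hFh⟩ := exists_form Z h1 h2 m (s * Fintype.card (TT m)) (by nlinarith)
  exact ⟨_, F, hF, hF0, _, rfl, hFh⟩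

theorem alpha_subadd {K : Type*} [Field K] {s : ℕ} (Z : Fin s → (K × K) × (K × K))
    (h1 : ∀ i, (Z i).1.2 ≠ 0) (h2 : ∀ i, (Z i).2.2 ≠ 0) (m n : ℕ) :
    alpha K (symbolicPower K Z (m + n)) ≤
      alpha K (symbolicPower K Z m) + alpha K (symbolicPower K Z n) := by
  obtain ⟨F, hF, hF0, d, hd, hFh⟩ := alpha_spec Z h1 h2 m
  obtain ⟨G, hG, hG0, d', hd', hGh⟩ := alpha_spec Z h1 h2 n
  refine Nat.sInf_le ⟨F * G, ?_, mul_ne_zero hF0 hG0, d + d', ?_, hFh.mul hGh⟩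
  · rw [symbolicPower, Submodule.mem_iInf] at hF hG ⊢
    intro i
    rw [pow_add]
    exact Ideal.mul_mem_mul (hF i) (hG i)
  · simp only [Prod.fst_add, Prod.snd_add]; omega

theorem gamma_exists {K : Type*} [Field K] {s : ℕ} (Z : Fin s → (K × K) × (K × K))
    (h1 : ∀ i, (Z i).1.2 ≠ 0) (h2 : ∀ i, (Z i).2.2 ≠ 0) (q : ℕ)
    (hq : ∀ m, q * m ≤ alpha K (symbolicPower K Z m)) :
    ∃ γ : ℝ, Filter.Tendsto (fun m : ℕ => (alpha K (symbolicPower K Z m) : ℝ) / m)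
      Filter.atTop (nhds γ) ∧ (q : ℝ) ≤ γ ∧ γ ≤ Real.sqrt (2 * s) := by
  have hsub : Subadditive (fun m : ℕ => (alpha K (symbolicPower K Z m) : ℝ)) := by
    intro m n
    beta_reduce
    exact_mod_cast alpha_subadd Z h1 h2 m n
  have hb : BddBelow (Set.range fun n : ℕ => (alpha K (symbolicPower K Z n) : ℝ) / n) := by
    refine ⟨0, ?_⟩
    rintro _ ⟨n, rfl⟩
    positivity
  have hlim := hsub.tendsto_lim hb
  refine ⟨_, hlim, ?_, ?_⟩
  · refine ge_of_tendsto hlim ?_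
    filter_upwards [Filter.eventually_gt_atTop 0] with m hm
    rw [le_div_iff₀ (by exact_mod_cast hm)]
    exact_mod_cast hq m
  · have h3 : Filter.Tendsto (fun m : ℕ => Real.sqrt (2 * s) * (1 + 1 / (m : ℝ))) Filter.atTop
        (nhds (Real.sqrt (2 * s) * (1 + 0))) :=
      (tendsto_one_div_atTop_nhds_zero_nat.const_add 1).const_mul _
    rw [add_zero, mul_one] at h3
    refine le_of_tendsto_of_tendsto hlim h3 ?_
    filter_upwards [Filter.eventually_gt_atTop 0] with m hm
    have hm' : (0 : ℝ) < m := by exact_mod_cast hm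
    rw [div_le_iff₀ hm']
    set T := s * Fintype.card (TT m) with hT
    have ha := alpha_le Z h1 h2 m (Nat.sqrt T) (by
      have := Nat.lt_succ_sqrt T
      rw [pow_two]; exact this)
    have ha' : (alpha K (symbolicPower K Z m) : ℝ) ≤ 2 * (Nat.sqrt T : ℝ) := by
      have : (alpha K (symbolicPower K Z m) : ℝ) ≤ (Nat.sqrt T : ℝ) + (Nat.sqrt T : ℝ) := by
        exact_mod_cast ha
      linarith
    have e1 : Real.sqrt (2 * s) * (1 + 1 / (m : ℝ)) * m = Real.sqrt (2 * s) * (m + 1) := by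
      field_simp
    rw [e1]
    refine ha'.trans ?_
    have h4 : ((Nat.sqrt T : ℝ)) ^ 2 ≤ T := by exact_mod_cast Nat.sqrt_le' T
    have h5 : 2 * T = s * (m * (m + 1)) := by
      rw [hT, ← two_card_TT m]; ring
    have h5' : 2 * (T : ℝ) = s * (m * (m + 1)) := by exact_mod_cast h5
    have h6 : Real.sqrt (2 * s) ^ 2 = 2 * s := Real.sq_sqrt (by positivity)
    refine abs_le_of_sq_le_sq' ?_ (by positivity) |>.2
    rw [mul_pow, mul_pow, h6]
    have : (0 : ℝ) ≤ s := by positivity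
    nlinarith

/-! ### Part 5: dehomogenization -/

/-- dehomogenization -/
def dh {K : Type*} [Field K] : MvPolynomial (Fin 4) K →ₐ[K] MvPolynomial (Fin 2) K :=
  aeval ![X 0, 1, X 1, 1]

theorem dh_monomial {K : Type*} [Field K] (e : Fin 4 →₀ ℕ) (c : K) :
    dh (monomial e c) = monomial (Finsupp.equivFunOnFinite.symm ![e 0, e 2]) c := by
  rw [dh, aeval_monomial, Finsupp.prod_fintype _ _ (fun _ => pow_zero _), Fin.prod_univ_four,
    monomial_eq, Finsupp.prod_fintype _ _ (fun _ => pow_zero _), Fin.prod_univ_two]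
  simp [algebraMap_eq]

theorem dh_coeff {K : Type*} [Field K] {F : MvPolynomial (Fin 4) K} {d : ℕ × ℕ}
    (hF : F.IsWeightedHomogeneous w4 d) {e : Fin 4 →₀ ℕ} (he : e ∈ F.support) :
    coeff (Finsupp.equivFunOnFinite.symm ![e 0, e 2]) (dh F) = coeff e F := by
  classical
  conv_lhs => rw [F.as_sum]
  rw [map_sum, coeff_sum, Finset.sum_eq_single e]
  · rw [dh_monomial, coeff_monomial, if_pos rfl]
  · intro f hf hfe
    rw [dh_monomial, coeff_monomial, if_neg]
    intro h
    apply hfe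
    have e0 := DFunLike.congr_fun h 0
    have e2 := DFunLike.congr_fun h 1
    simp at e0 e2
    have w1 := hF (mem_support_iff.1 he)
    have w2 := hF (mem_support_iff.1 hf)
    rw [weight_four] at w1 w2
    rw [← w1, Prod.mk.injEq] at w2
    ext i
    fin_cases i <;> simp <;> omega
  · intro h; exact absurd he h

theorem dh_ne_zero {K : Type*} [Field K] {F : MvPolynomial (Fin 4) K} {d : ℕ × ℕ}
    (hF : F.IsWeightedHomogeneous w4 d) (h0 : F ≠ 0) : dh F ≠ 0 := by
  obtain ⟨e, he⟩ := ne_zero_iff.1 h0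
  intro h
  have := dh_coeff hF (mem_support_iff.2 he)
  rw [h, coeff_zero] at this
  exact he this.symm

theorem dh_degree {K : Type*} [Field K] {F : MvPolynomial (Fin 4) K} {d : ℕ × ℕ}
    (hF : F.IsWeightedHomogeneous w4 d) :
    degreeOf 0 (dh F) ≤ d.1 ∧ degreeOf 1 (dh F) ≤ d.2 := by
  have hw : ∀ e ∈ F.support, e 0 ≤ d.1 ∧ e 2 ≤ d.2 := by
    intro e he
    have w1 := hF (mem_support_iff.1 he)
    rw [weight_four] at w1
    rw [← w1]
    simp
  rw [F.as_sum, map_sum]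
  constructor
  · refine (degreeOf_sum_le _ _ _).trans (Finset.sup_le fun e he => ?_)
    rw [dh_monomial, degreeOf_monomial_eq _ _ (mem_support_iff.1 he)]
    simpa using (hw e he).1
  · refine (degreeOf_sum_le _ _ _).trans (Finset.sup_le fun e he => ?_)
    rw [dh_monomial, degreeOf_monomial_eq _ _ (mem_support_iff.1 he)]
    simpa using (hw e he).2

theorem dh_mem {K : Type*} [Field K] (p : (K × K) × (K × K)) (h1 : p.1.2 ≠ 0) (h2 : p.2.2 ≠ 0)
    (m : ℕ) {F : MvPolynomial (Fin 4) K} (hF : F ∈ pointIdeal K p ^ m) :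
    dh F ∈ ptI (p.1.1 / p.1.2, p.2.1 / p.2.2) ^ m := by
  have h := Ideal.mem_map_of_mem (dh (K := K)) hF
  rw [Ideal.map_pow] at h
  refine Ideal.pow_right_mono ?_ m h
  rw [pointIdeal, Ideal.map_span, Ideal.span_le]
  have ea : (C p.1.2 * X 0 - C p.1.1 : MvPolynomial (Fin 2) K) =
      C p.1.2 * (X 0 - C (p.1.1 / p.1.2)) := by
    rw [mul_sub, ← C_mul, mul_div_cancel₀ _ h1]
  have eb : (C p.2.2 * X 1 - C p.2.1 : MvPolynomial (Fin 2) K) =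
      C p.2.2 * (X 1 - C (p.2.1 / p.2.2)) := by
    rw [mul_sub, ← C_mul, mul_div_cancel₀ _ h2]
  have hC : ∀ c : K, dh (C c) = C c := fun c => by simp [dh, algebraMap_eq]
  have hX0 : dh (X 0 : MvPolynomial (Fin 4) K) = X 0 := by simp [dh]
  have hX1 : dh (X 1 : MvPolynomial (Fin 4) K) = 1 := by simp [dh]
  have hX2 : dh (X 2 : MvPolynomial (Fin 4) K) = X 1 := by simp [dh]
  have hX3 : dh (X 3 : MvPolynomial (Fin 4) K) = 1 := by simp [dh]
  rintro _ ⟨g, hg, rfl⟩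
  rcases hg with rfl | hg
  · simp only [map_sub, map_mul, hC, hX0, hX1, mul_one, SetLike.mem_coe]
    rw [ea]
    exact Ideal.mul_mem_left _ _ (Ideal.subset_span (by simp))
  · rw [Set.mem_singleton_iff.1 hg]
    simp only [map_sub, map_mul, hC, hX2, hX3, mul_one, SetLike.mem_coe]
    rw [eb]
    exact Ideal.mul_mem_left _ _ (Ideal.subset_span (by simp))

theorem pts_inj {K : Type*} [Field K] {s : ℕ} (Z : Fin s → (K × K) × (K × K))
    (h1 : ∀ i, (Z i).1.2 ≠ 0) (h2 : ∀ i, (Z i).2.2 ≠ 0)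
    (hne : ∀ i j, i ≠ j → ¬ PtEq K (Z i) (Z j)) :
    Function.Injective (fun i => ((Z i).1.1 / (Z i).1.2, (Z i).2.1 / (Z i).2.2)) := by
  intro e f hef
  by_contra hne'
  apply hne _ _ hne'
  simp only [Prod.mk.injEq] at hef
  rw [div_eq_div_iff (h1 _) (h1 _), div_eq_div_iff (h2 _) (h2 _)] at hef
  refine ⟨?_, ?_⟩
  · rw [ProjEq, hef.1, mul_comm]
  · rw [ProjEq, hef.2, mul_comm]

theorem affine_cert {K : Type*} [Field K] [Infinite K] (q : ℕ) (hq : 0 < q)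
    (x y : Fin q × Fin q → K) (hinj : Function.Injective fun e => (x e, y e)) (ξ : K)
    (hc : cert x y ξ ≠ 0) (m a b : ℕ) (F : MvPolynomial (Fin 2) K) (hF : F ≠ 0)
    (ha : degreeOf 0 F ≤ a) (hb : degreeOf 1 F ≤ b) (hFv : ∀ e, F ∈ ptI (x e, y e) ^ m) :
    q * m ≤ a + b := by
  have hr := cur_relPrime hq.ne' x y ξ hc
  have hA := cur_degreeOf x y 0
  have hB := cur_degreeOf x y 1
  have hAv := cur_eval x y 0
  have hBv := cur_eval x y 1
  generalize cur x y 0 = A at *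
  generalize cur x y 1 = B at *
  exact affine_lower (fun e => (x e, y e)) hinj m q a b F A B hF ha hb hr hA hB
    (by simp [pow_two]) hq hFv hAv hBv

theorem alpha_lower {K : Type*} [Field K] [Infinite K] {s : ℕ} (Z : Fin s → (K × K) × (K × K))
    (h1 : ∀ i, (Z i).1.2 ≠ 0) (h2 : ∀ i, (Z i).2.2 ≠ 0)
    (hne : ∀ i j, i ≠ j → ¬ PtEq K (Z i) (Z j)) (q : ℕ) (hq : 0 < q)
    (ι : Fin q × Fin q → Fin s) (hι : Function.Injective ι) (ξ : K)
    (hc : cert (fun e => (Z (ι e)).1.1 / (Z (ι e)).1.2) (fun e => (Z (ι e)).2.1 / (Z (ι e)).2.2) ξ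
      ≠ 0) (m : ℕ) : q * m ≤ alpha K (symbolicPower K Z m) := by
  obtain ⟨F, hF, hF0, d, hd, hFh⟩ := alpha_spec Z h1 h2 m
  rw [← hd]
  rw [symbolicPower, Submodule.mem_iInf] at hF
  have hinj := (pts_inj Z h1 h2 hne).comp hι
  exact affine_cert q hq _ _ hinj ξ hc m d.1 d.2 (dh F) (dh_ne_zero hFh hF0) (dh_degree hFh).1
    (dh_degree hFh).2 (fun e => dh_mem _ (h1 _) (h2 _) m (hF (ι e)))

/-! ### Part 6: multihomogenization and the final proof -/

/-- homogenized exponent -/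
def hx {s : ℕ} (D : ℕ) (e : Fin s × Fin 2 →₀ ℕ) : Fin s × Fin 4 →₀ ℕ :=
  Finsupp.equivFunOnFinite.symm
    fun p => ![e (p.1, 0), D - e (p.1, 0), e (p.1, 1), D - e (p.1, 1)] p.2

/-- homogenization -/
def HG {K : Type*} [Field K] {s : ℕ} (D : ℕ) (g : MvPolynomial (Fin s × Fin 2) K) :
    MvPolynomial (Fin s × Fin 4) K :=
  ∑ e ∈ g.support, monomial (hx D e) (coeff e g)

/-- affine coordinates -/
def aff {K : Type*} [Field K] {s : ℕ} (Z : Fin s → (K × K) × (K × K)) : Fin s × Fin 2 → K :=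
  fun p => ![(Z p.1).1.1 / (Z p.1).1.2, (Z p.1).2.1 / (Z p.1).2.2] p.2

theorem hx_weight {s : ℕ} (D : ℕ) (e : Fin s × Fin 2 →₀ ℕ) (he : ∀ p, e p ≤ D) :
    Finsupp.weight (wProd s) (hx D e) = fun _ => (D, D) := by
  rw [Finsupp.weight_apply, Finsupp.sum_fintype (hx D e) (fun i c => c • wProd s i)
    (fun i => zero_smul ℕ (wProd s i)), Fintype.sum_prod_type]
  simp only [Fin.sum_univ_four]
  ext i : 1
  rw [Finset.sum_apply, Finset.sum_eq_single i]
  · have h0 := he (i, 0)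
    have h1 := he (i, 1)
    refine Prod.ext ?_ ?_
    · simp [wProd, hx, w4]
      omega
    · simp [wProd, hx, w4]
      omega
  · intro j _ hj
    simp [wProd, Pi.single_eq_of_ne hj.symm]
  · simp

theorem HG_homog {K : Type*} [Field K] {s : ℕ} (D : ℕ) (g : MvPolynomial (Fin s × Fin 2) K)
    (hD : g.totalDegree < D) : (HG D g).IsWeightedHomogeneous (wProd s) (fun _ => (D, D)) := by
  refine IsWeightedHomogeneous.sum _ _ _ fun e he => ?_
  refine isWeightedHomogeneous_monomial _ _ _ (hx_weight D e fun p => ?_)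
  have := (monomial_le_degreeOf p he).trans (degreeOf_le_totalDegree g p)
  omega

theorem HG_eval_monomial {K : Type*} [Field K] {s : ℕ} (D : ℕ) (e : Fin s × Fin 2 →₀ ℕ) (c : K)
    (Z : Fin s → (K × K) × (K × K)) :
    eval (coordsOf K Z) (monomial (hx D e) c) = c * ∏ i, ((Z i).1.1 ^ e (i, 0) *
      (Z i).1.2 ^ (D - e (i, 0)) * (Z i).2.1 ^ e (i, 1) * (Z i).2.2 ^ (D - e (i, 1))) := by
  rw [eval_monomial, Finsupp.prod_fintype _ _ (fun _ => pow_zero _), Fintype.prod_prod_type]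
  simp only [Fin.prod_univ_four]
  simp [coordsOf, hx]

theorem HG_ne {K : Type*} [Field K] {s : ℕ} (D : ℕ) (g : MvPolynomial (Fin s × Fin 2) K)
    (hD : g.totalDegree < D) (Z : Fin s → (K × K) × (K × K))
    (h : eval (coordsOf K Z) (HG D g) ≠ 0) (i : Fin s) : (Z i).1.2 ≠ 0 ∧ (Z i).2.2 ≠ 0 := by
  have hle : ∀ e ∈ g.support, ∀ p, e p < D := fun e he p => by
    have := (monomial_le_degreeOf p he).trans (degreeOf_le_totalDegree g p)
    omega
  constructor
  · intro h0
    apply h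
    rw [HG, map_sum]
    refine Finset.sum_eq_zero fun e he => ?_
    have := hle e he (i, 0)
    rw [HG_eval_monomial, Finset.prod_eq_zero (Finset.mem_univ i), mul_zero]
    rw [h0, zero_pow (by omega)]
    simp
  · intro h0
    apply h
    rw [HG, map_sum]
    refine Finset.sum_eq_zero fun e he => ?_
    have := hle e he (i, 1)
    rw [HG_eval_monomial, Finset.prod_eq_zero (Finset.mem_univ i), mul_zero]
    rw [h0, zero_pow (by omega)]
    simp

theorem HG_eval {K : Type*} [Field K] {s : ℕ} (D : ℕ) (g : MvPolynomial (Fin s × Fin 2) K)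
    (hD : g.totalDegree < D) (Z : Fin s → (K × K) × (K × K))
    (h1 : ∀ i, (Z i).1.2 ≠ 0) (h2 : ∀ i, (Z i).2.2 ≠ 0) :
    eval (coordsOf K Z) (HG D g) =
      (∏ i, ((Z i).1.2 ^ D * (Z i).2.2 ^ D)) * eval (aff Z) g := by
  have hle : ∀ e ∈ g.support, ∀ p, e p ≤ D := fun e he p => by
    have := (monomial_le_degreeOf p he).trans (degreeOf_le_totalDegree g p)
    omega
  conv_rhs => rw [g.as_sum]
  rw [HG, map_sum, map_sum, Finset.mul_sum]
  refine Finset.sum_congr rfl fun e he => ?_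
  rw [HG_eval_monomial, eval_monomial, Finsupp.prod_fintype _ _ (fun _ => pow_zero _),
    Fintype.prod_prod_type, mul_left_comm, ← Finset.prod_mul_distrib]
  congr 1
  refine Finset.prod_congr rfl fun i _ => ?_
  have key : ∀ (a b : K) (n : ℕ), b ≠ 0 → n ≤ D → a ^ n * b ^ (D - n) = b ^ D * (a / b) ^ n := by
    intro a b n hb hn
    rw [div_pow, pow_sub₀ _ hb hn]
    field_simp
  have k1 := key (Z i).1.1 _ _ (h1 i) (hle e he (i, 0))
  have k2 := key (Z i).2.1 _ _ (h2 i) (hle e he (i, 1))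
  rw [k1, mul_assoc, k2]
  simp [aff, Fin.prod_univ_two]
  ring

theorem main_aux {K : Type*} [Field K] [Infinite K] (s q : ℕ) (hq : 0 < q) (hqs : q ^ 2 ≤ s)
    (P : (Fin s → (K × K) × (K × K)) → Prop)
    (hP : ∀ Z : Fin s → (K × K) × (K × K), (∀ i, (Z i).1.2 ≠ 0) → (∀ i, (Z i).2.2 ≠ 0) →
      (∀ m, q * m ≤ alpha K (symbolicPower K Z m)) → P Z) : GeneralPosition K s P := by
  classical
  have : NeZero q := ⟨hq.ne'⟩
  obtain ⟨ι⟩ : Nonempty (Fin q × Fin q ↪ Fin s) := by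
    apply Function.Embedding.nonempty_of_card_le
    simpa [← pow_two] using hqs
  have uu := Infinite.natEmbedding K
  let u : Fin q → K := fun i => uu i.1
  have hu : Function.Injective u := fun i j h => Fin.ext (uu.injective h)
  let ξ : K := uu q
  have hξ : ∀ i, ξ ≠ u i := fun i h => by
    have := uu.injective h
    have := i.2
    omega
  let g : MvPolynomial (Fin s × Fin 2) K :=
    cert (fun e => X (ι e, 0)) (fun e => X (ι e, 1)) (C ξ)
  have hg : ∀ z : Fin s × Fin 2 → K,
      eval z g = cert (fun e => z (ι e, 0)) (fun e => z (ι e, 1)) ξ := by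
    intro z
    have := cert_map (fun e => X (ι e, 0)) (fun e => X (ι e, 1)) (C ξ) (eval z)
    simpa using this.symm
  have hD : g.totalDegree < g.totalDegree + 1 := Nat.lt_succ_self _
  refine ⟨HG (g.totalDegree + 1) g, _, HG_homog _ g hD, ?_, ?_⟩
  · let Z0 : Fin s → (K × K) × (K × K) := fun i =>
      ((u (Function.invFun ι i).1, 1), (u (Function.invFun ι i).2, 1))
    refine ⟨Z0, fun i => ⟨?_, ?_⟩, ?_⟩
    · intro h
      simpa [Z0] using congrArg Prod.snd h
    · intro h
      simpa [Z0] using congrArg Prod.snd h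
    · rw [HG_eval _ g hD Z0 (by simp [Z0]) (by simp [Z0]), hg]
      refine mul_ne_zero (by simp [Z0]) ?_
      have := cert_grid u hu ξ hξ
      simpa [aff, Z0, Function.leftInverse_invFun ι.injective _] using this
  · intro Z _ hne hev
    have h1 := fun i => (HG_ne _ g hD Z hev i).1
    have h2 := fun i => (HG_ne _ g hD Z hev i).2
    rw [HG_eval _ g hD Z h1 h2, hg] at hev
    exact hP Z h1 h2 (alpha_lower Z h1 h2 hne q hq ι ι.injective ξ (right_ne_zero_of_mul hev))

/-- For `s ≥ 9` general points of `P^1 × P^1`,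
`√s - 1 < γ(I) ≤ √(2s)`, where `γ(I)` is the limit of `α(I^(m))/m`. -/
theorem gamma_general_points_bounds {k : Type*} [Field k] [IsAlgClosed k]
    (s : ℕ) (hs : 9 ≤ s) :
    GeneralPosition k s (fun Z =>
      ∃ γ : ℝ,
        Filter.Tendsto (fun m : ℕ => (alpha k (symbolicPower k Z m) : ℝ) / m)
          Filter.atTop (nhds γ) ∧
        Real.sqrt s - 1 < γ ∧ γ ≤ Real.sqrt (2 * s)) := by
  have : Infinite k := IsAlgClosed.instInfinite
  have hq : 0 < Nat.sqrt s := Nat.sqrt_pos.2 (by omega)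
  refine main_aux s (Nat.sqrt s) hq (Nat.sqrt_le' s) _ fun Z h1 h2 hZ => ?_
  obtain ⟨γ, hγ, hl, hu⟩ := gamma_exists Z h1 h2 (Nat.sqrt s) hZ
  refine ⟨γ, hγ, lt_of_lt_of_le ?_ hl, hu⟩
  have h3 : Real.sqrt s < (Nat.sqrt s : ℝ) + 1 := by
    rw [Real.sqrt_lt' (by positivity)]
    exact_mod_cast Nat.lt_succ_sqrt' s
  linarith
end
end

section
/- Let s ≥ 1 and let I be the ideal of a set Z of s general points of P^1 x P^1. Then I^m = I^(m) for all m > 0 if and only if s is 1, 2, 3, or 5; moreover, I^(3) ≠ I^3 if s = 4 and I^(2) ≠ I^2 if s ≥ 6. Precisely: there is a nonempty Zariski-open subset U of (P^1 x P^1)^s such that for every s-tuple of pairwise distinct points lying in U, with I the ideal of these points, the preceding assertions hold. -/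
open MvPolynomial

noncomputable section

variable (k : Type*) [Field k]

namespace SymPow
variable {k : Type*} [Field k]
/-- Induction principle for bihomogeneous polynomials. -/
lemma biH_induction {a b : ℕ} {P : MvPolynomial (Fin 4) k → Prop} (h0 : P 0)
    (hadd : ∀ f g, P f → P g → P (f + g))
    (hmon : ∀ (c : k) (u u' v v' : ℕ), u + u' = a → v + v' = b →
      P (C c * (X 0 ^ u * X 1 ^ u' * X 2 ^ v * X 3 ^ v')))
    {f : MvPolynomial (Fin 4) k} (hf : f.IsWeightedHomogeneous w4 (a, b)) : P f := by
  refine IsWeightedHomogeneous.induction_on (motive := fun p _ => P p) h0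
    (fun p q _ _ hp hq => hadd p q hp hq) ?_ hf
  intro d r hr
  have h1 : monomial d r = C r * (X 0 ^ d 0 * X 1 ^ d 1 * X 2 ^ d 2 * X 3 ^ d 3) := by
    rw [monomial_eq, Finsupp.prod_fintype _ _ (by simp), Fin.prod_univ_four]
  rw [h1]
  rw [Finsupp.weight_apply, Finsupp.sum_fintype _ _ (by simp), Fin.sum_univ_four] at hr
  simp [w4] at hr
  exact hmon r _ _ _ _ (by omega) (by omega)

lemma biH_mon (u u' v v' : ℕ) : (X 0 ^ u * X 1 ^ u' * X 2 ^ v * X 3 ^ v' :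
    MvPolynomial (Fin 4) k).IsWeightedHomogeneous w4 (u + u', v + v') := by
  have h := ((((isWeightedHomogeneous_X k w4 0).pow u).mul
    ((isWeightedHomogeneous_X k w4 1).pow u')).mul ((isWeightedHomogeneous_X k w4 2).pow v)).mul
      ((isWeightedHomogeneous_X k w4 3).pow v')
  convert h using 1
  simp [w4]

lemma biH_X0 : (X 0 : MvPolynomial (Fin 4) k).IsWeightedHomogeneous w4 (1, 0) :=
  isWeightedHomogeneous_X k w4 0
lemma biH_X1 : (X 1 : MvPolynomial (Fin 4) k).IsWeightedHomogeneous w4 (1, 0) :=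
  isWeightedHomogeneous_X k w4 1
lemma biH_X2 : (X 2 : MvPolynomial (Fin 4) k).IsWeightedHomogeneous w4 (0, 1) :=
  isWeightedHomogeneous_X k w4 2
lemma biH_X3 : (X 3 : MvPolynomial (Fin 4) k).IsWeightedHomogeneous w4 (0, 1) :=
  isWeightedHomogeneous_X k w4 3

lemma biH_lin (c d : k) : (C c * X 0 - C d * X 1 :
    MvPolynomial (Fin 4) k).IsWeightedHomogeneous w4 (1, 0) :=
  (biH_X0.C_mul c).sub (biH_X1.C_mul d)
lemma biH_lin' (c d : k) : (C c * X 2 - C d * X 3 :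
    MvPolynomial (Fin 4) k).IsWeightedHomogeneous w4 (0, 1) :=
  (biH_X2.C_mul c).sub (biH_X3.C_mul d)

/-- Scaling. -/
lemma aeval_scale {A : Type*} [CommRing A] [Algebra k A] (s t x0 x1 y0 y1 : A) {a b : ℕ}
    {f : MvPolynomial (Fin 4) k} (hf : f.IsWeightedHomogeneous w4 (a, b)) :
    aeval ![s * x0, s * x1, t * y0, t * y1] f = s ^ a * t ^ b * aeval ![x0, x1, y0, y1] f := by
  refine biH_induction (P := fun f => aeval ![s * x0, s * x1, t * y0, t * y1] f =
    s ^ a * t ^ b * aeval ![x0, x1, y0, y1] f) (by simp) ?_ ?_ hf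
  · intro f g hf hg
    rw [map_add, map_add, hf, hg, mul_add]
  · intro c u u' v v' h1 h2
    subst h1 h2
    simp
    ring

/-- Evaluation at (a representative of) a point. -/
def evp (p : (k × k) × (k × k)) : MvPolynomial (Fin 4) k →ₐ[k] k :=
  aeval ![p.1.1, p.1.2, p.2.1, p.2.2]

lemma exists_compl {a : k × k} (ha : a ≠ 0) : ∃ v : k × k, a.2 * v.1 - a.1 * v.2 = 1 := by
  by_cases h : a.2 = 0
  · have h1 : a.1 ≠ 0 := fun h1 => ha (Prod.ext h1 h)
    exact ⟨(0, -a.1⁻¹), by simp [h1]⟩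
  · exact ⟨(a.2⁻¹, 0), by simp [h]⟩

/-- The linear form in `x` dual to `a`. -/
def mx (v : k × k) : MvPolynomial (Fin 4) k := C v.1 * X 1 - C v.2 * X 0
/-- The linear form in `y` dual to `b`. -/
def my (v : k × k) : MvPolynomial (Fin 4) k := C v.1 * X 3 - C v.2 * X 2
/-- The linear form in `x` vanishing at `a`. -/
def lx (a : k × k) : MvPolynomial (Fin 4) k := C a.2 * X 0 - C a.1 * X 1
/-- The linear form in `y` vanishing at `b`. -/
def ly (b : k × k) : MvPolynomial (Fin 4) k := C b.2 * X 2 - C b.1 * X 3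

lemma pointIdeal_eq (p : (k × k) × (k × k)) : pointIdeal k p = Ideal.span {lx p.1, ly p.2} := rfl

lemma lx_mem (p : (k × k) × (k × k)) : lx p.1 ∈ pointIdeal k p :=
  Ideal.subset_span (by simp [lx])
lemma ly_mem (p : (k × k) × (k × k)) : ly p.2 ∈ pointIdeal k p :=
  Ideal.subset_span (by simp [ly])

lemma x0_eq {a v : k × k} (h : a.2 * v.1 - a.1 * v.2 = 1) :
    mx v * C a.1 + lx a * C v.1 = (X 0 : MvPolynomial (Fin 4) k) := by
  have : (C (a.2 * v.1 - a.1 * v.2) : MvPolynomial (Fin 4) k) = 1 := by rw [h]; simp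
  simp only [map_sub, map_mul] at this
  simp only [mx, lx]
  linear_combination X 0 * this
lemma x1_eq {a v : k × k} (h : a.2 * v.1 - a.1 * v.2 = 1) :
    mx v * C a.2 + lx a * C v.2 = (X 1 : MvPolynomial (Fin 4) k) := by
  have : (C (a.2 * v.1 - a.1 * v.2) : MvPolynomial (Fin 4) k) = 1 := by rw [h]; simp
  simp only [map_sub, map_mul] at this
  simp only [mx, lx]
  linear_combination X 1 * this
lemma y0_eq {a v : k × k} (h : a.2 * v.1 - a.1 * v.2 = 1) :
    my v * C a.1 + ly a * C v.1 = (X 2 : MvPolynomial (Fin 4) k) := by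
  have : (C (a.2 * v.1 - a.1 * v.2) : MvPolynomial (Fin 4) k) = 1 := by rw [h]; simp
  simp only [map_sub, map_mul] at this
  simp only [my, ly]
  linear_combination X 2 * this
lemma y1_eq {a v : k × k} (h : a.2 * v.1 - a.1 * v.2 = 1) :
    my v * C a.2 + ly a * C v.2 = (X 3 : MvPolynomial (Fin 4) k) := by
  have : (C (a.2 * v.1 - a.1 * v.2) : MvPolynomial (Fin 4) k) = 1 := by rw [h]; simp
  simp only [map_sub, map_mul] at this
  simp only [my, ly]
  linear_combination X 3 * this

/-- Deformation to the normal cone of the point `p`. -/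
def psi (p q : (k × k) × (k × k)) :
    MvPolynomial (Fin 4) k →ₐ[k] Polynomial (MvPolynomial (Fin 4) k) :=
  aeval ![Polynomial.C (mx q.1 * C p.1.1) + Polynomial.X * Polynomial.C (lx p.1 * C q.1.1),
    Polynomial.C (mx q.1 * C p.1.2) + Polynomial.X * Polynomial.C (lx p.1 * C q.1.2),
    Polynomial.C (my q.2 * C p.2.1) + Polynomial.X * Polynomial.C (ly p.2 * C q.2.1),
    Polynomial.C (my q.2 * C p.2.2) + Polynomial.X * Polynomial.C (ly p.2 * C q.2.2)]

/-- `q` is a complement of `p`. -/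
def Compl (p q : (k × k) × (k × k)) : Prop :=
  p.1.2 * q.1.1 - p.1.1 * q.1.2 = 1 ∧ p.2.2 * q.2.1 - p.2.1 * q.2.2 = 1

lemma exists_Compl {p : (k × k) × (k × k)} (hp : IsPtRep k p) : ∃ q, Compl p q := by
  obtain ⟨v, hv⟩ := exists_compl hp.1
  obtain ⟨w, hw⟩ := exists_compl hp.2
  exact ⟨(v, w), hv, hw⟩

lemma psi_rees (p q : (k × k) × (k × k)) (f : MvPolynomial (Fin 4) k) :
    psi p q f ∈ reesAlgebra (pointIdeal k p) := by
  have hC : ∀ r : MvPolynomial (Fin 4) k, Polynomial.C r ∈ reesAlgebra (pointIdeal k p) :=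
    fun r => (reesAlgebra (pointIdeal k p)).algebraMap_mem r
  have hX : ∀ r ∈ pointIdeal k p, Polynomial.X * Polynomial.C r ∈ reesAlgebra (pointIdeal k p) := by
    intro r hr
    rw [mul_comm, Polynomial.C_mul_X_eq_monomial]
    exact reesAlgebra.monomial_mem.2 (by simpa using hr)
  have hx : ∀ c, lx p.1 * C c ∈ pointIdeal k p := fun c => Ideal.mul_mem_right _ _ (lx_mem p)
  have hy : ∀ c, ly p.2 * C c ∈ pointIdeal k p := fun c => Ideal.mul_mem_right _ _ (ly_mem p)
  induction f using MvPolynomial.induction_on with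
  | C a =>
    rw [psi, MvPolynomial.algHom_C]
    exact hC (C a)
  | add f g hf hg => rw [map_add]; exact add_mem hf hg
  | mul_X f i hf =>
    rw [map_mul]
    refine mul_mem hf ?_
    rw [psi, aeval_X]
    fin_cases i
    · exact add_mem (hC _) (hX _ (hx _))
    · exact add_mem (hC _) (hX _ (hx _))
    · exact add_mem (hC _) (hX _ (hy _))
    · exact add_mem (hC _) (hX _ (hy _))

lemma psi_eval_one {p q : (k × k) × (k × k)} (h : Compl p q) (f : MvPolynomial (Fin 4) k) :
    (psi p q f).eval 1 = f := by
  have : ((Polynomial.aeval (1 : MvPolynomial (Fin 4) k)).restrictScalars k).comp (psi p q)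
      = AlgHom.id k _ := by
    ext i
    fin_cases i
    · simp [psi, x0_eq h.1]
    · simp [psi, x1_eq h.1]
    · simp [psi, y0_eq h.2]
    · simp [psi, y1_eq h.2]
  have := congrArg (fun F => F f) this
  simpa [Polynomial.aeval_def] using this

lemma psi_lx {p q : (k × k) × (k × k)} (h : Compl p q) :
    psi p q (lx p.1) = Polynomial.X * Polynomial.C (lx p.1) := by
  have h1 : (C p.1.2 * C q.1.1 - C p.1.1 * C q.1.2 : MvPolynomial (Fin 4) k) = 1 := by
    rw [← C_mul, ← C_mul, ← C_sub, h.1, C_1]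
  have h2 := congrArg (Polynomial.C (R := MvPolynomial (Fin 4) k)) h1
  conv_lhs => rw [lx]
  unfold psi
  rw [map_sub, map_mul (aeval _) (C _) (X _), map_mul (aeval _) (C _) (X _), aeval_X, aeval_X,
    algHom_C, algHom_C]
  have hc : ∀ a : k, algebraMap k (Polynomial (MvPolynomial (Fin 4) k)) a = Polynomial.C (C a) :=
    fun a => rfl
  simp only [hc, map_mul, map_sub, Matrix.cons_val, map_one] at h2 ⊢
  linear_combination Polynomial.X * Polynomial.C (lx p.1) * h2

lemma psi_ly {p q : (k × k) × (k × k)} (h : Compl p q) :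
    psi p q (ly p.2) = Polynomial.X * Polynomial.C (ly p.2) := by
  have h1 : (C p.2.2 * C q.2.1 - C p.2.1 * C q.2.2 : MvPolynomial (Fin 4) k) = 1 := by
    rw [← C_mul, ← C_mul, ← C_sub, h.2, C_1]
  have h2 := congrArg (Polynomial.C (R := MvPolynomial (Fin 4) k)) h1
  conv_lhs => rw [ly]
  unfold psi
  rw [map_sub, map_mul (aeval _) (C _) (X _), map_mul (aeval _) (C _) (X _), aeval_X, aeval_X,
    algHom_C, algHom_C]
  have hc : ∀ a : k, algebraMap k (Polynomial (MvPolynomial (Fin 4) k)) a = Polynomial.C (C a) :=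
    fun a => rfl
  simp only [hc, map_mul, map_sub, Matrix.cons_val, map_one] at h2 ⊢
  linear_combination Polynomial.X * Polynomial.C (ly p.2) * h2

/-- Membership in powers of the ideal of a point. -/
lemma mem_pow_iff {p q : (k × k) × (k × k)} (h : Compl p q) (m : ℕ)
    (f : MvPolynomial (Fin 4) k) :
    f ∈ pointIdeal k p ^ m ↔ Polynomial.X ^ m ∣ psi p q f := by
  constructor
  · intro hf
    have h1 : (pointIdeal k p).map (psi p q) ≤ Ideal.span {Polynomial.X} := by
      rw [pointIdeal_eq, Ideal.map_span, Ideal.span_le]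
      rintro _ ⟨g, (rfl | rfl), rfl⟩
      · rw [SetLike.mem_coe, Ideal.mem_span_singleton, psi_lx h]; exact dvd_mul_right _ _
      · rw [SetLike.mem_coe, Ideal.mem_span_singleton, psi_ly h]; exact dvd_mul_right _ _
    have h2 : psi p q f ∈ ((pointIdeal k p).map (psi p q)) ^ m := by
      rw [← Ideal.map_pow]; exact Ideal.mem_map_of_mem _ hf
    have h3 := Ideal.pow_right_mono h1 m h2
    rwa [Ideal.span_singleton_pow, Ideal.mem_span_singleton] at h3
  · intro hf
    rw [Polynomial.X_pow_dvd_iff] at hf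
    rw [← psi_eval_one h f, Polynomial.eval_eq_sum_range]
    refine Ideal.sum_mem _ fun i _ => ?_
    rw [one_pow, mul_one]
    by_cases hi : i < m
    · rw [hf i hi]; exact zero_mem _
    · exact Ideal.pow_le_pow_right (not_lt.1 hi) (psi_rees p q f i)

lemma mul_mem_cancel {p : (k × k) × (k × k)} (hp : IsPtRep k p) {G H : MvPolynomial (Fin 4) k}
    {m : ℕ} (hG : G ∉ pointIdeal k p ^ 2) (h : G * H ∈ pointIdeal k p ^ (m + 1)) :
    H ∈ pointIdeal k p ^ m := by
  obtain ⟨q, hq⟩ := exists_Compl hp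
  rw [mem_pow_iff hq] at *
  rw [map_mul] at h
  have hX : Prime (Polynomial.X : Polynomial (MvPolynomial (Fin 4) k)) := Polynomial.prime_X
  by_cases h1 : Polynomial.X ∣ psi p q G
  · obtain ⟨g, hg⟩ := h1
    rw [hg, pow_succ', mul_assoc, mul_dvd_mul_iff_left hX.ne_zero] at h
    refine hX.pow_dvd_of_dvd_mul_left m ?_ h
    rintro ⟨g', rfl⟩
    exact hG ⟨g', by rw [hg]; ring⟩
  · exact hX.pow_dvd_of_dvd_mul_left m h1 (dvd_trans (pow_dvd_pow _ (Nat.le_succ m)) h)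

lemma coeff_zero_psi {p q : (k × k) × (k × k)} {a b : ℕ}
    {f : MvPolynomial (Fin 4) k} (hf : f.IsWeightedHomogeneous w4 (a, b)) :
    (psi p q f).coeff 0 = mx q.1 ^ a * my q.2 ^ b * C (evp p f) := by
  have h1 : (psi p q f).coeff 0 = aeval ![mx q.1 * C p.1.1, mx q.1 * C p.1.2, my q.2 * C p.2.1,
      my q.2 * C p.2.2] f := by
    rw [Polynomial.coeff_zero_eq_eval_zero]
    have : ((Polynomial.aeval (0 : MvPolynomial (Fin 4) k)).restrictScalars k).comp (psi p q)
      = aeval ![mx q.1 * C p.1.1, mx q.1 * C p.1.2, my q.2 * C p.2.1, my q.2 * C p.2.2] := by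
      ext i
      fin_cases i <;> simp [psi]
    have := congrArg (fun F => F f) this
    simpa [Polynomial.aeval_def] using this
  have h2 : aeval ![C p.1.1, C p.1.2, C p.2.1, C p.2.2] f =
      (C (evp p f) : MvPolynomial (Fin 4) k) := by
    have : aeval ![C p.1.1, C p.1.2, C p.2.1, C p.2.2] =
      (Algebra.ofId k (MvPolynomial (Fin 4) k)).comp (evp p) := by
      ext i
      fin_cases i <;> simp [evp, Algebra.ofId_apply]
    rw [this]; rfl
  rw [h1, aeval_scale _ _ _ _ _ _ hf, h2]

lemma evp_of_mem {p : (k × k) × (k × k)} {f : MvPolynomial (Fin 4) k} (hf : f ∈ pointIdeal k p) :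
    evp p f = 0 := by
  have : pointIdeal k p ≤ RingHom.ker (evp p) := by
    rw [pointIdeal_eq, Ideal.span_le]
    rintro _ (rfl | rfl)
    · simp [evp, lx]; ring
    · simp [evp, ly]; ring
  exact this hf

lemma mem_point_iff {p : (k × k) × (k × k)} (hp : IsPtRep k p) {a b : ℕ}
    {f : MvPolynomial (Fin 4) k} (hf : f.IsWeightedHomogeneous w4 (a, b)) :
    f ∈ pointIdeal k p ↔ evp p f = 0 := by
  refine ⟨evp_of_mem, fun h => ?_⟩
  obtain ⟨q, hq⟩ := exists_Compl hp
  rw [← pow_one (pointIdeal k p), mem_pow_iff hq, pow_one, Polynomial.X_dvd_iff,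
    coeff_zero_psi hf, h]
  simp

/-- A form in `x` vanishing at `a` is divisible by the corresponding linear form. -/
lemma lx_dvd {a : k × k} (ha : a ≠ 0) (b : k × k) {n : ℕ} {f : MvPolynomial (Fin 4) k}
    (hf : f.IsWeightedHomogeneous w4 (n, 0)) (h : evp (a, b) f = 0) : lx a ∣ f := by
  have hb : evp (a, (0, 1)) f = 0 := by
    refine Eq.trans ?_ h
    refine biH_induction (P := fun f => evp (a, (0, 1)) f = evp (a, b) f) (by simp) ?_ ?_ hf
    · intro f g hf hg; rw [map_add, map_add, hf, hg]
    · intro c u u' v v' _ h2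
      have h3 : v = 0 := by omega
      have h4 : v' = 0 := by omega
      subst h3 h4
      simp [evp]
  have h1 := (mem_point_iff (p := (a, (0, 1))) ⟨ha, by simp⟩ hf).2 hb
  rw [pointIdeal_eq, Ideal.mem_span_pair] at h1
  obtain ⟨g, g', hg⟩ := h1
  have h2 := congrArg (aeval (R := k) ![X 0, X 1, 0, (1 : MvPolynomial (Fin 4) k)]) hg
  have h3 : aeval (R := k) ![X 0, X 1, 0, (1 : MvPolynomial (Fin 4) k)] f = f := by
    refine biH_induction (P := fun f => aeval (R := k)
      ![X 0, X 1, 0, (1 : MvPolynomial (Fin 4) k)] f = f) (by simp) ?_ ?_ hf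
    · intro f g hf hg; rw [map_add, hf, hg]
    · intro c u u' v v' _ h2
      have h3 : v = 0 := by omega
      have h4 : v' = 0 := by omega
      subst h3 h4
      simp [algHom_C]
  rw [h3] at h2
  rw [← h2]
  simp [lx, ly]

/-- Closure of an ideal under taking bihomogeneous components. -/
def HomI (J : Ideal (MvPolynomial (Fin 4) k)) : Prop :=
  ∀ f ∈ J, ∀ d, weightedHomogeneousComponent w4 d f ∈ J

lemma homI_point_pow (p : (k × k) × (k × k)) (m : ℕ) : HomI (pointIdeal k p ^ m) := by
  let _ := weightedGradedAlgebra k w4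
  have h1 : (pointIdeal k p).IsHomogeneous (weightedHomogeneousSubmodule k w4) := by
    refine Ideal.homogeneous_span _ _ ?_
    rintro _ (rfl | rfl)
    · exact ⟨_, biH_lin _ _⟩
    · exact ⟨_, biH_lin' _ _⟩
  have h2 : ((pointIdeal k p) ^ m).IsHomogeneous (weightedHomogeneousSubmodule k w4) := by
    induction m with
    | zero => rw [pow_zero, Ideal.one_eq_top]; exact Ideal.IsHomogeneous.top _
    | succ m ih => rw [pow_succ]; exact ih.mul h1
  intro f hf d
  exact weightedHomogeneousComponent_mem_of_mem k w4 h2 hf d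

lemma homI_symb {s : ℕ} (Z : Fin s → (k × k) × (k × k)) (m : ℕ) : HomI (symbolicPower k Z m) := by
  intro f hf d
  rw [symbolicPower, Ideal.mem_iInf] at *
  exact fun i => homI_point_pow _ _ _ (hf i) d

lemma symb_one {s : ℕ} (Z : Fin s → (k × k) × (k × k)) :
    symbolicPower k Z 1 = idealOfPoints k Z := by
  simp [symbolicPower, idealOfPoints]

lemma homI_ideal {s : ℕ} (Z : Fin s → (k × k) × (k × k)) : HomI (idealOfPoints k Z) := by
  rw [← symb_one]; exact homI_symb Z 1

lemma mem_of_comp {J : Ideal (MvPolynomial (Fin 4) k)} {f : MvPolynomial (Fin 4) k}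
    (h : ∀ d, weightedHomogeneousComponent w4 d f ∈ J) : f ∈ J := by
  rw [← sum_weightedHomogeneousComponent w4 f]
  exact finsum_induction (· ∈ J) (zero_mem _) (fun _ _ => add_mem) h

lemma homI_le {J K : Ideal (MvPolynomial (Fin 4) k)} (hJ : HomI J)
    (h : ∀ a b, ∀ f ∈ J, f.IsWeightedHomogeneous w4 (a, b) → f ∈ K) : J ≤ K := fun f hf =>
  mem_of_comp fun d => h d.1 d.2 _ (hJ f hf d)
    (weightedHomogeneousComponent_isWeightedHomogeneous _ _)

/-- Quotient of a bihomogeneous polynomial by a bihomogeneous one. -/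
lemma biH_div {T h : MvPolynomial (Fin 4) k} {d n : ℕ × ℕ} (hT : T.IsWeightedHomogeneous w4 d)
    (hh : (T * h).IsWeightedHomogeneous w4 n) : T * h = 0 ∨ (d ≤ n ∧ ∃ h' : MvPolynomial (Fin 4) k,
      h'.IsWeightedHomogeneous w4 (n - d) ∧ T * h = T * h') := by
  let _ := weightedGradedAlgebra k w4
  have h1 : ((DirectSum.decompose (weightedHomogeneousSubmodule k w4) (T * h) n :
    weightedHomogeneousSubmodule k w4 n) : MvPolynomial (Fin 4) k) = T * h :=
    DirectSum.decompose_of_mem_same _ hh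
  by_cases hd : d ≤ n
  · right
    refine ⟨hd, (DirectSum.decompose (weightedHomogeneousSubmodule k w4) h (n - d) :
      weightedHomogeneousSubmodule k w4 (n - d)), SetLike.coe_mem (DirectSum.decompose
      (weightedHomogeneousSubmodule k w4) h (n - d)), ?_⟩
    rw [← DirectSum.coe_decompose_mul_of_left_mem_of_le _ hT hd, h1]
  · left
    rw [← h1]
    exact DirectSum.coe_decompose_mul_of_left_mem_of_not_le _ hT hd
end SymPow

namespace SymPow
variable {k : Type*} [Field k]
/-- Exponent vectors of the monomials of bidegree `(a,b)`. -/
def expo (a b : ℕ) (u : Fin (a + 1) × Fin (b + 1)) : Fin 4 →₀ ℕ :=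
  Finsupp.equivFunOnFinite.symm ![(u.1 : ℕ), a - u.1, (u.2 : ℕ), b - u.2]

lemma expo_inj (a b : ℕ) : Function.Injective (expo a b) := by
  intro u v h
  have h0 := DFunLike.congr_fun h 0
  have h2 := DFunLike.congr_fun h 2
  simp [expo] at h0 h2
  exact Prod.ext (Fin.ext h0) (Fin.ext h2)

/-- The monomials of bidegree `(a,b)`. -/
def mon (k : Type*) [Field k] (a b : ℕ) (u : Fin (a + 1) × Fin (b + 1)) : MvPolynomial (Fin 4) k :=
  X 0 ^ (u.1 : ℕ) * X 1 ^ (a - u.1) * X 2 ^ (u.2 : ℕ) * X 3 ^ (b - u.2)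

lemma mon_eq (a b : ℕ) (u : Fin (a + 1) × Fin (b + 1)) : mon k a b u = monomial (expo a b u) 1 := by
  rw [monomial_eq, Finsupp.prod_fintype _ _ (by simp), Fin.prod_univ_four]
  simp [expo, mon]

lemma mon_li (a b : ℕ) : LinearIndependent k (mon k a b) := by
  have := (basisMonomials (Fin 4) k).linearIndependent.comp (expo a b) (expo_inj a b)
  have e : mon k a b = ⇑(basisMonomials (Fin 4) k) ∘ expo a b := by
    funext u
    simp [mon_eq]
  rw [e]
  exact this

/-- The space of forms of bidegree `(a,b)`. -/
abbrev RR (k : Type*) [Field k] (a b : ℕ) : Submodule k (MvPolynomial (Fin 4) k) :=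
  weightedHomogeneousSubmodule k w4 (a, b)

lemma mon_mem (a b : ℕ) (u : Fin (a + 1) × Fin (b + 1)) : mon k a b u ∈ RR k a b := by
  have h := biH_mon (k := k) u.1 (a - u.1) u.2 (b - u.2)
  have h1 := u.1.2
  have h2 := u.2.2
  rwa [show (u.1 : ℕ) + (a - u.1) = a by omega, show (u.2 : ℕ) + (b - u.2) = b by omega] at h

lemma mon_span (a b : ℕ) : Submodule.span k (Set.range (mon k a b)) = RR k a b := by
  apply le_antisymm
  · rw [Submodule.span_le]
    rintro _ ⟨u, rfl⟩
    exact mon_mem a b u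
  · intro f hf
    refine biH_induction (P := fun f => f ∈ Submodule.span k (Set.range (mon k a b)))
      (zero_mem _) (fun _ _ => add_mem) ?_ hf
    intro c u u' v v' h1 h2
    rw [← smul_eq_C_mul]
    refine Submodule.smul_mem _ _ (Submodule.subset_span ⟨(⟨u, by omega⟩, ⟨v, by omega⟩), ?_⟩)
    simp only [mon]
    rw [show a - u = u' by omega, show b - v = v' by omega]

instance (a b : ℕ) : FiniteDimensional k (RR k a b) := by
  rw [← mon_span]
  exact FiniteDimensional.span_of_finite k (Set.finite_range _)

lemma finrank_RR (a b : ℕ) : Module.finrank k (RR k a b) = (a + 1) * (b + 1) := by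
  rw [← mon_span, finrank_span_eq_card (mon_li a b)]
  simp

/-- The parametrization of the graph of `x ↦ [q(x):p(x)]`. -/
def phi (p q : MvPolynomial (Fin 4) k) : MvPolynomial (Fin 4) k →ₐ[k] MvPolynomial (Fin 4) k :=
  aeval ![X 0, X 1, q, p]

section
variable {p q : MvPolynomial (Fin 4) k} {e : ℕ}

lemma phi_biH (hp : p.IsWeightedHomogeneous w4 (e, 0)) (hq : q.IsWeightedHomogeneous w4 (e, 0))
    {i j : ℕ} {f : MvPolynomial (Fin 4) k} (hf : f.IsWeightedHomogeneous w4 (i, j)) :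
    (phi p q f).IsWeightedHomogeneous w4 (i + e * j, 0) := by
  refine biH_induction (P := fun f => (phi p q f).IsWeightedHomogeneous w4 (i + e * j, 0))
    (by rw [map_zero]; exact isWeightedHomogeneous_zero _ _ _) ?_ ?_ hf
  · intro f g hf hg; rw [map_add]; exact hf.add hg
  · intro c u u' v v' h1 h2
    subst h1 h2
    have h := (((((biH_X0 (k := k)).pow u).mul (biH_X1.pow u')).mul (hq.pow v)).mul
      (hp.pow v')).C_mul c
    simp only [phi, map_mul, map_pow, aeval_X, algHom_C]
    have e1 : (u + u' + e * (v + v'), 0) =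
        (u • (1, 0) + u' • (1, 0) + v • (e, 0) + v' • (e, 0) : ℕ × ℕ) := by
      ext
      · simp; ring
      · simp
    rw [e1]
    exact h

lemma curve_dvd {i j : ℕ} {f : MvPolynomial (Fin 4) k} (hf : f.IsWeightedHomogeneous w4 (i, j)) :
    p * X 2 - q * X 3 ∣ p ^ j * f - X 3 ^ j * phi p q f := by
  refine biH_induction (P := fun f => p * X 2 - q * X 3 ∣ p ^ j * f - X 3 ^ j * phi p q f)
    (by simp) ?_ ?_ hf
  · intro f g hf hg
    rw [map_add]
    convert dvd_add hf hg using 1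
    ring
  · intro c u u' v v' h1 h2
    subst h1 h2
    have h : phi p q (C c * (X 0 ^ u * X 1 ^ u' * X 2 ^ v * X 3 ^ v')) =
        C c * (X 0 ^ u * X 1 ^ u' * q ^ v * p ^ v') := by
      simp [phi, algHom_C]
    rw [h]
    have h2 := (sub_dvd_pow_sub_pow (p * X 2) (q * X 3) v).mul_left
      (C c * X 0 ^ u * X 1 ^ u' * p ^ v' * X 3 ^ v')
    convert h2 using 1
    ring

lemma relprime_X : IsRelPrime (X 0 : MvPolynomial (Fin 4) k) (X 1) := by
  have h0 : Irreducible (X 0 : MvPolynomial (Fin 4) k) := X_prime.irreducible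
  rw [h0.isRelPrime_iff_not_dvd, X_dvd_X]
  simp

lemma biH_no_X3 {i : ℕ} {f : MvPolynomial (Fin 4) k} (hf : f.IsWeightedHomogeneous w4 (i, 0))
    (g : Fin 4 → MvPolynomial (Fin 4) k) (h0 : g 0 = X 0) (h1 : g 1 = X 1) : aeval g f = f := by
  refine biH_induction (P := fun f => aeval g f = f) (by simp) ?_ ?_ hf
  · intro f g hf hg; rw [map_add, hf, hg]
  · intro c u u' v v' _ h2
    have h3 : v = 0 := by omega
    have h4 : v' = 0 := by omega
    subst h3 h4
    simp [algHom_C, h0, h1]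

lemma phi_ker (hp : p.IsWeightedHomogeneous w4 (e, 0)) (hp0 : p ≠ 0) (hpq : IsRelPrime p q)
    {i j : ℕ} {f : MvPolynomial (Fin 4) k} (hf : f.IsWeightedHomogeneous w4 (i, j))
    (h : phi p q f = 0) : p * X 2 - q * X 3 ∣ f := by
  have h1 := curve_dvd (p := p) (q := q) hf
  rw [h, mul_zero, sub_zero] at h1
  obtain ⟨U, hU⟩ := h1
  have hX3 : IsRelPrime p (X 3) := by
    have h3 : Irreducible (X 3 : MvPolynomial (Fin 4) k) := X_prime.irreducible
    refine IsRelPrime.symm ?_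
    rw [h3.isRelPrime_iff_not_dvd]
    rintro ⟨r, hr⟩
    have h5 := biH_no_X3 hp ![X 0, X 1, 0, 0] rfl rfl
    rw [hr, map_mul, aeval_X] at h5
    simp at h5
    simp [h5] at hr
    exact hp0 hr
  have hG : IsRelPrime p (p * X 2 - q * X 3) := by
    intro d hd hd'
    have : d ∣ q * X 3 := by
      have := dvd_sub (hd.mul_right (X 2)) hd'
      simpa using this
    exact (hpq.mul_right hX3) hd this
  have h6 : p ^ j ∣ U := (IsRelPrime.pow_left hG).dvd_of_dvd_mul_left ⟨f, hU.symm⟩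
  obtain ⟨V, rfl⟩ := h6
  refine ⟨V, mul_left_cancel₀ (pow_ne_zero j hp0) ?_⟩
  rw [hU]; ring

lemma split_x {n b : ℕ} {h : MvPolynomial (Fin 4) k}
    (hh : h.IsWeightedHomogeneous w4 (n + 1, b)) : ∃ h0 h1 : MvPolynomial (Fin 4) k,
      h0.IsWeightedHomogeneous w4 (n, b) ∧ h1.IsWeightedHomogeneous w4 (n, b) ∧
      h = X 0 * h0 + X 1 * h1 := by
  refine biH_induction (P := fun h => ∃ h0 h1 : MvPolynomial (Fin 4) k,
      h0.IsWeightedHomogeneous w4 (n, b) ∧ h1.IsWeightedHomogeneous w4 (n, b) ∧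
      h = X 0 * h0 + X 1 * h1) ?_ ?_ ?_ hh
  · exact ⟨0, 0, isWeightedHomogeneous_zero _ _ _, isWeightedHomogeneous_zero _ _ _, by simp⟩
  · rintro f g ⟨f0, f1, h0, h1, rfl⟩ ⟨g0, g1, h2, h3, rfl⟩
    exact ⟨f0 + g0, f1 + g1, h0.add h2, h1.add h3, by ring⟩
  · intro c u u' v v' h1 h2
    cases u with
    | succ u =>
      refine ⟨C c * (X 0 ^ u * X 1 ^ u' * X 2 ^ v * X 3 ^ v'), 0, ?_,
        isWeightedHomogeneous_zero _ _ _, by ring⟩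
      have := (biH_mon (k := k) u u' v v').C_mul c
      rwa [show u + u' = n by omega, h2] at this
    | zero =>
      obtain ⟨t, rfl⟩ : ∃ t, u' = t + 1 := ⟨u' - 1, by omega⟩
      refine ⟨0, C c * (X 0 ^ 0 * X 1 ^ t * X 2 ^ v * X 3 ^ v'),
        isWeightedHomogeneous_zero _ _ _, ?_, by ring⟩
      have := (biH_mon (k := k) 0 t v v').C_mul c
      rwa [show 0 + t = n by omega, h2] at this

lemma biH_dvd_eq_zero {a b a' b' : ℕ} {f g : MvPolynomial (Fin 4) k} (hf0 : f ≠ 0)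
    (hf : f.IsWeightedHomogeneous w4 (a, b)) (hg : g.IsWeightedHomogeneous w4 (a', b'))
    (h : f ∣ g) (hab : a' < a) : g = 0 := by
  obtain ⟨r, rfl⟩ := h
  rcases biH_div hf hg with h | ⟨h, -⟩
  · exact h
  · have := h.1
    simp at this
    omega

lemma surj_base (hp : p.IsWeightedHomogeneous w4 (e + 1, 0))
    (hq : q.IsWeightedHomogeneous w4 (e + 1, 0)) (hp0 : p ≠ 0) (hpq : IsRelPrime p q)
    {h : MvPolynomial (Fin 4) k} (hh : h.IsWeightedHomogeneous w4 (2 * e + 1, 0)) :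
    ∃ f g : MvPolynomial (Fin 4) k, f.IsWeightedHomogeneous w4 (e, 0) ∧
      g.IsWeightedHomogeneous w4 (e, 0) ∧ h = p * f + q * g := by
  have hmem : ∀ x : RR k e 0 × RR k e 0,
      p * (x.1 : MvPolynomial (Fin 4) k) + q * (x.2 : MvPolynomial (Fin 4) k) ∈
        RR k (2 * e + 1) 0 := by
    intro x
    have h1 := hp.mul x.1.2
    have h2 := hq.mul x.2.2
    have : ((e + 1, 0) + (e, 0) : ℕ × ℕ) = (2 * e + 1, 0) := by ext <;> simp; ring
    rw [this] at h1 h2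
    exact h1.add h2
  let L : (RR k e 0 × RR k e 0) →ₗ[k] RR k (2 * e + 1) 0 :=
    { toFun := fun x => ⟨_, hmem x⟩
      map_add' := fun x y => by ext1; simp; ring
      map_smul' := fun c x => by ext1; simp }
  have hinj : Function.Injective L := by
    rw [← LinearMap.ker_eq_bot, LinearMap.ker_eq_bot']
    rintro ⟨f, g⟩ hfg
    have h1 : p * (f : MvPolynomial (Fin 4) k) + q * (g : MvPolynomial (Fin 4) k) = 0 :=
      congrArg Subtype.val hfg
    have h2 : p ∣ q * (g : MvPolynomial (Fin 4) k) := ⟨-f, by linear_combination h1⟩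
    have h3 := hpq.dvd_of_dvd_mul_left h2
    have h4 := biH_dvd_eq_zero hp0 hp g.2 h3 (by omega)
    rw [h4, mul_zero, add_zero] at h1
    have h5 := (mul_eq_zero.1 h1).resolve_left hp0
    exact Prod.ext (Subtype.ext h5) (Subtype.ext h4)
  have hsurj : Function.Surjective L := by
    rw [← LinearMap.injective_iff_surjective_of_finrank_eq_finrank]
    · exact hinj
    · rw [Module.finrank_prod, finrank_RR, finrank_RR]; ring
  obtain ⟨x, hx⟩ := hsurj ⟨h, hh⟩
  exact ⟨x.1, x.2, x.1.2, x.2.2, (congrArg Subtype.val hx).symm⟩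

lemma surj_step (hp : p.IsWeightedHomogeneous w4 (e + 1, 0))
    (hq : q.IsWeightedHomogeneous w4 (e + 1, 0)) (hp0 : p ≠ 0) (hpq : IsRelPrime p q) (r : ℕ)
    {h : MvPolynomial (Fin 4) k} (hh : h.IsWeightedHomogeneous w4 (2 * e + 1 + r, 0)) :
    ∃ f g : MvPolynomial (Fin 4) k, f.IsWeightedHomogeneous w4 (e + r, 0) ∧
      g.IsWeightedHomogeneous w4 (e + r, 0) ∧ h = p * f + q * g := by
  induction r generalizing h with
  | zero => exact surj_base hp hq hp0 hpq hh
  | succ r ih =>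
    obtain ⟨h0, h1, H0, H1, rfl⟩ := split_x (n := 2 * e + 1 + r) hh
    obtain ⟨f0, g0, hf0, hg0, rfl⟩ := ih H0
    obtain ⟨f1, g1, hf1, hg1, rfl⟩ := ih H1
    have key : ∀ {i : Fin 4} {f : MvPolynomial (Fin 4) k},
        (X i : MvPolynomial (Fin 4) k).IsWeightedHomogeneous w4 (1, 0) →
        f.IsWeightedHomogeneous w4 (e + r, 0) →
        (X i * f).IsWeightedHomogeneous w4 (e + (r + 1), 0) := by
      intro i f hi hf
      have := hi.mul hf
      convert this using 1
      ext <;> simp; ring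
    exact ⟨X 0 * f0 + X 1 * f1, X 0 * g0 + X 1 * g1,
      (key biH_X0 hf0).add (key biH_X1 hf1), (key biH_X0 hg0).add (key biH_X1 hg1), by ring⟩

/-- Surjectivity of restriction of forms to the curve. -/
lemma phi_surj (hp : p.IsWeightedHomogeneous w4 (e + 1, 0))
    (hq : q.IsWeightedHomogeneous w4 (e + 1, 0)) (hp0 : p ≠ 0) (hpq : IsRelPrime p q) {a b : ℕ}
    (hab : e ≤ a ∨ b = 0)
    {h : MvPolynomial (Fin 4) k} (hh : h.IsWeightedHomogeneous w4 (a + (e + 1) * b, 0)) :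
    ∃ f : MvPolynomial (Fin 4) k, f.IsWeightedHomogeneous w4 (a, b) ∧ phi p q f = h := by
  induction b generalizing h with
  | zero => exact ⟨h, by simpa using hh, biH_no_X3 hh _ rfl rfl⟩
  | succ b ih =>
    have ha : e ≤ a := by omega
    obtain ⟨a, rfl⟩ := Nat.exists_eq_add_of_le ha
    have e1 : e + a + (e + 1) * (b + 1) = 2 * e + 1 + (a + (e + 1) * b) := by ring
    rw [e1] at hh
    obtain ⟨f, g, hf, hg, rfl⟩ := surj_step hp hq hp0 hpq _ hh
    rw [← add_assoc] at hf hg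
    obtain ⟨f', hf', rfl⟩ := ih (Or.inl ha) hf
    obtain ⟨g', hg', rfl⟩ := ih (Or.inl ha) hg
    refine ⟨X 3 * f' + X 2 * g', ?_, by simp [phi]⟩
    have h1 := biH_X3.mul hf'
    have h2 := biH_X2.mul hg'
    have e2 : ((0, 1) + (e + a, b) : ℕ × ℕ) = (e + a, b + 1) := by ext <;> simp; ring
    rw [e2] at h1 h2
    exact h1.add h2

end

/-- Points lying on the graph of a morphism `P^1 → P^1` of degree `e+1`. -/
structure Curve {s : ℕ} (e : ℕ) (Z : Fin s → (k × k) × (k × k)) (p q : MvPolynomial (Fin 4) k) :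
    Prop where
  hp : p.IsWeightedHomogeneous w4 (e + 1, 0)
  hq : q.IsWeightedHomogeneous w4 (e + 1, 0)
  hp0 : p ≠ 0
  hpq : IsRelPrime p q
  rep : ∀ i, IsPtRep k (Z i)
  nz : ∀ i, ¬ (evp (Z i) p = 0 ∧ evp (Z i) q = 0)
  on : ∀ i, evp (Z i) p * (Z i).2.1 = evp (Z i) q * (Z i).2.2
  dist : ∀ i j, i ≠ j → ¬ ProjEq k (Z i).1 (Z j).1

/-- Product of the linear forms in `x`. -/
def TT {s : ℕ} (Z : Fin s → (k × k) × (k × k)) : MvPolynomial (Fin 4) k := ∏ i, lx (Z i).1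

lemma TT_biH {s : ℕ} (Z : Fin s → (k × k) × (k × k)) : (TT Z).IsWeightedHomogeneous w4 (s, 0) := by
  have := IsWeightedHomogeneous.prod Finset.univ (fun i => lx (Z i).1) (fun _ => ((1, 0) : ℕ × ℕ))
    (fun i _ => biH_lin _ _)
  have e : ∑ _i : Fin s, ((1, 0) : ℕ × ℕ) = (s, 0) := by
    rw [Finset.sum_const]
    ext <;> simp
  rw [e] at this
  exact this

lemma lx_relprime {a b : k × k} (h : ¬ ProjEq k a b) :
    IsRelPrime (lx a : MvPolynomial (Fin 4) k) (lx b) := by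
  intro d h1 h2
  have hu : IsUnit (a.1 * b.2 - a.2 * b.1) := by
    rw [isUnit_iff_ne_zero, sub_ne_zero]; exact h
  have hu' : IsUnit (C (a.1 * b.2 - a.2 * b.1) : MvPolynomial (Fin 4) k) := hu.map C
  have h3 : d ∣ C (a.1 * b.2 - a.2 * b.1) * X 0 := by
    convert dvd_sub (h2.mul_left (C a.1)) (h1.mul_left (C b.1)) using 1
    simp [lx]; ring
  have h4 : d ∣ C (a.1 * b.2 - a.2 * b.1) * X 1 := by
    convert dvd_sub (h2.mul_left (C a.2)) (h1.mul_left (C b.2)) using 1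
    simp [lx]; ring
  rw [hu'.dvd_mul_left] at h3 h4
  exact relprime_X h3 h4

namespace Curve
variable {s e : ℕ} {Z : Fin s → (k × k) × (k × k)} {p q : MvPolynomial (Fin 4) k}

lemma lx_pow_dvd (c : Curve e Z p q) (i : Fin s) {m : ℕ} {f : MvPolynomial (Fin 4) k}
    (hf : f ∈ pointIdeal k (Z i) ^ m) : lx (Z i).1 ^ m ∣ phi p q f := by
  have h1 : (pointIdeal k (Z i)).map (phi p q) ≤ Ideal.span {lx (Z i).1} := by
    rw [pointIdeal_eq, Ideal.map_span, Ideal.span_le]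
    rintro _ ⟨g, (rfl | rfl), rfl⟩
    · rw [SetLike.mem_coe, Ideal.mem_span_singleton]
      simp [phi, lx, algHom_C]
    · rw [SetLike.mem_coe, Ideal.mem_span_singleton]
      have : phi p q (ly (Z i).2) = C (Z i).2.2 * q - C (Z i).2.1 * p := by
        simp [phi, ly, algHom_C]
      rw [this]
      refine lx_dvd (c.rep i).1 (Z i).2 ((c.hq.C_mul _).sub (c.hp.C_mul _)) ?_
      have := c.on i
      simp only [map_sub, map_mul, algHom_C, Algebra.algebraMap_self, RingHom.id_apply]
      linear_combination -this
  have h2 : phi p q f ∈ ((pointIdeal k (Z i)).map (phi p q)) ^ m := by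
    rw [← Ideal.map_pow]; exact Ideal.mem_map_of_mem _ hf
  have h3 := Ideal.pow_right_mono h1 m h2
  rwa [Ideal.span_singleton_pow, Ideal.mem_span_singleton] at h3

lemma TT_pow_dvd (c : Curve e Z p q) {m : ℕ} {f : MvPolynomial (Fin 4) k}
    (hf : f ∈ symbolicPower k Z m) : TT Z ^ m ∣ phi p q f := by
  rw [symbolicPower, Ideal.mem_iInf] at hf
  rw [TT, ← Finset.prod_pow]
  refine Finset.prod_dvd_of_isRelPrime ?_ fun i _ => c.lx_pow_dvd i (hf i)
  intro i _ j _ hij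
  exact (lx_relprime (c.dist i j hij)).pow

lemma evp_lift (c : Curve e Z p q) (i : Fin s) {a b : ℕ} {f : MvPolynomial (Fin 4) k}
    (hf : f.IsWeightedHomogeneous w4 (a, b)) (h : phi p q f = TT Z) : evp (Z i) f = 0 := by
  have h1 : evp (Z i) (phi p q f) = 0 := by
    rw [h, TT, map_prod]
    refine Finset.prod_eq_zero (Finset.mem_univ i) (evp_of_mem (lx_mem (Z i)))
  have h2 : evp (Z i) (phi p q f) =
      aeval ![(Z i).1.1, (Z i).1.2, evp (Z i) q, evp (Z i) p] f := by
    have : (evp (Z i)).comp (phi p q) = aeval ![(Z i).1.1, (Z i).1.2, evp (Z i) q, evp (Z i) p] := by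
      ext j
      fin_cases j <;> simp [phi, evp]
    rw [← this]; rfl
  obtain ⟨t, ht0, ht1, ht2⟩ : ∃ t : k, t ≠ 0 ∧ evp (Z i) q = t * (Z i).2.1 ∧
      evp (Z i) p = t * (Z i).2.2 := by
    have h3 := c.on i
    have h4 := c.nz i
    by_cases hb : (Z i).2.1 = 0
    · have hb2 : (Z i).2.2 ≠ 0 := fun hb2 => (c.rep i).2 (Prod.ext hb hb2)
      rw [hb, mul_zero, eq_comm, mul_eq_zero] at h3
      have h5 := h3.resolve_right hb2
      refine ⟨evp (Z i) p / (Z i).2.2, ?_, by simp [hb, h5], by field_simp⟩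
      exact div_ne_zero (fun h => h4 ⟨h, h5⟩) hb2
    · refine ⟨evp (Z i) q / (Z i).2.1, ?_, by field_simp, by field_simp; exact h3⟩
      refine div_ne_zero (fun h => h4 ⟨?_, h⟩) hb
      rw [h, zero_mul, mul_eq_zero] at h3
      exact h3.resolve_right hb
  rw [h1, ht1, ht2] at h2
  have h3 := aeval_scale (A := k) 1 t (Z i).1.1 (Z i).1.2 (Z i).2.1 (Z i).2.2 hf
  simp only [one_mul, one_pow] at h3
  rw [← h2, eq_comm, mul_eq_zero] at h3
  exact h3.resolve_left (pow_ne_zero _ ht0)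

lemma lift_one (c : Curve e Z p q) {a b : ℕ} (hs : s = a + (e + 1) * b) (ha : e ≤ a) :
    ∃ f ∈ idealOfPoints k Z, f.IsWeightedHomogeneous w4 (a, b) ∧ phi p q f = TT Z := by
  have hT := TT_biH Z
  obtain ⟨f, hf, h⟩ := phi_surj c.hp c.hq c.hp0 c.hpq (a := a) (b := b) (Or.inl ha) (h := TT Z)
    (by rw [← hs]; exact hT)
  refine ⟨f, ?_, hf, h⟩
  rw [idealOfPoints, Ideal.mem_iInf]
  exact fun i => (mem_point_iff (c.rep i) hf).2 (c.evp_lift i hf h)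

lemma lift_pow (c : Curve e Z p q) {A B : ℕ} (hs : s = A + (e + 1) * B) (hA : e ≤ A)
    (m : ℕ) : ∀ β α : ℕ, β ≤ m * B → α + (e + 1) * β = s * m →
    ∃ f ∈ idealOfPoints k Z ^ m, f.IsWeightedHomogeneous w4 (α, β) ∧ phi p q f = TT Z ^ m := by
  induction m with
  | zero =>
    intro β α hβ hα
    have h1 : β = 0 := by omega
    subst h1
    have h2 : α = 0 := by omega
    subst h2
    exact ⟨1, by simp, isWeightedHomogeneous_one k w4, by simp⟩
  | succ m ih =>
    intro β α hβ hα
    obtain ⟨b, β', hb, hβ', rfl⟩ : ∃ b β', b ≤ B ∧ β' ≤ m * B ∧ β = b + β' := by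
      rw [add_mul, one_mul] at hβ
      rcases le_total β B with h | h
      · exact ⟨β, 0, h, Nat.zero_le _, rfl⟩
      · exact ⟨B, β - B, le_rfl, by omega, by omega⟩
    have hle1 : (e + 1) * b ≤ (e + 1) * B := Nat.mul_le_mul_left _ hb
    have hle2 : (e + 1) * β' ≤ s * m := by
      calc (e + 1) * β' ≤ (e + 1) * (m * B) := Nat.mul_le_mul_left _ hβ'
        _ = ((e + 1) * B) * m := by ring
        _ ≤ s * m := Nat.mul_le_mul_right _ (by omega)
    obtain ⟨f, hf, hf1, hf2⟩ := c.lift_one (a := s - (e + 1) * b) (b := b) (by omega) (by omega)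
    obtain ⟨g, hg, hg1, hg2⟩ := ih β' (s * m - (e + 1) * β') hβ' (by omega)
    refine ⟨g * f, ?_, ?_, ?_⟩
    · rw [pow_succ]; exact Ideal.mul_mem_mul hg hf
    · convert hg1.mul hf1 using 1
      rw [mul_add, mul_add, mul_one] at hα
      ext
      · simp; omega
      · simp; omega
    · rw [map_mul, hf2, hg2, pow_succ]

lemma G_mem (c : Curve e Z p q) : p * X 2 - q * X 3 ∈ idealOfPoints k Z := by
  rw [idealOfPoints, Ideal.mem_iInf]
  intro i
  refine (mem_point_iff (c.rep i) (a := e + 1) (b := 1) ?_).2 ?_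
  · have h1 := c.hp.mul biH_X2
    have h2 := c.hq.mul biH_X3
    exact h1.sub h2
  · have := c.on i
    have h1 : evp (Z i) (X 2) = (Z i).2.1 := by simp [evp]
    have h2 : evp (Z i) (X 3) = (Z i).2.2 := by simp [evp]
    rw [map_sub, map_mul, map_mul, h1, h2, this, sub_self]

lemma G_notMem (c : Curve e Z p q) (i : Fin s) :
    p * X 2 - q * X 3 ∉ pointIdeal k (Z i) ^ 2 := by
  intro hG
  obtain ⟨w, hw⟩ := exists_Compl (c.rep i)
  let θ : MvPolynomial (Fin 4) k →ₐ[k] Polynomial k :=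
    aeval ![Polynomial.C (Z i).1.1, Polynomial.C (Z i).1.2,
      Polynomial.C (Z i).2.1 + Polynomial.X * Polynomial.C w.2.1,
      Polynomial.C (Z i).2.2 + Polynomial.X * Polynomial.C w.2.2]
  have h1 : (pointIdeal k (Z i)).map θ ≤ Ideal.span {Polynomial.X} := by
    rw [pointIdeal_eq, Ideal.map_span, Ideal.span_le]
    rintro _ ⟨g, (rfl | rfl), rfl⟩
    · rw [SetLike.mem_coe, Ideal.mem_span_singleton]
      have : θ (lx (Z i).1) = 0 := by simp [θ, lx, algHom_C]; ring
      rw [this]; exact dvd_zero _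
    · rw [SetLike.mem_coe, Ideal.mem_span_singleton]
      refine ⟨Polynomial.C ((Z i).2.2) * Polynomial.C w.2.1 -
        Polynomial.C ((Z i).2.1) * Polynomial.C w.2.2, ?_⟩
      simp [θ, ly, algHom_C]; ring
  have h2 : θ (p * X 2 - q * X 3) ∈ ((pointIdeal k (Z i)).map θ) ^ 2 := by
    rw [← Ideal.map_pow]; exact Ideal.mem_map_of_mem _ hG
  have h3 := Ideal.pow_right_mono h1 2 h2
  rw [Ideal.span_singleton_pow, Ideal.mem_span_singleton, Polynomial.X_pow_dvd_iff] at h3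
  have key : ∀ f : MvPolynomial (Fin 4) k, f.IsWeightedHomogeneous w4 (e + 1, 0) →
      θ f = Polynomial.C (evp (Z i) f) := by
    intro f hf
    refine biH_induction (P := fun f => θ f = Polynomial.C (evp (Z i) f)) (by simp) ?_ ?_ hf
    · intro f g hf hg; simp only [map_add, hf, hg]
    · intro d u u' v v' _ h2
      have h3 : v = 0 := by omega
      have h4 : v' = 0 := by omega
      subst h3 h4
      simp [θ, evp, algHom_C]
  have h4 : θ (p * X 2 - q * X 3) = Polynomial.C (evp (Z i) p) *
      (Polynomial.C (Z i).2.1 + Polynomial.X * Polynomial.C w.2.1) - Polynomial.C (evp (Z i) q) *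
      (Polynomial.C (Z i).2.2 + Polynomial.X * Polynomial.C w.2.2) := by
    rw [map_sub, map_mul, map_mul, key p c.hp, key q c.hq]
    simp [θ]
  rw [h4] at h3
  have h5 := h3 1 (by norm_num)
  simp [Polynomial.coeff_X, Polynomial.coeff_C] at h5
  have h6 := c.on i
  have h7 := hw.2
  refine c.nz i ⟨?_, ?_⟩
  · linear_combination (Z i).2.2 * h5 - w.2.2 * h6 - evp (Z i) p * h7
  · linear_combination (Z i).2.1 * h5 - w.2.1 * h6 - evp (Z i) q * h7

lemma step (c : Curve e Z p q) {A B : ℕ} (hs : s = A + (e + 1) * B) (hA : e ≤ A) {m i j : ℕ}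
    {H : MvPolynomial (Fin 4) k} (hH : H.IsWeightedHomogeneous w4 (i, j))
    (hHm : H ∈ symbolicPower k Z m) (hij : j ≤ m * B ∨ m * A + e ≤ i) :
    ∃ K ∈ idealOfPoints k Z ^ m, K.IsWeightedHomogeneous w4 (i, j) ∧ phi p q H = phi p q K := by
  obtain ⟨h, hh⟩ := c.TT_pow_dvd hHm
  have h1 := phi_biH c.hp c.hq hH
  rw [hh] at h1
  rcases biH_div ((TT_biH Z).pow m) h1 with h2 | ⟨hle, h', hh', h2⟩
  · exact ⟨0, zero_mem _, isWeightedHomogeneous_zero _ _ _, by rw [hh, h2, map_zero]⟩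
  · have hle' : s * m ≤ i + (e + 1) * j := by
      have := hle.1
      simp at this
      linarith
    obtain ⟨α, β, hβ, hβj, hαi, hαβ, hcond⟩ : ∃ α β, β ≤ m * B ∧ β ≤ j ∧ α ≤ i ∧
        α + (e + 1) * β = s * m ∧ (e ≤ i - α ∨ j - β = 0) := by
      have hsm : s * m = m * A + (e + 1) * (m * B) := by rw [hs]; ring
      rcases le_total j (m * B) with hj | hj
      · have := Nat.mul_le_mul_left (e + 1) hj
        exact ⟨s * m - (e + 1) * j, j, hj, le_rfl, by omega, by omega, by omega⟩
      · rcases hij with hij | hij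
        · have hj' : j = m * B := le_antisymm hij hj
          rw [← hj'] at hsm
          exact ⟨m * A, j, by omega, le_rfl, by omega, by omega, by omega⟩
        · exact ⟨m * A, m * B, le_rfl, hj, by omega, by omega, by omega⟩
    obtain ⟨f, hf, hf1, hf2⟩ := c.lift_pow hs hA m β α hβ hαβ
    obtain ⟨g, hg1, hg2⟩ := phi_surj c.hp c.hq c.hp0 c.hpq (a := i - α) (b := j - β) hcond
      (h := h') (by
        convert hh' using 1
        have h5 : (e + 1) * β ≤ (e + 1) * j := Nat.mul_le_mul_left _ hβj
        ext
        · simp [Nat.mul_sub]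
          rw [mul_comm m s]
          omega
        · simp)
    refine ⟨f * g, Ideal.mul_mem_right _ _ hf, ?_, ?_⟩
    · convert hf1.mul hg1 using 1
      ext <;> simp <;> omega
    · rw [hh, h2, map_mul, hf2, hg2]

lemma finish (c : Curve e Z p q) {A B : ℕ} (hs : s = A + (e + 1) * B) (hA : e ≤ A) {m i j : ℕ}
    (ih : symbolicPower k Z m ≤ idealOfPoints k Z ^ m)
    {H : MvPolynomial (Fin 4) k} (hH : H.IsWeightedHomogeneous w4 (i, j))
    (hHm : H ∈ symbolicPower k Z (m + 1)) (hij : j ≤ (m + 1) * B ∨ (m + 1) * A + e ≤ i) :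
    H ∈ idealOfPoints k Z ^ (m + 1) := by
  obtain ⟨K, hK, hK1, hK2⟩ := c.step hs hA hH hHm hij
  obtain ⟨H', hH'⟩ := phi_ker c.hp c.hp0 c.hpq (hH.sub hK1) (by rw [map_sub, hK2, sub_self])
  have h1 : ∀ a, p * X 2 - q * X 3 ∈ idealOfPoints k Z ∧ K ∈ pointIdeal k (Z a) ^ (m + 1) := by
    intro a
    refine ⟨c.G_mem, Ideal.pow_right_mono ?_ _ hK⟩
    exact iInf_le _ a
  have h2 : H' ∈ symbolicPower k Z m := by
    rw [symbolicPower, Ideal.mem_iInf] at *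
    intro a
    refine mul_mem_cancel (c.rep a) (c.G_notMem a) ?_
    rw [← hH']
    exact Ideal.sub_mem _ (hHm a) (h1 a).2
  have h3 : H = (p * X 2 - q * X 3) * H' + K := by rw [← hH']; ring
  rw [h3]
  refine Ideal.add_mem _ ?_ hK
  rw [pow_succ']
  exact Ideal.mul_mem_mul c.G_mem (ih h2)

end Curve

lemma pow_le_symb {s : ℕ} (Z : Fin s → (k × k) × (k × k)) (m : ℕ) :
    idealOfPoints k Z ^ m ≤ symbolicPower k Z m :=
  le_iInf fun i => Ideal.pow_right_mono (iInf_le _ i) m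

/-- Points on a smooth `(1,1)`-curve. -/
lemma eq_of_curve_zero {s : ℕ} {Z : Fin s → (k × k) × (k × k)} {p q : MvPolynomial (Fin 4) k}
    (c : Curve 0 Z p q) (m : ℕ) : idealOfPoints k Z ^ m = symbolicPower k Z m := by
  refine le_antisymm (pow_le_symb Z m) ?_
  induction m with
  | zero => simp
  | succ m ih =>
    refine homI_le (homI_symb Z _) fun a b f hf hab => ?_
    exact c.finish (A := 0) (B := s) (by omega) le_rfl ih hab hf (Or.inr (by omega))

/-- The swap of the two factors. -/
def swp : MvPolynomial (Fin 4) k →ₐ[k] MvPolynomial (Fin 4) k := aeval ![X 2, X 3, X 0, X 1]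

lemma swp_swp (f : MvPolynomial (Fin 4) k) : swp (swp f) = f := by
  have : (swp (k := k)).comp swp = AlgHom.id k _ := by
    ext i
    fin_cases i <;> simp [swp]
  exact congrArg (fun F => F f) this

lemma swp_point (p : (k × k) × (k × k)) :
    (pointIdeal k p).map (swp (k := k)) ≤ pointIdeal k p.swap := by
  rw [pointIdeal_eq, Ideal.map_span, Ideal.span_le]
  rintro _ ⟨g, (rfl | rfl), rfl⟩
  · have : swp (lx p.1) = ly p.swap.2 := by simp [swp, lx, ly, algHom_C]
    rw [this]; exact ly_mem _
  · have : swp (ly p.2) = lx p.swap.1 := by simp [swp, lx, ly, algHom_C]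
    rw [this]; exact lx_mem _

lemma swp_symb {s : ℕ} {Z : Fin s → (k × k) × (k × k)} {m : ℕ} {f : MvPolynomial (Fin 4) k}
    (hf : f ∈ symbolicPower k Z m) : swp f ∈ symbolicPower k (fun i => (Z i).swap) m := by
  rw [symbolicPower, Ideal.mem_iInf] at *
  intro i
  refine Ideal.pow_right_mono (swp_point (Z i)) m ?_
  rw [← Ideal.map_pow]
  exact Ideal.mem_map_of_mem _ (hf i)

lemma swp_ideal_pow {s : ℕ} {Z : Fin s → (k × k) × (k × k)} {m : ℕ} {f : MvPolynomial (Fin 4) k}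
    (hf : f ∈ idealOfPoints k Z ^ m) : swp f ∈ idealOfPoints k (fun i => (Z i).swap) ^ m := by
  have h1 : (idealOfPoints k Z).map (swp (k := k)) ≤ idealOfPoints k (fun i => (Z i).swap) := by
    rw [Ideal.map_le_iff_le_comap]
    intro g hg
    rw [← symb_one] at hg
    rw [Ideal.mem_comap, ← symb_one]
    exact swp_symb hg
  refine Ideal.pow_right_mono h1 m ?_
  rw [← Ideal.map_pow]
  exact Ideal.mem_map_of_mem _ hf

lemma swp_biH {a b : ℕ} {f : MvPolynomial (Fin 4) k} (hf : f.IsWeightedHomogeneous w4 (a, b)) :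
    (swp f).IsWeightedHomogeneous w4 (b, a) := by
  refine biH_induction (P := fun f => (swp f).IsWeightedHomogeneous w4 (b, a))
    (by rw [map_zero]; exact isWeightedHomogeneous_zero _ _ _) ?_ ?_ hf
  · intro f g hf hg; rw [map_add]; exact hf.add hg
  · intro c u u' v v' h1 h2
    have h := (biH_mon (k := k) v v' u u').C_mul c
    rw [h1, h2] at h
    convert h using 1
    simp only [swp, algHom_C, map_mul, map_pow, aeval_X]
    simp
    left
    ring

/-- Five points on smooth curves of bidegrees `(2,1)` and `(1,2)`. -/
lemma eq_of_curve_one {Z : Fin 5 → (k × k) × (k × k)} {p q p' q' : MvPolynomial (Fin 4) k}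
    (c : Curve 1 Z p q) (c' : Curve 1 (fun i => (Z i).swap) p' q') (m : ℕ) :
    idealOfPoints k Z ^ m = symbolicPower k Z m := by
  refine le_antisymm (pow_le_symb Z m) ?_
  induction m with
  | zero => simp
  | succ m ih =>
    refine homI_le (homI_symb Z _) fun a b f hf hab => ?_
    by_cases h : m + 1 + 1 ≤ a
    · exact c.finish (A := 1) (B := 2) (by norm_num) le_rfl ih hab hf (Or.inr (by omega))
    · have ih' : symbolicPower k (fun i => (Z i).swap) m ≤
          idealOfPoints k (fun i => (Z i).swap) ^ m := by
        intro g hg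
        have h0 := swp_symb hg
        have eZ : (fun i => ((fun i => (Z i).swap) i).swap) = Z := by
          funext i; simp
        rw [eZ] at h0
        have h1 := swp_ideal_pow (ih h0)
        rw [swp_swp] at h1
        exact h1
      have h1 := c'.finish (A := 1) (B := 2) (by norm_num) le_rfl ih' (swp_biH hab) (swp_symb hf)
        (Or.inl (by omega))
      have h2 := swp_ideal_pow h1
      have eZ : (fun i => ((fun i => (Z i).swap) i).swap) = Z := by
        funext i; simp
      rw [eZ, swp_swp] at h2
      exact h2
end SymPow

namespace SymPow
variable {k : Type*} [Field k]
/-- Polynomial minors of the evaluation matrix in bidegree `(a,b)`. -/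
def detG (k : Type*) [Field k] {s : ℕ} (a b r : ℕ) (α : Fin r ↪ Fin (a + 1) × Fin (b + 1))
    (σ : Fin r ↪ Fin s) : MvPolynomial (Fin s × Fin 4) k :=
  Matrix.det (Matrix.of fun i j => rename (fun t => (σ j, t)) (mon k a b (α i)))

lemma rename_mon_biH {s : ℕ} (a b : ℕ) (u : Fin (a + 1) × Fin (b + 1)) (j : Fin s) :
    (rename (fun t => (j, t)) (mon k a b u)).IsWeightedHomogeneous (wProd s)
      (Pi.single j (a, b)) := by
  have h : ∀ t : Fin 4, (X (j, t) : MvPolynomial (Fin s × Fin 4) k).IsWeightedHomogeneous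
      (wProd s) (Pi.single j (w4 t)) := fun t => isWeightedHomogeneous_X k (wProd s) (j, t)
  have h2 := ((((h 0).pow u.1).mul ((h 1).pow (a - u.1))).mul ((h 2).pow u.2)).mul
    ((h 3).pow (b - u.2))
  simp only [mon, map_mul, map_pow, rename_X]
  have h1 := u.1.2
  have h1' := u.2.2
  have e : (Pi.single j (a, b) : Fin s → ℕ × ℕ) = (u.1 : ℕ) • Pi.single j (w4 0) +
      (a - u.1) • Pi.single j (w4 1) + (u.2 : ℕ) • Pi.single j (w4 2) +
      (b - u.2) • Pi.single j (w4 3) := by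
    simp only [← Pi.single_smul, ← Pi.single_add]
    congr 1
    ext
    · simp [w4]; omega
    · simp [w4]; omega
  rw [e]
  exact h2

lemma detG_biH {s : ℕ} (a b r : ℕ) (α : Fin r ↪ Fin (a + 1) × Fin (b + 1)) (σ : Fin r ↪ Fin s) :
    (detG k a b r α σ).IsWeightedHomogeneous (wProd s) (∑ j, Pi.single (σ j) (a, b)) := by
  rw [detG, Matrix.det_apply']
  refine IsWeightedHomogeneous.sum _ _ _ fun π _ => ?_
  have h := IsWeightedHomogeneous.prod Finset.univ
    (fun j => rename (fun t => (σ j, t)) (mon k a b (α (π j))))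
    (fun j => (Pi.single (σ j) (a, b) : Fin s → ℕ × ℕ)) (fun j _ => rename_mon_biH a b _ _)
  have h2 := h.C_mul (((Equiv.Perm.sign π : ℤˣ) : ℤ) : k)
  simpa using h2

lemma detG_ne {s : ℕ} (a b r : ℕ) (α : Fin r ↪ Fin (a + 1) × Fin (b + 1)) (σ : Fin r ↪ Fin s) :
    detG k a b r α σ ≠ 0 := by
  classical
  intro h0
  let E : Equiv.Perm (Fin r) → (Fin s × Fin 4 →₀ ℕ) := fun π =>
    ∑ j, Finsupp.mapDomain (fun t => (σ j, t)) (expo a b (α (π j)))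
  have hE : ∀ π j t, E π (σ j, t) = expo a b (α (π j)) t := by
    intro π j t
    simp only [E, Finsupp.finsetSum_apply]
    rw [Finset.sum_eq_single j]
    · exact Finsupp.mapDomain_apply (fun x y h => (Prod.ext_iff.1 h).2) _ _
    · intro j' _ hj
      apply Finsupp.mapDomain_notin_range
      rintro ⟨t', ht⟩
      exact hj (σ.injective (Prod.ext_iff.1 ht).1)
    · simp
  have hinj : ∀ π, E π = E 1 → π = 1 := by
    intro π h
    ext1 j
    apply α.injective
    apply expo_inj a b
    ext t
    rw [← hE, h, hE]
  have h1 : detG k a b r α σ = ∑ π : Equiv.Perm (Fin r),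
      monomial (E π) (((Equiv.Perm.sign π : ℤˣ) : ℤ) : k) := by
    rw [detG, Matrix.det_apply']
    refine Finset.sum_congr rfl fun π _ => ?_
    rw [monomial_sum_index]
    simp [mon_eq, rename_monomial]
  have h2 := congrArg (coeff (E 1)) h1
  rw [h0, coeff_sum, Finset.sum_eq_single 1] at h2
  · simp at h2
  · intro π _ hπ
    rw [coeff_monomial, if_neg fun h => hπ (hinj π h)]
  · simp

/-- The generic condition: no minors vanish in bidegrees `< N`. -/
def Gen (N : ℕ) {s : ℕ} (Z : Fin s → (k × k) × (k × k)) : Prop :=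
  ∀ a < N, ∀ b < N, ∀ (r : ℕ) (α : Fin r ↪ Fin (a + 1) × Fin (b + 1)) (σ : Fin r ↪ Fin s),
    Matrix.det (Matrix.of fun i j => evp (Z (σ j)) (mon k a b (α i))) ≠ 0

lemma eval_detG {s : ℕ} (Z : Fin s → (k × k) × (k × k)) (a b r : ℕ)
    (α : Fin r ↪ Fin (a + 1) × Fin (b + 1)) (σ : Fin r ↪ Fin s) :
    eval (coordsOf k Z) (detG k a b r α σ) =
      Matrix.det (Matrix.of fun i j => evp (Z (σ j)) (mon k a b (α i))) := by
  rw [detG, RingHom.map_det]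
  congr 1
  ext i j
  simp [mon, evp, coordsOf]

/-- The product of all minors. -/
def bigG (k : Type*) [Field k] (N s : ℕ) : MvPolynomial (Fin s × Fin 4) k :=
  ∏ a ∈ Finset.range N, ∏ b ∈ Finset.range N, ∏ r ∈ Finset.range (s + 1),
    ∏ α : Fin r ↪ Fin (a + 1) × Fin (b + 1), ∏ σ : Fin r ↪ Fin s, detG k a b r α σ

lemma generalPosition_of_gen [Infinite k] (N : ℕ) {s : ℕ}
    {P : (Fin s → (k × k) × (k × k)) → Prop}
    (hP : ∀ Z, (∀ i, IsPtRep k (Z i)) → (∀ i j, i ≠ j → ¬ PtEq k (Z i) (Z j)) → Gen N Z → P Z) :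
    GeneralPosition k s P := by
  refine ⟨bigG k N s, ∑ a ∈ Finset.range N, ∑ b ∈ Finset.range N, ∑ r ∈ Finset.range (s + 1),
    ∑ _α : Fin r ↪ Fin (a + 1) × Fin (b + 1), ∑ σ : Fin r ↪ Fin s,
      ∑ j, Pi.single (σ j) (a, b), ?_, ?_, ?_⟩
  · refine IsWeightedHomogeneous.prod _ _ _ fun a _ => ?_
    refine IsWeightedHomogeneous.prod _ _ _ fun b _ => ?_
    refine IsWeightedHomogeneous.prod _ _ _ fun r _ => ?_
    refine IsWeightedHomogeneous.prod _ _ _ fun α _ => ?_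
    refine IsWeightedHomogeneous.prod _ _ _ fun σ _ => ?_
    exact detG_biH a b r α σ
  · have hne : bigG k N s * ∏ i : Fin s, (X (i, 0) * X (i, 2)) ≠ 0 := by
      refine mul_ne_zero ?_ ?_
      · simp only [bigG, Finset.prod_ne_zero_iff]
        intro a _ b _ r _ α _ σ _
        exact detG_ne a b r α σ
      · rw [Finset.prod_ne_zero_iff]
        intro i _
        exact mul_ne_zero (X_ne_zero _) (X_ne_zero _)
    have : ∃ x : Fin s × Fin 4 → k, eval x (bigG k N s * ∏ i : Fin s, (X (i, 0) * X (i, 2))) ≠ 0 := by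
      by_contra! h
      exact hne (MvPolynomial.funext fun x => by rw [h x, map_zero])
    obtain ⟨x, hx⟩ := this
    rw [map_mul] at hx
    have hx1 := left_ne_zero_of_mul hx
    have hx2 := right_ne_zero_of_mul hx
    rw [map_prod, Finset.prod_ne_zero_iff] at hx2
    refine ⟨fun i => ((x (i, 0), x (i, 1)), (x (i, 2), x (i, 3))), fun i => ?_, ?_⟩
    · have := hx2 i (Finset.mem_univ i)
      simp only [map_mul, eval_X] at this
      exact ⟨fun h => left_ne_zero_of_mul this (Prod.ext_iff.1 h).1,
        fun h => right_ne_zero_of_mul this (Prod.ext_iff.1 h).1⟩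
    · convert hx1 using 2
      congr 1
      funext ⟨i, t⟩
      fin_cases t <;> simp [coordsOf]
  · intro Z hZ hd hG
    refine hP Z hZ hd ?_
    intro a ha b hb r α σ
    have hr : r ≤ s := by simpa using Fintype.card_le_of_embedding σ
    simp only [bigG, map_prod, Finset.prod_ne_zero_iff] at hG
    rw [← eval_detG]
    exact hG a (Finset.mem_range.2 ha) b (Finset.mem_range.2 hb) r
      (Finset.mem_range.2 (by omega)) α (Finset.mem_univ _) σ (Finset.mem_univ _)

/-- Evaluation at points, on forms of bidegree `(a,b)`. -/
def ev {t : ℕ} (W : Fin t → (k × k) × (k × k)) (a b : ℕ) : RR k a b →ₗ[k] (Fin t → k) :=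
  LinearMap.pi fun j => (evp (W j)).toLinearMap ∘ₗ (RR k a b).subtype

@[simp] lemma ev_apply {t : ℕ} (W : Fin t → (k × k) × (k × k)) (a b : ℕ) (f : RR k a b)
    (j : Fin t) : ev W a b f j = evp (W j) f := rfl

lemma Gen.finrank_ker_min {N s : ℕ} {Z : Fin s → (k × k) × (k × k)} (h : Gen N Z) {a b : ℕ}
    (ha : a < N) (hb : b < N) {r : ℕ} (hr : r ≤ (a + 1) * (b + 1)) (σ : Fin r ↪ Fin s) :
    Module.finrank k (LinearMap.ker (ev (Z ∘ σ) a b)) + r = (a + 1) * (b + 1) := by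
  have hα : Nonempty (Fin r ↪ Fin (a + 1) × Fin (b + 1)) :=
    Function.Embedding.nonempty_of_card_le (by simpa using hr)
  obtain ⟨α⟩ := hα
  have hdet := h a ha b hb r α σ
  have hli := Matrix.linearIndependent_rows_of_det_ne_zero hdet
  have hsurj : LinearMap.range (ev (Z ∘ σ) a b) = ⊤ := by
    rw [eq_top_iff, ← hli.span_eq_top_of_card_eq_finrank' (by simp), Submodule.span_le]
    rintro _ ⟨i, rfl⟩
    refine ⟨⟨mon k a b (α i), mon_mem a b _⟩, ?_⟩
    funext j
    rfl
  have h1 := LinearMap.finrank_range_add_finrank_ker (ev (Z ∘ σ) a b)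
  rw [hsurj, finrank_top, finrank_RR] at h1
  simp at h1
  omega

lemma Gen.finrank_ker {N s : ℕ} {Z : Fin s → (k × k) × (k × k)} (h : Gen N Z) {a b : ℕ}
    (ha : a < N) (hb : b < N) {t : ℕ} (σ : Fin t ↪ Fin s) :
    Module.finrank k (LinearMap.ker (ev (Z ∘ σ) a b)) ≤ (a + 1) * (b + 1) - t := by
  by_cases ht : t ≤ (a + 1) * (b + 1)
  · have := h.finrank_ker_min ha hb ht σ
    omega
  · have := h.finrank_ker_min ha hb le_rfl ((Fin.castLEEmb (by omega)).trans σ :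
      Fin ((a + 1) * (b + 1)) ↪ Fin s)
    refine le_trans (Submodule.finrank_mono (t := LinearMap.ker (ev (Z ∘ (((Fin.castLEEmb
      (by omega)).trans σ : Fin ((a + 1) * (b + 1)) ↪ Fin s))) a b)) ?_) (by omega)
    intro f hf
    rw [LinearMap.mem_ker] at hf ⊢
    funext j
    exact congrFun hf (Fin.castLE (by omega) j)

lemma Gen.eq_zero {N s : ℕ} {Z : Fin s → (k × k) × (k × k)} (h : Gen N Z) {a b : ℕ}
    (ha : a < N) (hb : b < N) {t : ℕ} (ht : (a + 1) * (b + 1) ≤ t) (σ : Fin t ↪ Fin s)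
    {f : MvPolynomial (Fin 4) k} (hf : f.IsWeightedHomogeneous w4 (a, b))
    (h0 : ∀ i, evp (Z (σ i)) f = 0) : f = 0 := by
  have h1 := h.finrank_ker ha hb σ
  rw [Nat.sub_eq_zero_of_le ht, Nat.le_zero, Submodule.finrank_eq_zero] at h1
  have h2 : (⟨f, hf⟩ : RR k a b) ∈ LinearMap.ker (ev (Z ∘ σ) a b) := by
    rw [LinearMap.mem_ker]
    funext j
    exact h0 j
  rw [h1, Submodule.mem_bot] at h2
  exact congrArg Subtype.val h2
end SymPow

namespace SymPow
variable {k : Type*} [Field k]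
lemma lx_ne_zero {a : k × k} (ha : a ≠ 0) : (lx a : MvPolynomial (Fin 4) k) ≠ 0 := by
  intro h
  apply ha
  have h0 := congrArg (evp ((1, 0), (0, 0))) h
  have h1 := congrArg (evp ((0, 1), (0, 0))) h
  simp [lx, evp] at h0 h1
  exact Prod.ext h1 h0

lemma lx_quot {a : k × k} {e : ℕ} {p : MvPolynomial (Fin 4) k}
    (hp : p.IsWeightedHomogeneous w4 (e + 1, 0)) (h : lx a ∣ p) :
    ∃ p' : MvPolynomial (Fin 4) k, p'.IsWeightedHomogeneous w4 (e, 0) ∧ p = lx a * p' := by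
  obtain ⟨r, rfl⟩ := h
  rcases biH_div (biH_lin a.2 a.1) hp with h | ⟨_, h', h1, h2⟩
  · exact ⟨0, isWeightedHomogeneous_zero _ _ _, by rw [mul_zero]; exact h⟩
  · exact ⟨h', h1, h2⟩

lemma relprime_of_no_zero [IsAlgClosed k] {p q : MvPolynomial (Fin 4) k}
    (h : ∀ a b : k × k, a ≠ 0 → ¬ (evp (a, b) p = 0 ∧ evp (a, b) q = 0)) : IsRelPrime p q := by
  have key : ∀ t : Fin 4, t = 0 ∨ t = 1 → X t ∈ (Ideal.span {p, q}).radical := by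
    intro t ht
    rw [← vanishingIdeal_zeroLocus_eq_radical (K := k), mem_vanishingIdeal_iff]
    intro x hx
    rw [zeroLocus_span] at hx
    have h1 := hx p (by simp)
    have h2 := hx q (by simp)
    have ex : x = ![x 0, x 1, x 2, x 3] := by
      funext i; fin_cases i <;> rfl
    have h3 := h (x 0, x 1) (x 2, x 3)
    simp only [evp] at h3
    rw [← ex] at h3
    by_contra h4
    refine h3 ?_ ⟨h1, h2⟩
    intro h5
    simp only [Prod.mk_eq_zero] at h5
    rw [aeval_X] at h4
    rcases ht with rfl | rfl
    · exact h4 h5.1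
    · exact h4 h5.2
  obtain ⟨n, hn⟩ := key 0 (Or.inl rfl)
  obtain ⟨m, hm⟩ := key 1 (Or.inr rfl)
  rw [Ideal.mem_span_pair] at hn hm
  obtain ⟨u, v, hn⟩ := hn
  obtain ⟨u', v', hm⟩ := hm
  intro d h1 h2
  refine (relprime_X (k := k)).pow (m := n) (n := m) ?_ ?_
  · rw [← hn]; exact dvd_add (h1.mul_left _) (h2.mul_left _)
  · rw [← hm]; exact dvd_add (h1.mul_left _) (h2.mul_left _)

lemma exists_curve [IsAlgClosed k] (e : ℕ) {n : ℕ} [NeZero n] (W : Fin n → (k × k) × (k × k))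
    (hn : n ≤ 2 * e + 3) (rep : ∀ i, IsPtRep k (W i))
    (dist : ∀ i j, i ≠ j → ¬ ProjEq k (W i).1 (W j).1)
    (hno : ∀ p' q' : MvPolynomial (Fin 4) k, p'.IsWeightedHomogeneous w4 (e, 0) →
      q'.IsWeightedHomogeneous w4 (e, 0) → ∀ j, (∀ i, i ≠ j →
        evp (W i) p' * (W i).2.1 = evp (W i) q' * (W i).2.2) → p' = 0 ∧ q' = 0) :
    ∃ p q, Curve e W p q := by
  let L : (RR k (e + 1) 0 × RR k (e + 1) 0) →ₗ[k] (Fin n → k) := LinearMap.pi fun i =>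
    ((W i).2.1 • ((evp (W i)).toLinearMap ∘ₗ (RR k (e + 1) 0).subtype)).comp (LinearMap.fst k _ _) -
    ((W i).2.2 • ((evp (W i)).toLinearMap ∘ₗ (RR k (e + 1) 0).subtype)).comp (LinearMap.snd k _ _)
  have hL : LinearMap.ker L ≠ ⊥ := by
    apply LinearMap.ker_ne_bot_of_finrank_lt
    rw [Module.finrank_prod, finrank_RR]
    simp
    omega
  obtain ⟨⟨⟨p, hp⟩, ⟨q, hq⟩⟩, hpq, hne⟩ := Submodule.exists_mem_ne_zero_of_ne_bot hL
  have on : ∀ i, evp (W i) p * (W i).2.1 = evp (W i) q * (W i).2.2 := by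
    intro i
    have h1 := congrFun (LinearMap.mem_ker.1 hpq) i
    simp [L] at h1
    linear_combination h1
  have hne' : ¬ (p = 0 ∧ q = 0) := by
    rintro ⟨rfl, rfl⟩
    exact hne rfl
  replace hp : p.IsWeightedHomogeneous w4 (e + 1, 0) := hp
  replace hq : q.IsWeightedHomogeneous w4 (e + 1, 0) := hq
  have nz : ∀ a b : k × k, a ≠ 0 → ¬ (evp (a, b) p = 0 ∧ evp (a, b) q = 0) := by
    rintro a b ha ⟨h1, h2⟩
    obtain ⟨p', hp', rfl⟩ := lx_quot hp (lx_dvd ha b hp h1)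
    obtain ⟨q', hq', rfl⟩ := lx_quot hq (lx_dvd ha b hq h2)
    have hj : ∃ j, ∀ i, i ≠ j → evp (W i) (lx a) ≠ 0 := by
      by_cases h : ∃ j, evp (W j) (lx a) = 0
      · obtain ⟨j, hj⟩ := h
        refine ⟨j, fun i hij hi => dist i j hij ?_⟩
        simp only [evp, lx, map_sub, map_mul, algHom_C, aeval_X] at hi hj
        simp at hi hj
        rw [ProjEq]
        by_cases h1 : a.1 = 0
        · have h2 : a.2 ≠ 0 := fun h => ha (Prod.ext h1 h)
          simp [h1, h2] at hi hj
          simp [hi, hj]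
        · apply mul_left_cancel₀ h1
          linear_combination (W i).1.1 * (- hj) + (W j).1.1 * hi
      · push Not at h
        exact ⟨0, fun i _ => h i⟩
    obtain ⟨j, hj⟩ := hj
    obtain ⟨rfl, rfl⟩ := hno p' q' hp' hq' j fun i hi => by
      have := on i
      rw [map_mul, map_mul] at this
      apply mul_left_cancel₀ (hj i hi)
      linear_combination this
    simp at hne'
  have hrel := relprime_of_no_zero nz
  refine ⟨p, q, hp, hq, ?_, hrel, rep, fun i => nz (W i).1 (W i).2 (rep i).1, on, dist⟩
  rintro rfl
  rw [isRelPrime_zero_left] at hrel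
  have h1 := hrel.map (evp ((0, 0), (0, 0)))
  have h2 := aeval_scale (A := k) 0 0 0 0 0 0 hq
  simp only [mul_zero, zero_pow (Nat.succ_ne_zero e), zero_mul] at h2
  simp only [evp] at h1
  rw [h2] at h1
  simp at h1

lemma biH_00 {f : MvPolynomial (Fin 4) k} (hf : f.IsWeightedHomogeneous w4 (0, 0)) :
    ∃ c, f = C c := by
  refine biH_induction (P := fun f => ∃ c, f = C c) ⟨0, by simp⟩ ?_ ?_ hf
  · rintro _ _ ⟨c, rfl⟩ ⟨d, rfl⟩; exact ⟨c + d, by simp⟩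
  · intro c u u' v v' h1 h2
    obtain ⟨rfl, rfl⟩ : u = 0 ∧ u' = 0 := by omega
    obtain ⟨rfl, rfl⟩ : v = 0 ∧ v' = 0 := by omega
    exact ⟨c, by simp⟩

lemma exists_curve_zero [IsAlgClosed k] (W : Fin 3 → (k × k) × (k × k))
    (rep : ∀ i, IsPtRep k (W i))
    (dist : ∀ i j, i ≠ j → ¬ ProjEq k (W i).1 (W j).1)
    (dist' : ∀ i j, i ≠ j → ¬ ProjEq k (W i).2 (W j).2) : ∃ p q, Curve 0 W p q := by
  refine exists_curve 0 W (by norm_num) rep dist ?_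
  intro p' q' hp hq j hj
  obtain ⟨c, rfl⟩ := biH_00 hp
  obtain ⟨d, rfl⟩ := biH_00 hq
  obtain ⟨i, i', hi, hi', hii⟩ : ∃ i i' : Fin 3, i ≠ j ∧ i' ≠ j ∧ i ≠ i' := by
    fin_cases j
    · exact ⟨1, 2, by decide⟩
    · exact ⟨0, 2, by decide⟩
    · exact ⟨0, 1, by decide⟩
  have h1 := hj i hi
  have h2 := hj i' hi'
  have h3 := dist' i i' hii
  rw [ProjEq, ← sub_eq_zero] at h3
  simp only [algHom_C] at h1 h2
  simp at h1 h2
  constructor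
  · have : c = 0 := by
      apply (mul_eq_zero.1 (_ : c * ((W i).2.1 * (W i').2.2 - (W i).2.2 * (W i').2.1) = 0)).resolve_right h3
      linear_combination (W i').2.2 * h1 - (W i).2.2 * h2
    simp [this]
  · have : d = 0 := by
      apply (mul_eq_zero.1 (_ : d * ((W i).2.1 * (W i').2.2 - (W i).2.2 * (W i').2.1) = 0)).resolve_right h3
      linear_combination (W i').2.1 * h1 - (W i).2.1 * h2
    simp [this]

lemma biH_lxx (a : k × k) : (lx a : MvPolynomial (Fin 4) k).IsWeightedHomogeneous w4 (1, 0) :=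
  biH_lin _ _

lemma Gen.dist {N s : ℕ} {Z : Fin s → (k × k) × (k × k)} (h : Gen N Z) (hN : 2 ≤ N)
    (rep : ∀ i, IsPtRep k (Z i)) {i j : Fin s} (hij : i ≠ j) : ¬ ProjEq k (Z i).1 (Z j).1 := by
  intro hp
  have h1 := h.eq_zero (a := 1) (b := 0) (by omega) (by omega) (t := 2) (by norm_num)
    ⟨![i, j], by intro x y; fin_cases x <;> fin_cases y <;> simp [hij, hij.symm]⟩
    (biH_lxx (Z i).1) (by
      intro x
      rw [ProjEq] at hp
      fin_cases x
      · change evp (Z i) _ = 0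
        simp [evp, lx]; ring
      · change evp (Z j) _ = 0
        simp [evp, lx]; linear_combination -hp)
  exact lx_ne_zero (rep i).1 h1

lemma ly_ne_zero {a : k × k} (ha : a ≠ 0) : (ly a : MvPolynomial (Fin 4) k) ≠ 0 := by
  intro h
  apply ha
  have h0 := congrArg (evp ((0, 0), (1, 0))) h
  have h1 := congrArg (evp ((0, 0), (0, 1))) h
  simp [ly, evp] at h0 h1
  exact Prod.ext h1 h0

lemma Gen.dist' {N s : ℕ} {Z : Fin s → (k × k) × (k × k)} (h : Gen N Z) (hN : 2 ≤ N)
    (rep : ∀ i, IsPtRep k (Z i)) {i j : Fin s} (hij : i ≠ j) : ¬ ProjEq k (Z i).2 (Z j).2 := by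
  intro hp
  have h1 := h.eq_zero (a := 0) (b := 1) (by omega) (by omega) (t := 2) (by norm_num)
    ⟨![i, j], by intro x y; fin_cases x <;> fin_cases y <;> simp [hij, hij.symm]⟩
    (f := ly (Z i).2) (biH_lin' _ _) (by
      intro x
      rw [ProjEq] at hp
      fin_cases x
      · change evp (Z i) _ = 0
        simp [evp, ly]; ring
      · change evp (Z j) _ = 0
        simp [evp, ly]; linear_combination -hp)
  exact ly_ne_zero (rep i).2 h1

lemma eq_one (Z : Fin 1 → (k × k) × (k × k)) (m : ℕ) :
    idealOfPoints k Z ^ m = symbolicPower k Z m := by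
  simp [idealOfPoints, symbolicPower]

lemma eq_two [IsAlgClosed k] {N : ℕ} {Z : Fin 2 → (k × k) × (k × k)} (h : Gen N Z) (hN : 2 ≤ N)
    (rep : ∀ i, IsPtRep k (Z i)) (m : ℕ) : idealOfPoints k Z ^ m = symbolicPower k Z m := by
  have d1 := h.dist hN rep (i := 0) (j := 1) (by decide)
  have d2 := h.dist' hN rep (i := 0) (j := 1) (by decide)
  have r0 := rep 0
  have r1 := rep 1
  simp only [ProjEq] at d1 d2
  obtain ⟨p, q, c⟩ := exists_curve_zero ![Z 0, Z 1, Z 0 + Z 1] (by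
      intro i
      fin_cases i
      · exact r0
      · exact r1
      · refine ⟨fun h => d1 ?_, fun h => d2 ?_⟩
        · have e1 := congrArg Prod.fst h
          have e2 := congrArg Prod.snd h
          simp at e1 e2
          linear_combination (Z 1).1.2 * e1 - (Z 1).1.1 * e2
        · have e1 := congrArg Prod.fst h
          have e2 := congrArg Prod.snd h
          simp at e1 e2
          linear_combination (Z 1).2.2 * e1 - (Z 1).2.1 * e2) (by
      intro i j hij hp
      apply d1
      simp only [ProjEq] at hp
      fin_cases i <;> fin_cases j <;> simp at hij <;> simp at hp
      · exact hp
      · linear_combination hp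
      · linear_combination -hp
      · linear_combination -hp
      · linear_combination -hp
      · linear_combination hp) (by
      intro i j hij hp
      apply d2
      simp only [ProjEq] at hp
      fin_cases i <;> fin_cases j <;> simp at hij <;> simp at hp
      · exact hp
      · linear_combination hp
      · linear_combination -hp
      · linear_combination -hp
      · linear_combination -hp
      · linear_combination hp)
  refine eq_of_curve_zero (p := p) (q := q) ⟨c.hp, c.hq, c.hp0, c.hpq, rep, ?_, ?_, ?_⟩ m
  · intro i
    fin_cases i
    · exact c.nz 0
    · exact c.nz 1
  · intro i
    fin_cases i
    · exact c.on 0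
    · exact c.on 1
  · intro i j hij
    exact h.dist hN rep hij

lemma eq_three [IsAlgClosed k] {N : ℕ} {Z : Fin 3 → (k × k) × (k × k)} (h : Gen N Z) (hN : 2 ≤ N)
    (rep : ∀ i, IsPtRep k (Z i)) (m : ℕ) : idealOfPoints k Z ^ m = symbolicPower k Z m := by
  obtain ⟨p, q, c⟩ := exists_curve_zero Z rep (fun i j hij => h.dist hN rep hij)
    (fun i j hij => h.dist' hN rep hij)
  exact eq_of_curve_zero c m

lemma curve_form_zero {p' q' : MvPolynomial (Fin 4) k} {e : ℕ}
    (hp : p'.IsWeightedHomogeneous w4 (e, 0)) (hq : q'.IsWeightedHomogeneous w4 (e, 0))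
    (h : p' * X 2 - q' * X 3 = 0) : p' = 0 ∧ q' = 0 := by
  constructor
  · have h1 := congrArg (aeval (R := k) ![X 0, X 1, (1 : MvPolynomial (Fin 4) k), 0]) h
    rw [map_sub, map_mul, map_mul, biH_no_X3 hp ![X 0, X 1, 1, 0] rfl rfl] at h1
    simpa using h1
  · have h1 := congrArg (aeval (R := k) ![X 0, X 1, (0 : MvPolynomial (Fin 4) k), 1]) h
    rw [map_sub, map_mul, map_mul, biH_no_X3 hq ![X 0, X 1, 0, 1] rfl rfl] at h1
    simpa using h1

lemma evp_swp (p : (k × k) × (k × k)) (f : MvPolynomial (Fin 4) k) :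
    evp p (swp f) = evp p.swap f := by
  have : (evp p).comp swp = evp p.swap := by
    ext i
    fin_cases i <;> simp [evp, swp]
  exact congrArg (fun F => F f) this

lemma eq_five [IsAlgClosed k] {N : ℕ} {Z : Fin 5 → (k × k) × (k × k)} (h : Gen N Z) (hN : 2 ≤ N)
    (rep : ∀ i, IsPtRep k (Z i)) (m : ℕ) : idealOfPoints k Z ^ m = symbolicPower k Z m := by
  obtain ⟨p, q, c⟩ := exists_curve 1 Z (by norm_num) rep (fun i j hij => h.dist hN rep hij) (by
    intro p' q' hp' hq' j hj
    refine curve_form_zero hp' hq' (h.eq_zero (a := 1) (b := 1) (by omega) (by omega) (t := 4)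
      (by norm_num) (Fin.succAboveEmb j) ((hp'.mul biH_X2).sub (hq'.mul biH_X3)) ?_)
    intro i
    have := hj (Fin.succAboveEmb j i) (Fin.succAbove_ne j i)
    rw [map_sub, map_mul, map_mul, sub_eq_zero]
    simpa [evp] using this)
  obtain ⟨p', q', c'⟩ := exists_curve 1 (fun i => (Z i).swap) (by norm_num)
    (fun i => (rep i).symm) (fun i j hij => h.dist' hN rep hij) (by
    intro p' q' hp' hq' j hj
    refine curve_form_zero hp' hq' ?_
    rw [← swp_swp (p' * X 2 - q' * X 3), h.eq_zero (a := 1) (b := 1) (by omega) (by omega) (t := 4)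
      (by norm_num) (Fin.succAboveEmb j) (swp_biH ((hp'.mul biH_X2).sub (hq'.mul biH_X3))), map_zero]
    intro i
    have := hj (Fin.succAboveEmb j i) (Fin.succAbove_ne j i)
    rw [evp_swp, map_sub, map_mul, map_mul, sub_eq_zero]
    simpa [evp] using this)
  exact eq_of_curve_one c c' m
end SymPow

namespace SymPow
variable {k : Type*} [Field k]
lemma biH_degree {a b : ℕ} {f : MvPolynomial (Fin 4) k} (hf : f.IsWeightedHomogeneous w4 (a, b))
    {x : Fin 4 →₀ ℕ} (hx : coeff x f ≠ 0) : x.degree = a + b := by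
  have hr := hf hx
  rw [Finsupp.weight_apply, Finsupp.sum_fintype _ _ (by simp), Fin.sum_univ_four] at hr
  simp [w4] at hr
  rw [Finsupp.degree_eq_sum, Fin.sum_univ_four]
  omega

lemma mem_ideal_iff {s : ℕ} {Z : Fin s → (k × k) × (k × k)} (rep : ∀ i, IsPtRep k (Z i))
    {a b : ℕ} {f : MvPolynomial (Fin 4) k} (hf : f.IsWeightedHomogeneous w4 (a, b)) :
    f ∈ idealOfPoints k Z ↔ ∀ i, evp (Z i) f = 0 := by
  rw [idealOfPoints, Ideal.mem_iInf]
  exact forall_congr' fun i => mem_point_iff (rep i) hf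

lemma ne_four {N : ℕ} {Z : Fin 4 → (k × k) × (k × k)} (h : Gen N Z) (hN : 3 ≤ N)
    (rep : ∀ i, IsPtRep k (Z i)) : symbolicPower k Z 3 ≠ idealOfPoints k Z ^ 3 := by
  have hD : ∀ i : Fin 4, ∃ D : MvPolynomial (Fin 4) k, D.IsWeightedHomogeneous w4 (1, 1) ∧
      D ≠ 0 ∧ ∀ j, j ≠ i → evp (Z j) D = 0 := by
    intro i
    have hk : LinearMap.ker (ev (Z ∘ i.succAbove) 1 1) ≠ ⊥ := by
      apply LinearMap.ker_ne_bot_of_finrank_lt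
      rw [finrank_RR]
      simp
    obtain ⟨⟨D, hD⟩, h1, h2⟩ := Submodule.exists_mem_ne_zero_of_ne_bot hk
    refine ⟨D, hD, fun h => h2 (Subtype.ext h), fun j hj => ?_⟩
    obtain ⟨l, rfl⟩ := Fin.exists_succAbove_eq hj
    exact congrFun (LinearMap.mem_ker.1 h1) l
  choose D hD1 hD2 hD3 using hD
  intro heq
  have hmem : ∏ i, D i ∈ symbolicPower k Z 3 := by
    rw [symbolicPower, Ideal.mem_iInf]
    intro j
    rw [← Finset.mul_prod_erase _ _ (Finset.mem_univ j)]
    refine Ideal.mul_mem_left _ _ ?_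
    have h1 := Ideal.prod_mem_prod (s := Finset.univ.erase j) (x := D)
      (I := fun _ => pointIdeal k (Z j)) fun i hi =>
      (mem_point_iff (rep j) (hD1 i)).2 (hD3 i j (Finset.ne_of_mem_erase hi).symm)
    rw [Finset.prod_const, Finset.card_erase_of_mem (Finset.mem_univ j)] at h1
    simpa using h1
  rw [heq] at hmem
  have hI : idealOfPoints k Z ≤ idealOfVars (Fin 4) k ^ 3 := by
    refine homI_le (homI_ideal Z) fun a b f hf hab => ?_
    by_cases hd : a + b ≤ 2
    · have : f = 0 := by
        refine h.eq_zero (a := a) (b := b) (by omega) (by omega) (t := 4) ?_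
          (Function.Embedding.refl _) hab ((mem_ideal_iff rep hab).1 hf)
        obtain rfl | rfl | rfl : a = 0 ∨ a = 1 ∨ a = 2 := by omega
        all_goals omega
      rw [this]; exact zero_mem _
    · rw [mem_pow_idealOfVars_iff']
      intro x hx
      by_contra hc
      have := biH_degree hab hc
      omega
  have h9 := Ideal.pow_right_mono hI 3 hmem
  rw [← pow_mul, mem_pow_idealOfVars_iff'] at h9
  have hne : ∏ i, D i ≠ 0 := Finset.prod_ne_zero_iff.2 fun i _ => hD2 i
  obtain ⟨x, hx⟩ := ne_zero_iff.1 hne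
  have hH : (∏ i, D i).IsWeightedHomogeneous w4 (4, 4) := by
    have := IsWeightedHomogeneous.prod Finset.univ D (fun _ => (1, 1)) fun i _ => hD1 i
    simpa using this
  have h8 := biH_degree hH hx
  exact hx (h9 x (by omega))
end SymPow

namespace SymPow
variable {k : Type*} [Field k]
/-- The forms of bidegree `(a,b)` in an ideal. -/
def VV (J : Ideal (MvPolynomial (Fin 4) k)) (a b : ℕ) : Submodule k (MvPolynomial (Fin 4) k) :=
  (Submodule.restrictScalars k J) ⊓ RR k a b

instance (J : Ideal (MvPolynomial (Fin 4) k)) (a b : ℕ) : FiniteDimensional k (VV J a b) :=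
  Submodule.finiteDimensional_of_le (inf_le_right : VV J a b ≤ RR k a b)

lemma mem_VV {J : Ideal (MvPolynomial (Fin 4) k)} {a b : ℕ} {f : MvPolynomial (Fin 4) k} :
    f ∈ VV J a b ↔ f ∈ J ∧ f.IsWeightedHomogeneous w4 (a, b) := Iff.rfl

lemma finrank_VV_le {N s : ℕ} {Z : Fin s → (k × k) × (k × k)} (h : Gen N Z)
    (rep : ∀ i, IsPtRep k (Z i)) {a b : ℕ} (ha : a < N) (hb : b < N) :
    Module.finrank k (VV (idealOfPoints k Z) a b) ≤ (a + 1) * (b + 1) - s := by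
  have h1 := h.finrank_ker ha hb (Function.Embedding.refl (Fin s))
  refine le_trans ?_ h1
  rw [← Submodule.finrank_map_subtype_eq]
  apply Submodule.finrank_mono
  rintro f ⟨hf, hf'⟩
  refine ⟨⟨f, hf'⟩, ?_, rfl⟩
  rw [SetLike.mem_coe, LinearMap.mem_ker]
  funext j
  exact (mem_ideal_iff rep hf').1 hf j

lemma finrank_mul_le' (M N : Submodule k (MvPolynomial (Fin 4) k)) [FiniteDimensional k M]
    [FiniteDimensional k N] :
    Module.finrank k (M * N : Submodule k (MvPolynomial (Fin 4) k)) ≤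
      Module.finrank k M * Module.finrank k N := by
  rw [← Submodule.mulMap_range]
  refine le_trans (LinearMap.finrank_range_le _) ?_
  rw [Module.finrank_tensorProduct]

instance (M N : Submodule k (MvPolynomial (Fin 4) k)) [FiniteDimensional k M]
    [FiniteDimensional k N] :
    FiniteDimensional k (M * N : Submodule k (MvPolynomial (Fin 4) k)) := by
  rw [← Submodule.mulMap_range]
  infer_instance

lemma finrank_sup_le {ι : Type*} (L : Finset ι) (S : ι → Submodule k (MvPolynomial (Fin 4) k))
    [∀ i, FiniteDimensional k (S i)] :
    Module.finrank k (L.sup S : Submodule k (MvPolynomial (Fin 4) k)) ≤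
      ∑ i ∈ L, Module.finrank k (S i) := by
  classical
  induction L using Finset.induction_on with
  | empty => simp
  | insert i L hi ih =>
    rw [Finset.sup_insert, Finset.sum_insert hi]
    exact le_trans (Submodule.finrank_add_le_finrank_add_finrank _ _) (by omega)

/-- Bihomogeneous elements of `J * J` are sums of products of bihomogeneous elements of `J`. -/
lemma sq_le {J : Ideal (MvPolynomial (Fin 4) k)} (hJ : HomI J) {i j : ℕ}
    {T : Submodule k (MvPolynomial (Fin 4) k)}
    (hT : ∀ a ≤ i, ∀ b ≤ j, VV J a b * VV J (i - a) (j - b) ≤ T) : VV (J ^ 2) i j ≤ T := by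
  have key : ∀ g ∈ J, ∀ h ∈ J, weightedHomogeneousComponent w4 (i, j) (g * h) ∈ T := by
    intro g hg h hh
    rw [← sum_weightedHomogeneousComponent w4 g]
    refine finsum_induction (fun g => weightedHomogeneousComponent w4 (i, j) (g * h) ∈ T)
      (by simp) (fun x y hx hy => by rw [add_mul, map_add]; exact add_mem hx hy) fun d => ?_
    rw [← sum_weightedHomogeneousComponent w4 h]
    refine finsum_induction (fun h => weightedHomogeneousComponent w4 (i, j)
      (weightedHomogeneousComponent w4 d g * h) ∈ T)
      (by simp) (fun x y hx hy => by rw [mul_add, map_add]; exact add_mem hx hy) fun e => ?_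
    have h1 := weightedHomogeneousComponent_isWeightedHomogeneous (w := w4) d g
    have h2 := weightedHomogeneousComponent_isWeightedHomogeneous (w := w4) e h
    have h3 := h1.mul h2
    by_cases hde : d + e = (i, j)
    · rw [← hde, h3.weightedHomogeneousComponent_same]
      obtain ⟨a, b⟩ := d
      obtain ⟨c, c'⟩ := e
      simp only [Prod.mk_add_mk, Prod.mk.injEq] at hde
      have h4 := Submodule.mul_mem_mul (mem_VV.2 ⟨hJ g hg _, h1⟩) (mem_VV.2 ⟨hJ h hh _, h2⟩)
      have h5 := hT a (by omega) b (by omega)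
      rw [show i - a = c by omega, show j - b = c' by omega] at h5
      exact h5 h4
    · rw [h3.weightedHomogeneousComponent_ne _ (Ne.symm hde)]
      exact zero_mem _
  rintro f ⟨hf, hf'⟩
  rw [← IsWeightedHomogeneous.weightedHomogeneousComponent_same hf']
  have hf2 : f ∈ J * J := by rw [← pow_two]; exact hf
  refine Submodule.mul_induction_on (C := fun f => weightedHomogeneousComponent w4 (i, j) f ∈ T)
    hf2 key fun x y hx hy => ?_
  rw [map_add]; exact add_mem hx hy

/-- First order truncation of forms of degree `n` in `m`, `l`. -/
def EE (l m : MvPolynomial (Fin 4) k) : ℕ → MvPolynomial (Fin 4) k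
  | 0 => 0
  | n + 1 => m ^ n * l

lemma EE_dvd (l m : MvPolynomial (Fin 4) k) (n : ℕ) : l ∣ EE l m n := by
  cases n with
  | zero => exact dvd_zero _
  | succ n => exact Dvd.intro_left _ rfl

/-- Congruent to a combination of the first two terms modulo `l ^ 2`. -/
def Trunc (l m : MvPolynomial (Fin 4) k) (n : ℕ) (f : MvPolynomial (Fin 4) k) : Prop :=
  ∃ c d : k, l ^ 2 ∣ f - (C c * m ^ n + C d * EE l m n)

lemma Trunc.mul_lin {l m f : MvPolynomial (Fin 4) k} {n : ℕ} (h : Trunc l m n f) (α β : k) :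
    Trunc l m (n + 1) (f * (C α * m + C β * l)) := by
  obtain ⟨c, d, h⟩ := h
  cases n with
  | zero =>
    refine ⟨c * α, c * β, ?_⟩
    convert h.mul_right (C α * m + C β * l) using 1
    simp [EE]
    ring
  | succ n =>
    refine ⟨c * α, c * β + d * α, ?_⟩
    have h1 := (h.mul_right (C α * m + C β * l)).add (Dvd.intro_left (C d * C β * m ^ n) rfl :
      l ^ 2 ∣ C d * C β * m ^ n * l ^ 2)
    convert h1 using 1
    simp [EE]
    ring

lemma Trunc.mul_pow {l m f x : MvPolynomial (Fin 4) k} {n : ℕ} (h : Trunc l m n f) {α β : k}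
    (hx : x = C α * m + C β * l) (u : ℕ) : Trunc l m (n + u) (f * x ^ u) := by
  induction u with
  | zero => simpa using h
  | succ u ih =>
    have := ih.mul_lin α β
    rw [← hx] at this
    rw [pow_succ, ← mul_assoc]
    exact this

lemma trunc_mon {l m x y : MvPolynomial (Fin 4) k} {α β α' β' : k}
    (hx : x = C α * m + C β * l) (hy : y = C α' * m + C β' * l) (u u' : ℕ) :
    Trunc l m (u + u') (x ^ u * y ^ u') := by
  have h0 : Trunc l m 0 1 := ⟨1, 0, by simp⟩
  have := (h0.mul_pow hx u).mul_pow hy u'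
  simpa using this

lemma codim_aux {V : Type*} [AddCommGroup V] [Module k V] (W K : Submodule k V)
    [FiniteDimensional k W] (S : Finset V) (hW : W ≤ K ⊔ Submodule.span k (S : Set V)) :
    Module.finrank k W ≤ Module.finrank k (W ⊓ K : Submodule k V) + S.card := by
  have h1 := LinearMap.finrank_range_add_finrank_ker (K.mkQ ∘ₗ W.subtype)
  have : FiniteDimensional k (Submodule.span k (S : Set V)) := FiniteDimensional.span_finset k S
  have h2 : Module.finrank k (LinearMap.range (K.mkQ ∘ₗ W.subtype)) ≤ S.card := by
    have hle : LinearMap.range (K.mkQ ∘ₗ W.subtype) ≤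
        (Submodule.span k (S : Set V)).map K.mkQ := by
      rw [LinearMap.range_comp, Submodule.range_subtype]
      refine le_trans (Submodule.map_mono hW) ?_
      rw [Submodule.map_sup, Submodule.mkQ_map_self, bot_sup_eq]
    refine le_trans (Submodule.finrank_mono hle) (le_trans (Submodule.finrank_map_le _ _) ?_)
    exact finrank_span_finset_le_card S
  have h3 : Module.finrank k (LinearMap.ker (K.mkQ ∘ₗ W.subtype)) ≤
      Module.finrank k (W ⊓ K : Submodule k V) := by
    rw [← Submodule.finrank_map_subtype_eq]
    apply Submodule.finrank_mono
    rintro _ ⟨⟨g, hg⟩, hg', rfl⟩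
    refine ⟨hg, ?_⟩
    rw [SetLike.mem_coe, LinearMap.mem_ker] at hg'
    simpa using hg'
  omega

lemma codim_family {V ι : Type*} [AddCommGroup V] [Module k V] (W : Submodule k V)
    [FiniteDimensional k W] (K : ι → Submodule k V)
    (hK : ∀ t, ∃ S : Finset V, S.card ≤ 3 ∧ W ≤ K t ⊔ Submodule.span k (S : Set V))
    (F : Finset ι) :
    Module.finrank k W ≤ Module.finrank k (W ⊓ F.inf K : Submodule k V) + 3 * F.card := by
  classical
  induction F using Finset.induction_on with
  | empty => rw [Finset.inf_empty, inf_top_eq]; exact Nat.le_add_right _ _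
  | insert t F ht ih =>
    obtain ⟨S, hS, hS'⟩ := hK t
    have : FiniteDimensional k (W ⊓ F.inf K : Submodule k V) :=
      Submodule.finiteDimensional_of_le (inf_le_left : W ⊓ F.inf K ≤ W)
    have h1 := codim_aux (W ⊓ F.inf K) (K t) S (le_trans inf_le_left hS')
    rw [Finset.inf_insert, Finset.card_insert_of_notMem ht,
      show W ⊓ (K t ⊓ F.inf K) = W ⊓ F.inf K ⊓ K t by rw [inf_assoc, inf_comm (K t)]]
    omega

/-- The `(i,j)`-forms modulo the square of a point ideal are spanned by three elements. -/
lemma codim_le {p : (k × k) × (k × k)} (hp : IsPtRep k p) (i j : ℕ) :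
    ∃ S : Finset (MvPolynomial (Fin 4) k), S.card ≤ 3 ∧
      RR k i j ≤ Submodule.restrictScalars k (pointIdeal k p ^ 2) ⊔
        Submodule.span k (S : Set (MvPolynomial (Fin 4) k)) := by
  classical
  obtain ⟨q, hq⟩ := exists_Compl hp
  refine ⟨{mx q.1 ^ i * my q.2 ^ j, EE (lx p.1) (mx q.1) i * my q.2 ^ j,
      mx q.1 ^ i * EE (ly p.2) (my q.2) j}, Finset.card_le_three, ?_⟩
  intro f hf
  refine biH_induction (zero_mem _) (fun f g hf hg => add_mem hf hg) ?_ hf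
  · clear hf f
    intro c u u' v v' h1 h2
    subst h1 h2
    obtain ⟨c1, d1, g1, hg1⟩ := trunc_mon (l := lx p.1) (m := mx q.1) (x := X 0) (y := X 1)
      (α := p.1.1) (β := q.1.1) (α' := p.1.2) (β' := q.1.2)
      (by rw [← x0_eq hq.1]; ring) (by rw [← x1_eq hq.1]; ring) u u'
    obtain ⟨c2, d2, g2, hg2⟩ := trunc_mon (l := ly p.2) (m := my q.2) (x := X 2) (y := X 3)
      (α := p.2.1) (β := q.2.1) (α' := p.2.2) (β' := q.2.2)
      (by rw [← y0_eq hq.2]; ring) (by rw [← y1_eq hq.2]; ring) v v'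
    obtain ⟨e1, he1⟩ := EE_dvd (lx p.1) (mx q.1) (u + u')
    obtain ⟨e2, he2⟩ := EE_dvd (ly p.2) (my q.2) (v + v')
    have hll : lx p.1 ^ 2 ∈ pointIdeal k p ^ 2 := Ideal.pow_mem_pow (lx_mem p) 2
    have hyy : ly p.2 ^ 2 ∈ pointIdeal k p ^ 2 := Ideal.pow_mem_pow (ly_mem p) 2
    have hly : lx p.1 * ly p.2 ∈ pointIdeal k p ^ 2 := by
      rw [pow_two]; exact Ideal.mul_mem_mul (lx_mem p) (ly_mem p)
    have hmem : (C c * (X 0 ^ u * X 1 ^ u' * X 2 ^ v * X 3 ^ v')) -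
        ((c * c1 * c2) • (mx q.1 ^ (u + u') * my q.2 ^ (v + v')) +
         (c * d1 * c2) • (EE (lx p.1) (mx q.1) (u + u') * my q.2 ^ (v + v')) +
         (c * c1 * d2) • (mx q.1 ^ (u + u') * EE (ly p.2) (my q.2) (v + v'))) ∈
        pointIdeal k p ^ 2 := by
      have h3 : (C c * (X 0 ^ u * X 1 ^ u' * X 2 ^ v * X 3 ^ v')) -
        ((c * c1 * c2) • (mx q.1 ^ (u + u') * my q.2 ^ (v + v')) +
         (c * d1 * c2) • (EE (lx p.1) (mx q.1) (u + u') * my q.2 ^ (v + v')) +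
         (c * c1 * d2) • (mx q.1 ^ (u + u') * EE (ly p.2) (my q.2) (v + v'))) =
         (C c * g1 * (X 2 ^ v * X 3 ^ v')) * lx p.1 ^ 2 +
         (C c * g2 * (C c1 * mx q.1 ^ (u + u') + C d1 * EE (lx p.1) (mx q.1) (u + u'))) *
            ly p.2 ^ 2 + (C c * C d1 * C d2 * e1 * e2) * (lx p.1 * ly p.2) := by
        have h4 : C c * C d1 * C d2 * e1 * e2 * (lx p.1 * ly p.2) = C c * C d1 * C d2 *
            EE (lx p.1) (mx q.1) (u + u') * EE (ly p.2) (my q.2) (v + v') := by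
          rw [he1, he2]; ring
        rw [h4]
        simp only [smul_eq_C_mul, map_mul]
        linear_combination (C c * (X 2 ^ v * X 3 ^ v')) * hg1 + (C c * (C c1 * mx q.1 ^ (u + u') +
          C d1 * EE (lx p.1) (mx q.1) (u + u'))) * hg2
      rw [h3]
      exact add_mem (add_mem (Ideal.mul_mem_left _ _ hll) (Ideal.mul_mem_left _ _ hyy))
        (Ideal.mul_mem_left _ _ hly)
    rw [← sub_add_cancel (C c * (X 0 ^ u * X 1 ^ u' * X 2 ^ v * X 3 ^ v')) ((c * c1 * c2) • (mx q.1 ^ (u + u') * my q.2 ^ (v + v')) +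
         (c * d1 * c2) • (EE (lx p.1) (mx q.1) (u + u') * my q.2 ^ (v + v')) +
         (c * c1 * d2) • (mx q.1 ^ (u + u') * EE (ly p.2) (my q.2) (v + v')))]
    refine Submodule.add_mem_sup hmem (add_mem (add_mem ?_ ?_) ?_)
    · exact Submodule.smul_mem _ _ (Submodule.subset_span (by simp))
    · exact Submodule.smul_mem _ _ (Submodule.subset_span (by simp))
    · exact Submodule.smul_mem _ _ (Submodule.subset_span (by simp))

lemma finrank_symb_ge {s : ℕ} {Z : Fin s → (k × k) × (k × k)} (rep : ∀ i, IsPtRep k (Z i))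
    (i j : ℕ) : (i + 1) * (j + 1) ≤ Module.finrank k (VV (symbolicPower k Z 2) i j) + 3 * s := by
  have h1 := codim_family (RR k i j)
    (fun t => Submodule.restrictScalars k (pointIdeal k (Z t) ^ 2))
    (fun t => codim_le (rep t) i j) Finset.univ
  rw [finrank_RR, Finset.card_univ, Fintype.card_fin] at h1
  refine le_trans h1 (Nat.add_le_add_right (Submodule.finrank_mono ?_) _)
  rintro g ⟨hg, hg'⟩
  refine ⟨?_, hg⟩
  change g ∈ symbolicPower k Z 2
  rw [symbolicPower, Ideal.mem_iInf]
  intro t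
  exact Finset.inf_le (f := fun t => Submodule.restrictScalars k (pointIdeal k (Z t) ^ 2))
    (Finset.mem_univ t) hg'

lemma finrank_sq_le {s i j : ℕ} {J : Ideal (MvPolynomial (Fin 4) k)} (hJ : HomI J)
    (hr : ∀ a ≤ i, ∀ b ≤ j, Module.finrank k (VV J a b) ≤ (a + 1) * (b + 1) - s)
    (L : Finset (ℕ × ℕ)) (hL : ∀ x ∈ L, x.1 ≤ i ∧ x.2 ≤ j)
    (hbox : ∀ a ≤ i, ∀ b ≤ j, (a + 1) * (b + 1) ≤ s ∨ (i - a + 1) * (j - b + 1) ≤ s ∨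
      (a, b) ∈ L ∨ (i - a, j - b) ∈ L) :
    Module.finrank k (VV (J ^ 2) i j) ≤
      ∑ x ∈ L, ((x.1 + 1) * (x.2 + 1) - s) * ((i - x.1 + 1) * (j - x.2 + 1) - s) := by
  have hz : ∀ a b, a ≤ i → b ≤ j → (a + 1) * (b + 1) ≤ s → VV J a b = ⊥ := by
    intro a b ha hb hab
    have := hr a ha b hb
    rw [Nat.sub_eq_zero_of_le hab, Nat.le_zero] at this
    exact Submodule.finrank_eq_zero.1 this
  obtain ⟨T, hT⟩ : ∃ T : ℕ × ℕ → Submodule k (MvPolynomial (Fin 4) k), ∀ x, T x =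
    VV J x.1 x.2 * VV J (i - x.1) (j - x.2) := ⟨_, fun _ => rfl⟩
  have : ∀ x, FiniteDimensional k (T x) := fun x => by rw [hT]; infer_instance
  have hle : VV (J ^ 2) i j ≤ L.sup T := by
    refine sq_le hJ fun a ha b hb => ?_
    rcases hbox a ha b hb with h1 | h1 | h1 | h1
    · rw [hz a b ha hb h1, Submodule.bot_mul]; exact bot_le
    · rw [hz (i - a) (j - b) (by omega) (by omega) h1, Submodule.mul_bot]; exact bot_le
    · refine le_trans (le_of_eq ?_) (Finset.le_sup (f := T) h1)
      rw [hT]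
    · refine le_trans (le_of_eq ?_) (Finset.le_sup (f := T) h1)
      rw [hT, show i - (i - a) = a by omega, show j - (j - b) = b by omega, Submodule.mul_comm]
  have : FiniteDimensional k (L.sup T : Submodule k (MvPolynomial (Fin 4) k)) :=
    Submodule.finiteDimensional_finset_sup L T
  refine le_trans (Submodule.finrank_mono hle) (le_trans (finrank_sup_le L T) ?_)
  refine Finset.sum_le_sum fun x hx => ?_
  have := hL x hx
  rw [hT]
  exact le_trans (finrank_mul_le' _ _) (Nat.mul_le_mul
      (hr _ (by omega) _ (by omega)) (hr _ (by omega) _ (by omega)))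

lemma ne_sq {N s : ℕ} {Z : Fin s → (k × k) × (k × k)} (h : Gen N Z)
    (rep : ∀ i, IsPtRep k (Z i)) {i j : ℕ} (hi : i < N) (hj : j < N) (L : Finset (ℕ × ℕ))
    (hL : ∀ x ∈ L, x.1 ≤ i ∧ x.2 ≤ j)
    (hbox : ∀ a ≤ i, ∀ b ≤ j, (a + 1) * (b + 1) ≤ s ∨ (i - a + 1) * (j - b + 1) ≤ s ∨
      (a, b) ∈ L ∨ (i - a, j - b) ∈ L)
    (hsum : ∑ x ∈ L, ((x.1 + 1) * (x.2 + 1) - s) * ((i - x.1 + 1) * (j - x.2 + 1) - s) + 3 * s <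
      (i + 1) * (j + 1)) : symbolicPower k Z 2 ≠ idealOfPoints k Z ^ 2 := by
  intro heq
  have h1 := finrank_symb_ge rep i j
  rw [heq] at h1
  have h2 := finrank_sq_le (s := s) (homI_ideal Z) (i := i) (j := j)
    (fun a ha b hb => finrank_VV_le h rep (by omega) (by omega)) L hL hbox
  omega

lemma ne_six {N s : ℕ} {Z : Fin s → (k × k) × (k × k)} (h : Gen N Z)
    (rep : ∀ i, IsPtRep k (Z i)) (hN : s + 6 ≤ N) (hs : 6 ≤ s) :
    symbolicPower k Z 2 ≠ idealOfPoints k Z ^ 2 := by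
  by_cases h18 : 18 ≤ s
  · refine ne_sq h rep (i := 3) (j := 3 * s / 4) (by omega) (by omega) ∅ (by simp) ?_ ?_
    · intro a ha b hb
      obtain rfl | rfl | rfl | rfl : a = 0 ∨ a = 1 ∨ a = 2 ∨ a = 3 := by omega
      all_goals omega
    · rw [Finset.sum_empty]
      omega
  · obtain ⟨i, j, L, h1, h2, h3, h4, h5⟩ : ∃ (i j : ℕ) (L : Finset (ℕ × ℕ)), i < s + 6 ∧ j < s + 6 ∧
        (∀ x ∈ L, x.1 ≤ i ∧ x.2 ≤ j) ∧
        (∀ a ≤ i, ∀ b ≤ j, (a + 1) * (b + 1) ≤ s ∨ (i - a + 1) * (j - b + 1) ≤ s ∨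
          (a, b) ∈ L ∨ (i - a, j - b) ∈ L) ∧
        ∑ x ∈ L, ((x.1 + 1) * (x.2 + 1) - s) * ((i - x.1 + 1) * (j - x.2 + 1) - s) + 3 * s <
          (i + 1) * (j + 1) := by
      obtain rfl | rfl | rfl | rfl | rfl | rfl | rfl | rfl | rfl | rfl | rfl | rfl :
          s = 6 ∨ s = 7 ∨ s = 8 ∨ s = 9 ∨ s = 10 ∨ s = 11 ∨ s = 12 ∨ s = 13 ∨ s = 14 ∨ s = 15 ∨ s = 16 ∨ s = 17 := by omega
      · exact ⟨3, 4, ∅, by decide⟩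
      · exact ⟨3, 5, {(2, 2)}, by decide⟩
      · exact ⟨4, 5, {(2, 2)}, by decide⟩
      · exact ⟨3, 6, ∅, by decide⟩
      · exact ⟨3, 7, ∅, by decide⟩
      · exact ⟨5, 5, {(2, 3)}, by decide⟩
      · exact ⟨3, 9, ∅, by decide⟩
      · exact ⟨3, 9, ∅, by decide⟩
      · exact ⟨3, 10, ∅, by decide⟩
      · exact ⟨3, 11, ∅, by decide⟩
      · exact ⟨3, 12, ∅, by decide⟩
      · exact ⟨3, 12, ∅, by decide⟩
    exact ne_sq h rep (by omega) (by omega) L h3 h4 h5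
end SymPow

/-- For the ideal `I` of `s ≥ 1` general points of `P^1 × P^1`,
`I^m = I^(m)` for all `m > 0` iff `s ∈ {1, 2, 3, 5}`; moreover `I^(3) ≠ I^3`
when `s = 4` and `I^(2) ≠ I^2` when `s ≥ 6`. -/
theorem symbolic_eq_ordinary_iff_general_points {k : Type*} [Field k] [IsAlgClosed k]
    (s : ℕ) (hs : 1 ≤ s) :
    GeneralPosition k s (fun Z =>
      ((∀ m : ℕ, 0 < m → idealOfPoints k Z ^ m = symbolicPower k Z m) ↔
        (s = 1 ∨ s = 2 ∨ s = 3 ∨ s = 5)) ∧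
      (s = 4 → symbolicPower k Z 3 ≠ idealOfPoints k Z ^ 3) ∧
      (6 ≤ s → symbolicPower k Z 2 ≠ idealOfPoints k Z ^ 2)) := by
  haveI : Infinite k := IsAlgClosed.instInfinite
  refine SymPow.generalPosition_of_gen (s + 10) fun Z rep hne h => ?_
  have h4 : s = 4 → symbolicPower k Z 3 ≠ idealOfPoints k Z ^ 3 := by
    rintro rfl
    exact SymPow.ne_four h (by omega) rep
  have h6 : 6 ≤ s → symbolicPower k Z 2 ≠ idealOfPoints k Z ^ 2 := fun h6 =>
    SymPow.ne_six h rep (by omega) h6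
  refine ⟨⟨fun hm => ?_, ?_⟩, h4, h6⟩
  · by_contra hcon
    have h5 : s = 4 ∨ 6 ≤ s := by omega
    rcases h5 with h5 | h5
    · exact h4 h5 (hm 3 (by omega)).symm
    · exact h6 h5 (hm 2 (by omega)).symm
  · rintro (rfl | rfl | rfl | rfl) m _
    · exact SymPow.eq_one Z m
    · exact SymPow.eq_two h (by omega) rep m
    · exact SymPow.eq_three h (by omega) rep m
    · exact SymPow.eq_five h (by omega) rep m
end
end
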